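/- Let n ≥ 2 and let λ,μ ∈ ℝ satisfy μ > 0 and 2μ + λ > 0. Fix p ∈ (1,∞), ℓ ∈ ℕ₀, and κ > 0. Then there exists a finite constant C = C(n,p,λ,μ,ℓ,κ) > 0 such that for every f = (f_β) ∈ L^p_ℓ(ℝ^{n-1};ℝⁿ), the function u = (u_α) : ℝⁿ₊ → ℝⁿ defined by u_α(x',t) := (4μ/(3μ+λ))(1/ω_{n-1}) ∫_{ℝ^{n-1}} t(|x'-y'|²+t²)^{-n/2} f_α(y') dy' + ((μ+λ)/(3μ+λ))(2n/ω_{n-1}) Σ_{β=1}^n ∫_{ℝ^{n-1}} t (x'-y',t)_α (x'-y',t)_β (|x'-y'|²+t²)^{-(n+2)/2} f_β(y') dy' satisfies: (i) μΔu + (λ+μ)∇(div u) = 0 in ℝⁿ₊; (ii) the nontangential limit of u at (x',0) exists and equals f(x') for almost every x' ∈ ℝ^{n-1}; (iii) N_κ(∇^k u) ∈ L^p(ℝ^{n-1}) for every 0 ≤ k ≤ ℓ, and Σ_{k=0}^ℓ ‖N_κ(∇^k u)‖_{L^p(ℝ^{n-1})} ≤ C ‖f‖_{L^p_ℓ(ℝ^{n-1})}.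 -/

import Mathlib

open MeasureTheory Filter Metric Real
open scoped ENNReal NNReal Topology

noncomputable section

/-- The point `(x', t)` of `ℝⁿ`, where `x' ∈ ℝ^{n-1}` and `t ∈ ℝ` is the last coordinate. -/
def toUp {n : ℕ} (x' : EuclideanSpace ℝ (Fin (n - 1))) (t : ℝ) :
    EuclideanSpace ℝ (Fin n) :=
  (WithLp.equiv 2 (Fin n → ℝ)).symm
    (fun i => if h : (i : ℕ) < n - 1 then x' ⟨i, h⟩ else t)

/-- The first `n-1` coordinates of a point of `ℝⁿ`. -/
def xinit {n : ℕ} (x : EuclideanSpace ℝ (Fin n)) : EuclideanSpace ℝ (Fin (n - 1)) :=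
  (WithLp.equiv 2 (Fin (n - 1) → ℝ)).symm
    (fun i => x ⟨(i : ℕ), Nat.lt_of_lt_of_le i.isLt (Nat.sub_le n 1)⟩)

/-- The last coordinate of a point of `ℝⁿ`. -/
def xlast {n : ℕ} (x : EuclideanSpace ℝ (Fin n)) : ℝ :=
  if h : 0 < n then x ⟨n - 1, by omega⟩ else 0

/-- The upper half space `ℝⁿ₊`. -/
def upperHalfSpace (n : ℕ) : Set (EuclideanSpace ℝ (Fin n)) := {x | 0 < xlast x}

/-- The embedding `Fin (n-1) → Fin n`. -/
def finUp {n : ℕ} (i : Fin (n - 1)) : Fin n :=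
  ⟨(i : ℕ), Nat.lt_of_lt_of_le i.isLt (Nat.sub_le n 1)⟩

/-- The last index of `Fin n`. -/
def lastIdx (n : ℕ) (h : 0 < n) : Fin n := ⟨n - 1, by omega⟩

/-- Partial derivative along the `i`-th coordinate direction. -/
def pd {n : ℕ} {F : Type*} [NormedAddCommGroup F] [NormedSpace ℝ F]
    (i : Fin n) (u : EuclideanSpace ℝ (Fin n) → F) (x : EuclideanSpace ℝ (Fin n)) : F :=
  fderiv ℝ u x (EuclideanSpace.single i 1)

/-- Iterated mixed partial derivative along the string of coordinate directions `d`. -/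
def mpd {n : ℕ} {F : Type*} [NormedAddCommGroup F] [NormedSpace ℝ F]
    (k : ℕ) (d : Fin k → Fin n) (u : EuclideanSpace ℝ (Fin n) → F)
    (x : EuclideanSpace ℝ (Fin n)) : F :=
  iteratedFDeriv ℝ k u x (fun i => EuclideanSpace.single (d i) 1)

/-- The nontangential approach filter for the cone `Γ_κ(x')` (points written as `(y', t)`). -/
def ntFilter {n : ℕ} (κ : ℝ) (x' : EuclideanSpace ℝ (Fin (n - 1))) :
    Filter ((EuclideanSpace ℝ (Fin (n - 1))) × ℝ) :=
  (nhds (x', (0 : ℝ))) ⊓ Filter.principal {q | 0 < q.2 ∧ dist x' q.1 < κ * q.2}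

/-- The nontangential maximal function (aperture `κ`) of `u : ℝⁿ → F`,
as an `ℝ≥0∞`-valued function on `ℝ^{n-1}`. -/
def ntMax {n : ℕ} {F : Type*} [NormedAddCommGroup F] (κ : ℝ)
    (u : EuclideanSpace ℝ (Fin n) → F) (x' : EuclideanSpace ℝ (Fin (n - 1))) : ℝ≥0∞ :=
  ⨆ (y' : EuclideanSpace ℝ (Fin (n - 1))) (t : ℝ) (_ : 0 < t ∧ dist x' y' < κ * t),
    (‖u (toUp y' t)‖₊ : ℝ≥0∞)

/-- The `L^p` norm (`p ∈ (0,∞]`) of an `ℝ≥0∞`-valued function on `ℝ^m`. -/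
def lpNormE {m : ℕ} (g : EuclideanSpace ℝ (Fin m) → ℝ≥0∞) (p : ℝ≥0∞) : ℝ≥0∞ :=
  if p = ∞ then essSup g volume
  else (∫⁻ x', (g x') ^ p.toReal) ^ (1 / p.toReal)

/-- The Hardy–Littlewood maximal function. -/
def hlMax {m : ℕ} {F : Type*} [NormedAddCommGroup F]
    (f : EuclideanSpace ℝ (Fin m) → F) (x' : EuclideanSpace ℝ (Fin m)) : ℝ≥0∞ :=
  ⨆ (r : ℝ) (_ : 0 < r),
    (volume (ball x' r))⁻¹ * ∫⁻ y' in ball x' r, (‖f y'‖₊ : ℝ≥0∞)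

/-- The Legendre-Hadamard ellipticity condition for the coefficient tensor `A`,
where `A r s α β` stands for `a^{αβ}_{rs}`. -/
def LegendreHadamard {n M : ℕ} (A : Fin n → Fin n → Fin M → Fin M → ℂ) : Prop :=
  ∃ κ₀ : ℝ, 0 < κ₀ ∧ ∀ (ξ : Fin n → ℝ) (η : Fin M → ℂ),
    κ₀ * (∑ r, ξ r ^ 2) * (∑ a, ‖η a‖ ^ 2) ≤
      (∑ r, ∑ s, ∑ a, ∑ b, A r s a b * ξ r * ξ s * (starRingEnd ℂ) (η a) * η b).re

/-- `g` is the weak (distributional) mixed partial derivative of `f` of order `k`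
along the string of directions `d`. -/
def IsWeakDeriv {m : ℕ} {F : Type*} [NormedAddCommGroup F] [NormedSpace ℝ F]
    (k : ℕ) (d : Fin k → Fin m) (f g : EuclideanSpace ℝ (Fin m) → F) : Prop :=
  ∀ φ : EuclideanSpace ℝ (Fin m) → ℝ, ContDiff ℝ (⊤ : ℕ∞) φ → HasCompactSupport φ →
    ∫ x', (mpd k d φ x') • f x' = ((-1 : ℝ) ^ k) • ∫ x', φ x' • g x'

/-- The surface area `ω_{n-1}` of the unit sphere `S^{n-1}` in `ℝⁿ`. -/
def sphereArea (n : ℕ) : ℝ :=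
  (n : ℝ) * (volume (ball (0 : EuclideanSpace ℝ (Fin n)) (1 : ℝ))).toReal

/-- The parabolic dilation `F_t(x') = t^{1-n} F(x'/t)` of a matrix-valued kernel. -/
def matDil {n M : ℕ} (P : EuclideanSpace ℝ (Fin (n - 1)) → Matrix (Fin M) (Fin M) ℂ)
    (t : ℝ) (x' : EuclideanSpace ℝ (Fin (n - 1))) : Matrix (Fin M) (Fin M) ℂ :=
  (t ^ ((1 : ℤ) - (n : ℤ))) • P (t⁻¹ • x')

/-- The convolution `(P_t * f)(x')` of a dilated matrix kernel with a `ℂ^M`-valued function. -/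
def matConv {n M : ℕ} (P : EuclideanSpace ℝ (Fin (n - 1)) → Matrix (Fin M) (Fin M) ℂ)
    (f : EuclideanSpace ℝ (Fin (n - 1)) → EuclideanSpace ℂ (Fin M))
    (t : ℝ) (x' : EuclideanSpace ℝ (Fin (n - 1))) : EuclideanSpace ℂ (Fin M) :=
  (WithLp.equiv 2 (Fin M → ℂ)).symm
    (fun γ => ∫ y', ∑ α, matDil P t (x' - y') γ α * f y' α)



section HL
variable {E : Type*} [NormedAddCommGroup E] [NormedSpace ℝ E] [FiniteDimensional ℝ E]
  [MeasureSpace E] [BorelSpace E] [(volume : Measure E).IsAddHaarMeasure]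

/-- Hardy-Littlewood maximal function with closed balls. -/
def mx (w : E → ℝ≥0∞) (x : E) : ℝ≥0∞ :=
  ⨆ (r : ℝ) (_ : 0 < r), (volume (closedBall x r))⁻¹ * ∫⁻ y in closedBall x r, w y

lemma vol_cb (x : E) {r : ℝ} (hr : 0 < r) :
    volume (closedBall x r) = ENNReal.ofReal (r ^ Module.finrank ℝ E) *
      volume (closedBall (0 : E) 1) := by
  rw [Measure.addHaar_closedBall' _ _ hr.le]

lemma vol_cb_pos (x : E) {r : ℝ} (hr : 0 < r) : volume (closedBall x r) ≠ 0 :=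
  (measure_closedBall_pos _ _ hr).ne'

lemma vol_cb_top (x : E) (r : ℝ) : volume (closedBall x r) ≠ ∞ :=
  measure_closedBall_lt_top.ne

lemma le_mx (w : E → ℝ≥0∞) (x : E) {r : ℝ} (hr : 0 < r) :
    ∫⁻ y in closedBall x r, w y ≤ volume (closedBall x r) * mx w x := by
  have h : (volume (closedBall x r))⁻¹ * ∫⁻ y in closedBall x r, w y ≤ mx w x :=
    le_iSup₂_of_le r hr le_rfl
  calc _ = volume (closedBall x r) *
        ((volume (closedBall x r))⁻¹ * ∫⁻ y in closedBall x r, w y) := by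
        rw [← mul_assoc, ENNReal.mul_inv_cancel (vol_cb_pos x hr) (vol_cb_top x r), one_mul]
    _ ≤ _ := by gcongr

lemma mx_weak (hE : 0 < Module.finrank ℝ E) (w : E → ℝ≥0∞) (l : ℝ≥0∞) (hl0 : l ≠ 0) :
    l * volume {x | l < mx w x} ≤ 4 ^ Module.finrank ℝ E * ∫⁻ x, w x := by
  by_cases hI : ∫⁻ x, w x = ∞
  · rw [hI, ENNReal.mul_top (by positivity)]; exact le_top
  by_cases hlt : l = ∞
  · subst hlt; simp
  have h1 : ∀ x : {x | l < mx w x}, ∃ r : ℝ, 0 < r ∧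
      l * volume (closedBall (x : E) r) < ∫⁻ y in closedBall (x : E) r, w y := by
    rintro ⟨x, hx⟩
    simp only [Set.mem_ofPred_eq, mx, lt_iSup_iff] at hx
    obtain ⟨r, hr, h⟩ := hx
    refine ⟨r, hr, ?_⟩
    rw [mul_comm, ← div_eq_mul_inv] at h
    exact (ENNReal.lt_div_iff_mul_lt (Or.inl (vol_cb_pos x hr)) (Or.inl (vol_cb_top x r))).1 h
  choose r hr0 hr using h1
  have hvp : volume (closedBall (0 : E) 1) ≠ 0 := vol_cb_pos _ one_pos
  have hvt : volume (closedBall (0 : E) 1) ≠ ∞ := vol_cb_top _ _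
  set A : ℝ := ((∫⁻ x, w x) / (l * volume (closedBall (0 : E) 1))).toReal with hA
  have hR : ∀ a ∈ (Set.univ : Set {x | l < mx w x}), r a ≤ max 1 A := by
    intro a _
    by_cases h1 : r a ≤ 1
    · exact le_max_of_le_left h1
    refine le_max_of_le_right ?_
    have h2 := (hr a).le.trans (setLIntegral_le_lintegral _ _)
    rw [vol_cb _ (hr0 a)] at h2
    have h3 : ENNReal.ofReal (r a ^ Module.finrank ℝ E) ≤
        (∫⁻ x, w x) / (l * volume (closedBall (0 : E) 1)) := by
      rw [ENNReal.le_div_iff_mul_le (Or.inl (mul_ne_zero hl0 hvp))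
        (Or.inl (ENNReal.mul_ne_top hlt hvt))]
      calc _ = l * (ENNReal.ofReal (r a ^ Module.finrank ℝ E) * volume (closedBall (0 : E) 1)) := by
            ring
        _ ≤ _ := h2
    have h4 : r a ^ Module.finrank ℝ E ≤ A := by
      rw [hA]
      refine (ENNReal.ofReal_le_iff_le_toReal ?_).1 h3
      exact ENNReal.div_ne_top hI (mul_ne_zero hl0 hvp)
    exact (le_self_pow₀ (not_le.1 h1).le hE.ne').trans h4
  obtain ⟨u, -, hdis, hcov⟩ := Vitali.exists_disjoint_subfamily_covering_enlargement_closedBall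
    Set.univ (fun a : {x | l < mx w x} => (a : E)) r (max 1 A) hR 4 (by norm_num)
  have hcount : u.Countable := by
    refine hdis.countable_of_nonempty_interior ?_
    intro a _
    refine ⟨a, ?_⟩
    exact ball_subset_interior_closedBall (mem_ball_self (hr0 a))
  have hsub : {x | l < mx w x} ⊆ ⋃ b ∈ u, closedBall (b : E) (4 * r b) := by
    intro x hx
    obtain ⟨b, hb, h⟩ := hcov ⟨x, hx⟩ trivial
    exact Set.mem_biUnion hb (h (mem_closedBall_self (hr0 _).le))
  haveI := hcount.to_subtype
  calc l * volume {x | l < mx w x} ≤ l * ∑' b : u, volume (closedBall (b : E) (4 * r b)) := by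
        gcongr
        refine (measure_mono hsub).trans ?_
        exact measure_biUnion_le _ hcount _
    _ = 4 ^ Module.finrank ℝ E * ∑' b : u, l * volume (closedBall (b : E) (r b)) := by
        rw [← ENNReal.tsum_mul_left, ← ENNReal.tsum_mul_left]
        congr 1; ext b
        rw [vol_cb _ (hr0 _), vol_cb _ (mul_pos four_pos (hr0 _)), mul_pow,
          ENNReal.ofReal_mul (by positivity), ENNReal.ofReal_pow (by norm_num)]
        norm_num
        ring
    _ ≤ 4 ^ Module.finrank ℝ E * ∑' b : u, ∫⁻ y in closedBall (b : E) (r b), w y := by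
        gcongr with b
        exact (hr b).le
    _ = 4 ^ Module.finrank ℝ E * ∫⁻ y in ⋃ b ∈ u, closedBall (b : E) (r b), w y := by
        rw [lintegral_biUnion hcount (fun b _ => measurableSet_closedBall) hdis]
    _ ≤ _ := by gcongr; exact Measure.restrict_le_self

lemma lc (p : ℝ) (hp : 0 < p) (a : ℝ≥0∞) :
    ∫⁻ t in Set.Ioi (0 : ℝ), ENNReal.ofReal (p * t ^ (p - 1)) *
      (if ENNReal.ofReal t < a then 1 else 0) = a ^ p := by
  have hfin : ∀ b : ℝ, 0 ≤ b → ∫⁻ t in Set.Ioc (0 : ℝ) b, ENNReal.ofReal (p * t ^ (p - 1)) =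
      ENNReal.ofReal b ^ p := by
    intro b hb
    rw [← ofReal_integral_eq_lintegral_ofReal, ← intervalIntegral.integral_of_le hb,
      intervalIntegral.integral_const_mul, integral_rpow (Or.inl (by linarith)),
      ENNReal.ofReal_rpow_of_nonneg hb hp.le]
    · congr 1
      rw [sub_add_cancel, Real.zero_rpow hp.ne']; field_simp; simp
    · exact ((intervalIntegral.intervalIntegrable_rpow' (by linarith)).const_mul p).1
    · refine (ae_restrict_mem measurableSet_Ioc).mono fun t ht => ?_
      have : 0 < t := ht.1
      positivity
  have hle : ∀ b : ℝ, 0 ≤ b → ENNReal.ofReal b ≤ a → ENNReal.ofReal b ^ p ≤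
      ∫⁻ t in Set.Ioi (0 : ℝ), ENNReal.ofReal (p * t ^ (p - 1)) *
      (if ENNReal.ofReal t < a then 1 else 0) := by
    intro b hb hba
    rw [← hfin b hb, ← setLIntegral_congr (Ioo_ae_eq_Ioc (a := (0:ℝ)) (b := b))]
    refine le_trans ?_ (lintegral_mono_set (fun s hs => hs.1 : Set.Ioo 0 b ⊆ Set.Ioi 0))
    refine setLIntegral_mono' measurableSet_Ioo fun t ht => ?_
    rw [if_pos (lt_of_lt_of_le ((ENNReal.ofReal_lt_ofReal_iff (ht.1.trans ht.2)).2 ht.2) hba),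
      mul_one]
  refine le_antisymm ?_ ?_
  · by_cases ha : a = ∞
    · rw [ha, ENNReal.top_rpow_of_pos hp]; exact le_top
    lift a to ℝ≥0 using ha
    have h := hfin a a.2
    rw [ENNReal.ofReal_coe_nnreal] at h
    rw [← h, ← lintegral_indicator measurableSet_Ioi, ← lintegral_indicator measurableSet_Ioc]
    refine lintegral_mono fun t => ?_
    by_cases ht : t ∈ Set.Ioi (0:ℝ)
    · rw [Set.indicator_of_mem ht]
      split_ifs with h1
      · rw [Set.indicator_of_mem, mul_one]
        refine ⟨ht, ?_⟩
        have := h1.le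
        exact ENNReal.ofReal_le_ofReal_iff a.2 |>.1 (by simpa using this)
      · simp
    · rw [Set.indicator_of_notMem ht]; exact zero_le
  · by_cases ha : a = ∞
    · have : Tendsto (fun b : ℕ => ENNReal.ofReal (b:ℝ) ^ p) atTop (𝓝 (∞ ^ p)) := by
        simp only [ENNReal.ofReal_natCast]
        exact (ENNReal.continuous_rpow_const.tendsto _).comp ENNReal.tendsto_nat_nhds_top
      rw [ha] at hle ⊢
      exact le_of_tendsto' this fun b => hle b b.cast_nonneg le_top
    · have := hle a.toReal ENNReal.toReal_nonneg (by rw [ENNReal.ofReal_toReal ha])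
      rwa [ENNReal.ofReal_toReal ha] at this

lemma lc_meas {X : Type*} [MeasurableSpace X] (w : X → ℝ≥0∞) (hw : Measurable w) (p : ℝ) :
    Measurable (fun z : X × ℝ => ENNReal.ofReal (p * z.2 ^ (p - 1)) *
      (if ENNReal.ofReal z.2 < w z.1 then (1 : ℝ≥0∞) else 0)) := by
  refine Measurable.mul (by fun_prop) (Measurable.ite ?_ measurable_const measurable_const)
  exact measurableSet_lt (by fun_prop) (by fun_prop)

/-- layer cake upper bound without measurability -/
lemma lc_le (G : E → ℝ≥0∞) (p : ℝ) (hp : 0 < p) :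
    ∫⁻ x, G x ^ p ≤ ∫⁻ t in Set.Ioi (0 : ℝ), ENNReal.ofReal (p * t ^ (p - 1)) *
      volume {x | ENNReal.ofReal t < G x} := by
  obtain ⟨g, hg, hgle, hgeq⟩ := exists_measurable_le_lintegral_eq volume (fun x => G x ^ p)
  rw [hgeq]
  have h1 : ∀ x, g x = (g x ^ (1 / p)) ^ p := fun x => by
    rw [← ENNReal.rpow_mul, one_div_mul_cancel hp.ne', ENNReal.rpow_one]
  have h2 : ∀ x, g x ^ (1 / p) ≤ G x := fun x => by
    have := ENNReal.rpow_le_rpow (hgle x) (by positivity : 0 ≤ 1 / p)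
    rwa [← ENNReal.rpow_mul, mul_one_div_cancel hp.ne', ENNReal.rpow_one] at this
  set h := fun x => g x ^ (1 / p)
  have hm : Measurable h := hg.pow_const _
  calc ∫⁻ x, g x = ∫⁻ x, ∫⁻ t in Set.Ioi (0 : ℝ), ENNReal.ofReal (p * t ^ (p - 1)) *
      (if ENNReal.ofReal t < h x then 1 else 0) := by
        refine lintegral_congr fun x => ?_
        rw [lc p hp, h1 x]
    _ = ∫⁻ t in Set.Ioi (0 : ℝ), ∫⁻ x, ENNReal.ofReal (p * t ^ (p - 1)) *
      (if ENNReal.ofReal t < h x then 1 else 0) :=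
        lintegral_lintegral_swap (lc_meas h hm p).aemeasurable
    _ ≤ _ := by
        refine lintegral_mono fun t => ?_
        rw [lintegral_const_mul' _ _ ENNReal.ofReal_ne_top]
        gcongr
        have : MeasurableSet {x | ENNReal.ofReal t < h x} := measurableSet_lt measurable_const hm
        calc _ = ∫⁻ x, ({x | ENNReal.ofReal t < h x}).indicator 1 x := by
              refine lintegral_congr fun x => ?_
              simp [Set.indicator_apply]
          _ = volume {x | ENNReal.ofReal t < h x} := lintegral_indicator_one this
          _ ≤ _ := measure_mono fun x hx => lt_of_lt_of_le hx (h2 x)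

lemma mx_add_const (w v : E → ℝ≥0∞) (c : ℝ≥0∞) (h : ∀ x, w x ≤ v x + c) (x : E) :
    mx w x ≤ mx v x + c := by
  refine iSup₂_le fun r hr => ?_
  calc (volume (closedBall x r))⁻¹ * ∫⁻ y in closedBall x r, w y
      ≤ (volume (closedBall x r))⁻¹ * ∫⁻ y in closedBall x r, (v y + c) := by
        gcongr with y; exact h y
    _ = (volume (closedBall x r))⁻¹ * (∫⁻ y in closedBall x r, v y) + c := by
        rw [lintegral_add_right _ measurable_const, setLIntegral_const, mul_add, mul_comm c,
          ← mul_assoc _ _ c, ENNReal.inv_mul_cancel (vol_cb_pos x hr) (vol_cb_top x r), one_mul]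
    _ ≤ _ := by gcongr; exact le_iSup₂_of_le (f := fun r (_ : 0 < r) =>
        (volume (closedBall x r))⁻¹ * ∫⁻ y in closedBall x r, v y) r hr le_rfl

theorem mx_strong (hE : 0 < Module.finrank ℝ E) (p : ℝ) (hp : 1 < p) :
    ∃ C : ℝ≥0, ∀ w : E → ℝ≥0∞, Measurable w →
      ∫⁻ x, mx w x ^ p ≤ C * ∫⁻ x, w x ^ p := by
  refine ⟨4 ^ Module.finrank ℝ E * 2 * Real.toNNReal (p / (p - 1)) * Real.toNNReal (2 ^ (p - 1)),
    fun w hw => ?_⟩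
  have key : ∀ t : ℝ, 0 < t → volume {x | ENNReal.ofReal t < mx w x} ≤
      (4 ^ Module.finrank ℝ E * 2) * ENNReal.ofReal t⁻¹ *
        ∫⁻ x, w x * (if ENNReal.ofReal t < 2 * w x then 1 else 0) := by
    intro t ht
    set v : E → ℝ≥0∞ := fun x => w x * (if ENNReal.ofReal t < 2 * w x then 1 else 0)
    have h2 : (2 : ℝ≥0∞) * ENNReal.ofReal (t / 2) = ENNReal.ofReal t := by
      rw [← ENNReal.ofReal_ofNat 2, ← ENNReal.ofReal_mul (by norm_num)]; congr 1; ring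
    have h3 : ENNReal.ofReal (t / 2) + ENNReal.ofReal (t / 2) = ENNReal.ofReal t := by
      rw [← h2, two_mul]
    have h1 : ∀ x, w x ≤ v x + ENNReal.ofReal (t / 2) := by
      intro x
      by_cases h : ENNReal.ofReal t < 2 * w x
      · simp [v, h]
      · rw [not_lt, ← h2, ENNReal.mul_le_mul_iff_right (by norm_num) (by norm_num)] at h
        exact h.trans le_add_self
    have h4 : {x | ENNReal.ofReal t < mx w x} ⊆ {x | ENNReal.ofReal (t / 2) < mx v x} := by
      intro x hx
      simp only [Set.mem_ofPred_eq] at hx ⊢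
      by_contra hcon
      rw [not_lt] at hcon
      have := (mx_add_const w v _ h1 x).trans (add_le_add_left hcon _)
      rw [h3] at this
      exact absurd hx (not_lt.2 this)
    have h5 := mx_weak hE v (ENNReal.ofReal (t / 2)) (by simp; positivity)
    have h6 : ENNReal.ofReal (t / 2) * (2 * ENNReal.ofReal t⁻¹) = 1 := by
      rw [← mul_assoc, mul_comm _ (2 : ℝ≥0∞), h2, ← ENNReal.ofReal_mul ht.le,
        mul_inv_cancel₀ ht.ne', ENNReal.ofReal_one]
    calc _ ≤ volume {x | ENNReal.ofReal (t / 2) < mx v x} := measure_mono h4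
      _ = (2 * ENNReal.ofReal t⁻¹) * (ENNReal.ofReal (t / 2) *
            volume {x | ENNReal.ofReal (t / 2) < mx v x}) := by
          rw [← mul_assoc, mul_comm (2 * _), h6, one_mul]
      _ ≤ (2 * ENNReal.ofReal t⁻¹) * (4 ^ Module.finrank ℝ E * ∫⁻ x, v x) := by gcongr
      _ = _ := by ring
  have hp1 : 0 < p - 1 := by linarith
  set c4 : ℝ≥0∞ := 4 ^ Module.finrank ℝ E * 2 with hc4
  have hc4t : c4 ≠ ∞ := by rw [hc4]; exact ENNReal.mul_ne_top (by simp) (by norm_num)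
  have hm := lc_meas (fun x => 2 * w x) (hw.const_mul 2) (p - 1)
  calc ∫⁻ x, mx w x ^ p ≤ _ := lc_le _ p (by linarith)
    _ ≤ ∫⁻ t in Set.Ioi (0 : ℝ), c4 * ENNReal.ofReal (p / (p - 1)) *
          ∫⁻ x, w x * (ENNReal.ofReal ((p - 1) * t ^ (p - 1 - 1)) *
            (if ENNReal.ofReal t < 2 * w x then 1 else 0)) := by
        refine setLIntegral_mono' measurableSet_Ioi fun t ht => ?_
        have ht0 : 0 < t := ht
        refine (mul_le_mul_right (key t ht) _).trans_eq ?_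
        have : ∀ x, w x * (ENNReal.ofReal ((p - 1) * t ^ (p - 1 - 1)) *
            (if ENNReal.ofReal t < 2 * w x then 1 else 0)) =
            ENNReal.ofReal ((p - 1) * t ^ (p - 1 - 1)) *
              (w x * (if ENNReal.ofReal t < 2 * w x then 1 else 0)) := fun x => by ring
        simp_rw [this]
        rw [lintegral_const_mul' _ _ ENNReal.ofReal_ne_top]
        have h7 : ENNReal.ofReal (p * t ^ (p - 1)) * ENNReal.ofReal t⁻¹ =
            ENNReal.ofReal (p / (p - 1)) * ENNReal.ofReal ((p - 1) * t ^ (p - 1 - 1)) := by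
          rw [← ENNReal.ofReal_mul (by positivity), ← ENNReal.ofReal_mul (by positivity)]
          congr 1
          rw [Real.rpow_sub_one ht0.ne' (p - 1)]
          field_simp
        calc _ = c4 * (ENNReal.ofReal (p * t ^ (p - 1)) * ENNReal.ofReal t⁻¹) *
              ∫⁻ x, w x * (if ENNReal.ofReal t < 2 * w x then 1 else 0) := by ring
          _ = _ := by rw [h7]; ring
    _ = c4 * ENNReal.ofReal (p / (p - 1)) * ∫⁻ x, ∫⁻ t in Set.Ioi (0 : ℝ),
          w x * (ENNReal.ofReal ((p - 1) * t ^ (p - 1 - 1)) *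
            (if ENNReal.ofReal t < 2 * w x then 1 else 0)) := by
        rw [lintegral_const_mul' _ _ (ENNReal.mul_ne_top hc4t ENNReal.ofReal_ne_top)]
        rw [lintegral_lintegral_swap]
        exact (((hw.comp measurable_fst).mul hm).comp measurable_swap).aemeasurable
    _ = c4 * ENNReal.ofReal (p / (p - 1)) * ∫⁻ x, w x * (2 * w x) ^ (p - 1) := by
        congr 1
        refine lintegral_congr fun x => ?_
        rw [lintegral_const_mul, lc (p - 1) hp1]
        exact hm.comp (measurable_const.prodMk measurable_id)
    _ = c4 * ENNReal.ofReal (p / (p - 1)) * (ENNReal.ofReal (2 ^ (p - 1)) * ∫⁻ x, w x ^ p) := by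
        congr 1
        rw [← lintegral_const_mul' _ _ ENNReal.ofReal_ne_top]
        refine lintegral_congr fun x => ?_
        rw [ENNReal.mul_rpow_of_nonneg _ _ hp1.le, ← ENNReal.ofReal_rpow_of_pos (by norm_num),
          ENNReal.ofReal_ofNat]
        have : w x ^ p = w x * w x ^ (p - 1) := by
          conv_lhs => rw [show p = 1 + (p - 1) by ring]
          rw [ENNReal.rpow_add_of_nonneg _ _ zero_le_one hp1.le, ENNReal.rpow_one]
        rw [this]; ring
    _ = _ := by
        push_cast
        rw [hc4, ← mul_assoc]
        rfl

end HL


/-- Poisson-like majorant -/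
def pk (m : ℕ) (t r : ℝ) : ℝ := t / (t + r) ^ (m + 1)

lemma pk_nonneg (m : ℕ) {t r : ℝ} (ht : 0 < t) (hr : 0 ≤ r) : 0 ≤ pk m t r := by
  unfold pk; positivity

section HL
variable {E : Type*} [NormedAddCommGroup E] [NormedSpace ℝ E] [FiniteDimensional ℝ E]
  [MeasureSpace E] [BorelSpace E] [(volume : Measure E).IsAddHaarMeasure]

lemma pk_le_tsum (m : ℕ) (x z : E) (t : ℝ) (ht : 0 < t) :
    ENNReal.ofReal (pk m t ‖x - z‖) ≤ ∑' k : ℕ, ENNReal.ofReal (2 ^ (m + 1) * ((2 ^ k) ^ (m + 1))⁻¹ *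
      (t ^ m)⁻¹) * (closedBall x (2 ^ k * t)).indicator 1 z := by
  have hex : ∃ k : ℕ, ‖x - z‖ ≤ 2 ^ k * t := by
    obtain ⟨k, hk⟩ := pow_unbounded_of_one_lt (‖x - z‖ / t) (one_lt_two)
    exact ⟨k, by rw [div_lt_iff₀ ht] at hk; exact hk.le⟩
  classical
  set k := Nat.find hex with hk
  have h1 : ‖x - z‖ ≤ 2 ^ k * t := Nat.find_spec hex
  refine le_trans ?_ (ENNReal.le_tsum k)
  have hz : z ∈ closedBall x (2 ^ k * t) := by
    rw [mem_closedBall, dist_comm, dist_eq_norm]; exact h1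
  rw [Set.indicator_of_mem hz, Pi.one_apply, mul_one]
  apply ENNReal.ofReal_le_ofReal
  have h2 : 2 ^ k * t / 2 ≤ t + ‖x - z‖ := by
    rcases Nat.eq_zero_or_pos k with h0 | h0
    · rw [h0]; have := norm_nonneg (x - z); linarith
    · have h3 : ¬ ‖x - z‖ ≤ 2 ^ (k - 1) * t := Nat.find_min hex (by omega)
      have h4 : (2 : ℝ) ^ k = 2 ^ (k - 1) * 2 := by rw [← pow_succ]; congr 1; omega
      rw [h4]; linarith
  unfold pk
  calc t / (t + ‖x - z‖) ^ (m + 1) ≤ t / (2 ^ k * t / 2) ^ (m + 1) := by gcongr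
    _ = _ := by rw [div_pow, mul_pow]; field_simp; ring

theorem pk_mx : ∃ C : ℝ≥0, ∀ (w : E → ℝ≥0∞), Measurable w → ∀ (x : E) (t : ℝ), 0 < t →
    ∫⁻ z, ENNReal.ofReal (pk (Module.finrank ℝ E) t ‖x - z‖) * w z ≤ C * mx w x := by
  set m := Module.finrank ℝ E with hm
  have hvt : volume (closedBall (0 : E) 1) ≠ ∞ := vol_cb_top _ _
  refine ⟨2 ^ (m + 2) * (volume (closedBall (0 : E) 1)).toNNReal, fun w hw x t ht => ?_⟩
  calc _ ≤ ∫⁻ z, ∑' k : ℕ, ENNReal.ofReal (2 ^ (m + 1) * ((2 ^ k) ^ (m + 1))⁻¹ *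
      (t ^ m)⁻¹) * (closedBall x (2 ^ k * t)).indicator w z := by
        refine lintegral_mono fun z => ?_
        refine (mul_le_mul_left (pk_le_tsum m x z t ht) (w z)).trans_eq ?_
        rw [← ENNReal.tsum_mul_right]
        congr 1; ext k
        rw [mul_assoc]; congr 1
        by_cases h : z ∈ closedBall x (2 ^ k * t) <;> simp [h]
    _ = ∑' k : ℕ, ENNReal.ofReal (2 ^ (m + 1) * ((2 ^ k) ^ (m + 1))⁻¹ *
      (t ^ m)⁻¹) * ∫⁻ z in closedBall x (2 ^ k * t), w z := by
        rw [lintegral_tsum]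
        · congr 1; ext k
          rw [lintegral_const_mul' _ _ ENNReal.ofReal_ne_top,
            lintegral_indicator measurableSet_closedBall]
        · intro k
          exact ((hw.indicator measurableSet_closedBall).const_mul _).aemeasurable
    _ ≤ ∑' k : ℕ, ENNReal.ofReal (2 ^ (m + 1) * ((2 ^ k) ^ (m + 1))⁻¹ *
      (t ^ m)⁻¹) * ((ENNReal.ofReal ((2 ^ k * t) ^ m) * volume (closedBall (0 : E) 1)) * mx w x) := by
        gcongr with k
        rw [← vol_cb x (by positivity)]
        exact le_mx w x (by positivity)
    _ = ∑' k : ℕ, (2⁻¹ : ℝ≥0∞) ^ k * (2 ^ (m + 1) * volume (closedBall (0 : E) 1) * mx w x) := by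
        congr 1; ext k
        have : ENNReal.ofReal (2 ^ (m + 1) * ((2 ^ k) ^ (m + 1))⁻¹ * (t ^ m)⁻¹) *
            ENNReal.ofReal ((2 ^ k * t) ^ m) = 2⁻¹ ^ k * 2 ^ (m + 1) := by
          rw [← ENNReal.ofReal_mul (by positivity)]
          have h1 : (2:ℝ) ^ (m + 1) * ((2 ^ k) ^ (m + 1))⁻¹ * (t ^ m)⁻¹ * (2 ^ k * t) ^ m
              = (2⁻¹) ^ k * 2 ^ (m + 1) := by
            rw [mul_pow, inv_pow]; field_simp; ring
          rw [h1, ENNReal.ofReal_mul (by positivity), ENNReal.ofReal_pow (by positivity),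
            ENNReal.ofReal_pow (by positivity), ENNReal.ofReal_inv_of_pos (by positivity)]
          simp
        rw [← mul_assoc, ← mul_assoc, this]; ring
    _ = _ := by
        rw [ENNReal.tsum_mul_right, ENNReal.tsum_geometric, ENNReal.one_sub_inv_two, inv_inv]
        push_cast
        rw [ENNReal.coe_toNNReal hvt]; ring

end HL


/-- bounded measurable with bounded support -/
structure Bcs {E : Type*} [NormedAddCommGroup E] [MeasurableSpace E] (g : E → ℝ) : Prop where
  meas : Measurable g
  bdd : ∃ B : ℝ, 0 ≤ B ∧ ∀ x, |g x| ≤ B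
  supp : ∃ R : ℝ, 0 < R ∧ ∀ x, R < ‖x‖ → g x = 0

lemma Bcs.integrable {E : Type*} [NormedAddCommGroup E] [MeasureSpace E] [BorelSpace E]
    [ProperSpace E] [IsFiniteMeasureOnCompacts (volume : Measure E)] {g : E → ℝ} (hg : Bcs g) :
    Integrable g := by
  obtain ⟨B, hB0, hB⟩ := hg.bdd
  obtain ⟨R, hR0, hR⟩ := hg.supp
  have h1 : IntegrableOn g (closedBall 0 R) :=
    Measure.integrableOn_of_bounded (M := B) measure_closedBall_lt_top.ne
      hg.meas.aestronglyMeasurable (Eventually.of_forall fun x => by simpa using hB x)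
  rw [integrableOn_iff_integrable_of_support_subset] at h1
  · exact h1
  · intro x hx
    by_contra hc
    rw [mem_closedBall, dist_zero_right, not_le] at hc
    exact hx (hR x hc)

/-- holomorphic functions decaying faster than 1/|z| have zero line integrals -/
lemma line_int_zero (f : ℂ → ℂ) (hf : DifferentiableOn ℂ f {z | 0 < z.im}) (p C ε : ℝ)
    (hp : 1 < p) (hε : 0 < ε) (hb : ∀ z : ℂ, ε ≤ z.im → ‖f z‖ ≤ C * (1 + ‖z‖) ^ (-p)) :
    Integrable (fun x : ℝ => f (x + ε * Complex.I)) ∧ ∫ x : ℝ, f (x + ε * Complex.I) = 0 := by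
  have hC : 0 ≤ C := by
    have := (norm_nonneg _).trans (hb (ε * Complex.I) (by simp))
    exact nonneg_of_mul_nonneg_left this (by positivity)
  have hopen : IsOpen {z : ℂ | 0 < z.im} := isOpen_lt continuous_const Complex.continuous_im
  have hcont : Continuous (fun x : ℝ => f (x + ε * Complex.I)) := by
    have : ContinuousOn f {z | 0 < z.im} := hf.continuousOn
    refine this.comp_continuous (by fun_prop) fun x => by simp [hε]
  have hmono : ∀ (z : ℂ) (R : ℝ), 0 ≤ R → R ≤ ‖z‖ → ε ≤ z.im → ‖f z‖ ≤ C * (1 + R) ^ (-p) := by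
    intro z R hR0 hR hz
    refine (hb z hz).trans ?_
    gcongr ?_ * ?_
    exact Real.rpow_le_rpow_of_nonpos (by positivity) (by linarith) (by linarith)
  have hint : Integrable (fun x : ℝ => f (x + ε * Complex.I)) := by
    have h1 : Integrable (fun x : ℝ => C * (1 + ‖x‖) ^ (-p)) :=
      (integrable_one_add_norm (by simpa using hp)).const_mul C
    refine h1.mono' hcont.aestronglyMeasurable (Eventually.of_forall fun x => ?_)
    refine hmono _ _ (norm_nonneg _) ?_ (by simp)
    have := Complex.abs_re_le_norm (x + ε * Complex.I)
    simpa using this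
  refine ⟨hint, ?_⟩
  have hlim := intervalIntegral_tendsto_integral hint tendsto_neg_atTop_atBot tendsto_id
  have hz : Tendsto (fun R : ℝ => ∫ x in (-R)..R, f (x + ε * Complex.I)) atTop (𝓝 0) := by
    have hbound : ∀ R : ℝ, 0 < R → ‖∫ x in (-R)..R, f (x + ε * Complex.I)‖ ≤
        4 * C * (1 + R) ^ (1 - p) := by
      intro R hR
      have H := Complex.integral_boundary_rect_eq_zero_of_differentiableOn f
        (-R + ε * Complex.I) (R + (ε + R : ℝ) * Complex.I) (hf.mono ?_)
      · simp only [Complex.add_re, Complex.neg_re, Complex.ofReal_re, Complex.mul_re,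
          Complex.I_re, mul_zero, Complex.ofReal_im, Complex.I_im, mul_one, sub_self, add_zero,
          Complex.add_im, Complex.neg_im, neg_zero, Complex.mul_im, zero_add,
          Complex.ofReal_neg] at H
        have e1 : ∫ x in (-R)..R, f (x + ε * Complex.I) =
            (∫ x in (-R)..R, f (x + (ε + R : ℝ) * Complex.I)) -
            Complex.I • (∫ y in ε..(ε + R), f (R + y * Complex.I)) +
            Complex.I • (∫ y in ε..(ε + R), f (-R + y * Complex.I)) := by
          rw [← sub_eq_zero, ← H]; simp only [smul_eq_mul]; ring
        have b1 : ‖∫ x in (-R)..R, f (x + (ε + R : ℝ) * Complex.I)‖ ≤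
            C * (1 + R) ^ (-p) * |R - -R| := by
          refine intervalIntegral.norm_integral_le_of_norm_le_const fun x _ => ?_
          refine hmono _ _ hR.le ?_ (by simp; linarith)
          have := Complex.abs_im_le_norm (x + (ε + R : ℝ) * Complex.I)
          simp only [Complex.add_im, Complex.ofReal_im, Complex.mul_im, Complex.ofReal_re,
            Complex.I_im, mul_one, Complex.I_re, mul_zero, add_zero, zero_add] at this
          exact ((le_abs_self _).trans' (by linarith)).trans this
        have b2 : ‖∫ y in ε..(ε + R), f (R + y * Complex.I)‖ ≤
            C * (1 + R) ^ (-p) * |ε + R - ε| := by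
          refine intervalIntegral.norm_integral_le_of_norm_le_const fun x hx => ?_
          rw [Set.uIoc_of_le (by linarith)] at hx
          refine hmono _ _ hR.le ?_ (by simp; linarith [hx.1])
          have := Complex.abs_re_le_norm (R + x * Complex.I)
          simp at this
          exact (le_abs_self _).trans this
        have b3 : ‖∫ y in ε..(ε + R), f (-R + y * Complex.I)‖ ≤
            C * (1 + R) ^ (-p) * |ε + R - ε| := by
          refine intervalIntegral.norm_integral_le_of_norm_le_const fun x hx => ?_
          rw [Set.uIoc_of_le (by linarith)] at hx
          refine hmono _ _ hR.le ?_ (by simp; linarith [hx.1])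
          have := Complex.abs_re_le_norm (-R + x * Complex.I)
          simp at this
          exact (le_abs_self _).trans this
        rw [e1]
        have e2 : (1 + R) ^ (1 - p) = (1 + R) ^ (-p) * (1 + R) := by
          rw [← Real.rpow_add_one (by positivity)]; congr 1; ring
        have a1 : |R - -R| = 2 * R := by rw [abs_of_pos (by linarith)]; ring
        have a2 : |ε + R - ε| = R := by rw [abs_of_pos (by linarith)]; ring
        rw [a1] at b1
        rw [a2] at b2 b3
        have hpos : 0 ≤ C * (1 + R) ^ (-p) := by positivity
        calc _ ≤ ‖∫ x in (-R)..R, f (x + (ε + R : ℝ) * Complex.I)‖ +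
            ‖Complex.I • (∫ y in ε..(ε + R), f (R + y * Complex.I))‖ +
            ‖Complex.I • (∫ y in ε..(ε + R), f (-R + y * Complex.I))‖ :=
              (norm_add_le _ _).trans (add_le_add_left (norm_sub_le _ _) _)
          _ ≤ 4 * C * ((1 + R) ^ (-p) * (1 + R)) := by
              rw [norm_smul, norm_smul, Complex.norm_I, one_mul, one_mul]
              nlinarith
          _ = _ := by rw [e2]
      · intro z hz
        rw [Complex.mem_reProdIm] at hz
        have := hz.2
        simp at this
        rw [Set.uIcc_of_le (by linarith)] at this
        exact lt_of_lt_of_le hε this.1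
    refine squeeze_zero_norm' ((eventually_gt_atTop 0).mono fun R hR => hbound R hR) ?_
    have : Tendsto (fun R : ℝ => 4 * C * (1 + R) ^ (-(p - 1))) atTop (𝓝 (4 * C * 0)) :=
      ((tendsto_rpow_neg_atTop (by linarith)).comp
        (tendsto_atTop_add_const_left _ _ tendsto_id)).const_mul _
    simpa using this
  exact tendsto_nhds_unique hlim hz

/-- trigonometric inequality -/
lemma riesz_trig (p : ℝ) (hp : 1 < p) (hp2 : p ≤ 2) : ∃ A B : ℝ, 0 ≤ A ∧ 0 ≤ B ∧
    ∀ z : ℂ, 0 < z.re → |z.im| ^ p ≤ A * z.re ^ p - B * (z ^ (p : ℂ)).re := by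
  set φ := (p + 1) / p * (π / 4) with hφ
  have hφp : p * φ = (p + 1) * (π / 4) := by rw [hφ]; field_simp
  have hπ := Real.pi_pos
  have hφ0 : 0 < φ := by positivity
  have hφ2 : φ < π / 2 := by
    have : p * φ < p * (π / 2) := by rw [hφp]; nlinarith
    exact lt_of_mul_lt_mul_left this (by linarith)
  set b := - Real.cos (p * φ) with hb
  have hbpos : 0 < b := by
    rw [hb, hφp, neg_pos]
    apply Real.cos_neg_of_pi_div_two_lt_of_lt <;> nlinarith
  have hcpos : 0 < Real.cos φ := Real.cos_pos_of_mem_Ioo ⟨by linarith, hφ2⟩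
  refine ⟨(1 + 1 / b) / (Real.cos φ) ^ p, 1 / b, by positivity, by positivity, fun z hz => ?_⟩
  have hz0 : z ≠ 0 := by rintro rfl; simp at hz
  have hn : 0 < ‖z‖ := norm_pos_iff.2 hz0
  set θ := z.arg with hθ
  have hθ2 : |θ| < π / 2 := Complex.abs_arg_lt_pi_div_two_iff.2 (Or.inl hz)
  have h1 : z.re = ‖z‖ * Real.cos θ := (Complex.norm_mul_cos_arg z).symm
  have h2 : z.im = ‖z‖ * Real.sin θ := (Complex.norm_mul_sin_arg z).symm
  have h3 : (z ^ (p : ℂ)).re = ‖z‖ ^ p * Real.cos (p * θ) := by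
    rw [Complex.cpow_ofReal_re]
    rw [mul_comm p]
  have hcθ : 0 < Real.cos θ := by
    rw [h1] at hz; exact (pos_iff_pos_of_mul_pos hz).1 hn
  rw [h3, h1, h2, abs_mul, abs_of_pos hn, Real.mul_rpow hn.le (abs_nonneg _),
    Real.mul_rpow hn.le hcθ.le]
  have key : |Real.sin θ| ^ p ≤ (1 + 1 / b) / (Real.cos φ) ^ p * Real.cos θ ^ p -
      1 / b * Real.cos (p * θ) := by
    have hs : |Real.sin θ| ^ p ≤ 1 :=
      Real.rpow_le_one (abs_nonneg _) (Real.abs_sin_le_one θ) (by linarith)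
    have hcos : Real.cos (p * θ) = Real.cos (p * |θ|) := by
      rw [← Real.cos_abs, abs_mul, abs_of_pos (by linarith : (0:ℝ) < p)]
    by_cases hle : |θ| ≤ φ
    · have : Real.cos φ ≤ Real.cos θ := by
        rw [← Real.cos_abs θ]
        exact Real.cos_le_cos_of_nonneg_of_le_pi (abs_nonneg _) (by linarith) hle
      have h4 : Real.cos φ ^ p ≤ Real.cos θ ^ p := Real.rpow_le_rpow hcpos.le this (by linarith)
      have h5 : 1 + 1 / b ≤ (1 + 1 / b) / (Real.cos φ) ^ p * Real.cos θ ^ p := by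
        rw [div_mul_eq_mul_div, le_div_iff₀ (by positivity)]
        gcongr
      have h6 : 1 / b * Real.cos (p * θ) ≤ 1 / b * 1 := by
        gcongr; exact Real.cos_le_one _
      linarith
    · rw [not_le] at hle
      have h4 : Real.cos (p * |θ|) ≤ Real.cos (p * φ) := by
        refine Real.cos_le_cos_of_nonneg_of_le_pi (by positivity) ?_ (by gcongr)
        nlinarith [abs_nonneg θ]
      have h5 : 1 / b * Real.cos (p * θ) ≤ 1 / b * (-b) := by
        gcongr; rw [hcos, hb, neg_neg]; exact h4
      have h6 : 1 / b * (-b) = -1 := by field_simp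
      have h7 : 0 ≤ (1 + 1 / b) / (Real.cos φ) ^ p * Real.cos θ ^ p := by positivity
      linarith
  calc _ ≤ ‖z‖ ^ p * _ := mul_le_mul_of_nonneg_left key (by positivity)
    _ = _ := by ring



/-- Cauchy type integral -/
def FC (g : ℝ → ℝ) (z : ℂ) : ℂ := ∫ s : ℝ, (g s : ℂ) * (Complex.I / (z - s))

/-- conjugate Poisson integral -/
def Hc (ε : ℝ) (g : ℝ → ℝ) (x : ℝ) : ℝ := ∫ s : ℝ, (x - s) / ((x - s) ^ 2 + ε ^ 2) * g s

/-- Poisson integral -/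
def Pc (ε : ℝ) (g : ℝ → ℝ) (x : ℝ) : ℝ := ∫ s : ℝ, ε / ((x - s) ^ 2 + ε ^ 2) * g s

lemma im_le_sub (z : ℂ) (s : ℝ) : z.im ≤ ‖z - s‖ := by
  have := Complex.abs_im_le_norm (z - s)
  simp at this
  exact (le_abs_self _).trans this

lemma FC_intg {g : ℝ → ℝ} (hg : Integrable g) {z : ℂ} (hz : 0 < z.im) :
    Integrable (fun s : ℝ => (g s : ℂ) * (Complex.I / (z - s))) := by
  refine hg.ofReal.mul_bdd (c := 1 / z.im) (Measurable.aestronglyMeasurable (by fun_prop)) (Eventually.of_forall fun s => ?_)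
  rw [norm_div, Complex.norm_I]
  exact one_div_le_one_div_of_le hz (im_le_sub z s)

lemma FC_eq {g : ℝ → ℝ} (hg : Integrable g) (x : ℝ) {ε : ℝ} (hε : 0 < ε) :
    FC g (x + ε * Complex.I) = Pc ε g x + Hc ε g x * Complex.I := by
  have hz : 0 < ((x : ℂ) + ε * Complex.I).im := by simpa using hε
  have key : ∀ s : ℝ, Complex.I / ((x : ℂ) + ε * Complex.I - s) =
      ((ε / ((x - s) ^ 2 + ε ^ 2) : ℝ) : ℂ) + ((x - s) / ((x - s) ^ 2 + ε ^ 2) : ℝ) * Complex.I := by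
    intro s
    have h1 : (x : ℂ) + ε * Complex.I - s ≠ 0 := by
      intro h
      have := congrArg Complex.im h
      simp at this
      exact hε.ne' this
    have h2 : ((x : ℂ) - s) ^ 2 + ε ^ 2 ≠ 0 := by
      have : ((x - s) ^ 2 + ε ^ 2 : ℝ) ≠ 0 := by positivity
      exact_mod_cast this
    push_cast
    rw [div_eq_iff h1]
    field_simp
    ring_nf
    rw [Complex.I_sq]
    ring
  have h := FC_intg hg hz
  have hre := integral_re h
  have him := integral_im h
  apply Complex.ext
  · simp only [Complex.add_re, Complex.ofReal_re, Complex.mul_re, Complex.I_re, mul_zero,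
      Complex.ofReal_im, Complex.I_im, mul_one, sub_self, add_zero]
    simp only [RCLike.re_eq_complex_re] at hre
    rw [FC, ← hre, Pc]
    congr 1; ext s
    rw [key, Complex.re_ofReal_mul, Complex.add_re, Complex.ofReal_re, Complex.re_ofReal_mul,
      Complex.I_re]
    ring
  · simp only [Complex.add_im, Complex.ofReal_re, Complex.mul_im, Complex.I_re, mul_zero,
      Complex.ofReal_im, Complex.I_im, mul_one, zero_add, add_zero]
    simp only [RCLike.im_eq_complex_im] at him
    rw [FC, ← him, Hc]
    congr 1; ext s
    rw [key, Complex.im_ofReal_mul, Complex.add_im, Complex.ofReal_im, Complex.im_ofReal_mul,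
      Complex.I_im]
    ring

lemma FC_diff {g : ℝ → ℝ} (hg : Integrable g) : DifferentiableOn ℂ (FC g) {z | 0 < z.im} := by
  intro z hz
  have hz' : 0 < z.im := hz
  have hball : ∀ w ∈ ball z (z.im / 2), z.im / 2 ≤ w.im := by
    intro w hw
    have h1 := Complex.abs_im_le_norm (w - z)
    rw [mem_ball, dist_eq_norm] at hw
    have h2 := (abs_lt.1 (h1.trans_lt hw)).1
    simp at h2; linarith
  refine DifferentiableAt.differentiableWithinAt ?_
  have := hasDerivAt_integral_of_dominated_loc_of_deriv_le (𝕜 := ℂ) (μ := volume)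
    (F := fun z (s : ℝ) => (g s : ℂ) * (Complex.I / (z - s)))
    (F' := fun z (s : ℝ) => (g s : ℂ) * (- Complex.I / (z - s) ^ 2))
    (x₀ := z) (s := ball z (z.im / 2)) (bound := fun s => |g s| * (1 / (z.im / 2) ^ 2))
    (ball_mem_nhds _ (by linarith)) ?_ (FC_intg hg hz') ?_ ?_ ?_ ?_
  · exact this.2.differentiableAt
  · filter_upwards [ball_mem_nhds z (by linarith : (0:ℝ) < z.im / 2)] with w hw
    exact (FC_intg hg (by linarith [hball w hw])).1
  · exact hg.ofReal.1.mul (Measurable.aestronglyMeasurable (by fun_prop))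
  · refine Eventually.of_forall fun s w hw => ?_
    rw [norm_mul, norm_div, norm_neg, Complex.norm_I, norm_pow, Complex.norm_real, Real.norm_eq_abs]
    have := (hball w hw).trans (im_le_sub w s)
    gcongr
  · exact hg.abs.mul_const _
  · refine Eventually.of_forall fun s w hw => ?_
    have h1 : w - s ≠ 0 := by
      have := (hball w hw).trans (im_le_sub w s)
      exact norm_pos_iff.1 (by linarith)
    have h2 : HasDerivAt (fun w : ℂ => Complex.I / (w - s)) (- Complex.I / (w - s) ^ 2) w := by
      have := (hasDerivAt_const w Complex.I).div ((hasDerivAt_id w).sub_const (s : ℂ)) h1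
      exact this.congr_deriv (by simp)
    exact h2.const_mul _

lemma FC_bd {g : ℝ → ℝ} (hg : Bcs g) {ε : ℝ} (hε : 0 < ε) : ∃ C : ℝ, 0 ≤ C ∧ ∀ z : ℂ, ε ≤ z.im →
    ‖FC g z‖ ≤ C * (1 + ‖z‖)⁻¹ := by
  obtain ⟨R, hR0, hR⟩ := hg.supp
  refine ⟨((1 + R) / ε + 1) * ∫ s, |g s|, by positivity, fun z hz => ?_⟩
  rw [FC]
  calc _ ≤ ∫ s, |g s| * (((1 + R) / ε + 1) * (1 + ‖z‖)⁻¹) := by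
        refine norm_integral_le_of_norm_le (hg.integrable.abs.mul_const _)
          (Eventually.of_forall fun s => ?_)
        rw [norm_mul, Complex.norm_real, norm_div, Complex.norm_I, Real.norm_eq_abs]
        by_cases hs : R < ‖s‖
        · simp [hR s hs]
        rw [not_lt] at hs
        gcongr
        have h1 := hz.trans (im_le_sub z s)
        have h2 : ‖z‖ ≤ ‖z - s‖ + ‖s‖ := by
          have := norm_add_le (z - s) (s : ℂ)
          simpa using this
        rw [← div_eq_mul_inv, div_le_div_iff₀ (by linarith) (by positivity)]
        have h3 : 1 + R ≤ (1 + R) / ε * ‖z - s‖ := by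
          rw [div_mul_eq_mul_div, le_div_iff₀ hε]; gcongr
        linarith
    _ = _ := by rw [integral_mul_const]; ring

lemma pk1_le {ε r : ℝ} (hε : 0 < ε) : ε / (r ^ 2 + ε ^ 2) ≤ 2 * pk 1 ε ‖r‖ := by
  rw [pk, ← mul_div_assoc, div_le_div_iff₀ (by positivity) (by positivity), Real.norm_eq_abs]
  have : (ε + |r|) ^ 2 ≤ 2 * (r ^ 2 + ε ^ 2) := by
    nlinarith [sq_nonneg (ε - |r|), sq_abs r]
  norm_num at *
  nlinarith

lemma enorm_int_le {X : Type*} [MeasurableSpace X] {μ : Measure X} (k g : X → ℝ) (c : X → ℝ)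
    (h : ∀ x, |k x| ≤ c x) :
    ‖∫ s, k s * g s ∂μ‖ₑ ≤ ∫⁻ s, ENNReal.ofReal (c s) * ‖g s‖ₑ ∂μ := by
  refine (enorm_integral_le_lintegral_enorm _).trans (lintegral_mono fun s => ?_)
  rw [enorm_mul]
  gcongr
  rw [Real.enorm_eq_ofReal_abs]
  exact ENNReal.ofReal_le_ofReal (h s)

lemma pk_mx1 : ∃ C : ℝ≥0, ∀ (w : ℝ → ℝ≥0∞), Measurable w → ∀ (x t : ℝ), 0 < t →
    ∫⁻ z, ENNReal.ofReal (pk 1 t ‖x - z‖) * w z ≤ C * mx w x := by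
  have := pk_mx (E := ℝ)
  simpa only [Module.finrank_self] using this

lemma Pc_mx : ∃ C : ℝ≥0, ∀ (g : ℝ → ℝ), Measurable g → ∀ (x t : ℝ), 0 < t →
    ∫⁻ s, ENNReal.ofReal (t / ((x - s) ^ 2 + t ^ 2)) * ‖g s‖ₑ ≤ C * mx (fun s => ‖g s‖ₑ) x := by
  obtain ⟨C, hC⟩ := pk_mx1
  refine ⟨2 * C, fun g hg x t ht => ?_⟩
  calc _ ≤ ∫⁻ s, 2 * (ENNReal.ofReal (pk 1 t ‖x - s‖) * ‖g s‖ₑ) := by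
        refine lintegral_mono fun s => ?_
        rw [← mul_assoc]
        gcongr
        rw [show (2 : ℝ≥0∞) = ENNReal.ofReal 2 by simp, ← ENNReal.ofReal_mul (by norm_num)]
        exact ENNReal.ofReal_le_ofReal (pk1_le ht)
    _ ≤ _ := by
        rw [lintegral_const_mul' _ _ (by simp)]
        push_cast
        rw [mul_assoc]
        gcongr
        exact hC _ (by fun_prop) x t ht

lemma FC_re_pos {g : ℝ → ℝ} (hg : Bcs g) (h0 : ∀ s, 0 ≤ g s) (hne : 0 < ∫ s, g s)
    {z : ℂ} (hz : 0 < z.im) : 0 < (FC g z).re := by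
  have e : z = (z.re : ℂ) + z.im * Complex.I := (Complex.re_add_im z).symm
  rw [e, FC_eq hg.integrable _ hz]
  simp only [Complex.add_re, Complex.ofReal_re, Complex.mul_re, Complex.I_re, mul_zero,
      Complex.ofReal_im, Complex.I_im, mul_one, sub_self, add_zero]
  rw [Pc]
  have hk : ∀ s, 0 < z.im / ((z.re - s) ^ 2 + z.im ^ 2) := fun s => by positivity
  rw [integral_pos_iff_support_of_nonneg (fun s => by have := hk s; have := h0 s; simp only [Pi.zero_apply]; positivity)]
  · rw [integral_pos_iff_support_of_nonneg h0 hg.integrable] at hne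
    convert hne using 2
    ext s
    simp only [Function.mem_support, ne_eq, mul_eq_zero, (hk s).ne', false_or]
  · refine hg.integrable.bdd_mul (c := 1 / z.im) (Measurable.aestronglyMeasurable (by fun_prop)) (Eventually.of_forall fun s => ?_)
    rw [Real.norm_eq_abs, abs_of_pos (hk s), div_le_div_iff₀ (by positivity) hz]
    nlinarith [sq_nonneg (z.re - s)]

lemma riesz_pos (p : ℝ) (hp : 1 < p) (hp2 : p ≤ 2) : ∃ C : ℝ≥0, ∀ (ε : ℝ), 0 < ε →
    ∀ g : ℝ → ℝ, Bcs g → (∀ s, 0 ≤ g s) → ∫⁻ x, ‖Hc ε g x‖ₑ ^ p ≤ C * ∫⁻ x, ‖g x‖ₑ ^ p := by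
  obtain ⟨A, B, hA, hB, hAB⟩ := riesz_trig p hp hp2
  obtain ⟨C1, hC1⟩ := Pc_mx
  obtain ⟨C2, hC2⟩ := mx_strong (E := ℝ) (by simp) p hp
  refine ⟨A.toNNReal * C1 ^ p * C2, fun ε hε g hg h0 => ?_⟩
  by_cases hne : 0 < ∫ s, g s
  swap
  · have h1 : ∫ s, g s = 0 := le_antisymm (not_lt.1 hne) (integral_nonneg h0)
    rw [integral_eq_zero_iff_of_nonneg h0 hg.integrable] at h1
    have : ∀ x, Hc ε g x = 0 := by
      intro x
      rw [Hc, integral_eq_zero_of_ae]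
      filter_upwards [h1] with s hs
      simp at hs
      simp [hs]
    simp only [this, enorm_zero]
    rw [ENNReal.zero_rpow_of_pos (by linarith)]; simp
  have hre : ∀ z : ℂ, 0 < z.im → 0 < (FC g z).re := fun z hz => FC_re_pos hg h0 hne hz
  obtain ⟨D, hD0, hD⟩ := FC_bd hg hε
  obtain ⟨hI, hI0⟩ := line_int_zero (fun z => (FC g z) ^ (p : ℂ))
    ((FC_diff hg.integrable).cpow_const fun z hz => Or.inl (hre z hz)) p (D ^ p) ε hp hε (by
    intro z hz
    rw [Complex.norm_cpow_real, Real.rpow_neg (by positivity), ← Real.inv_rpow (by positivity),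
      ← Real.mul_rpow hD0 (by positivity)]
    exact Real.rpow_le_rpow (norm_nonneg _) (hD z hz) (by linarith))
  have hU : ∀ x : ℝ, (FC g (x + ε * Complex.I)).re = Pc ε g x := fun x => by
    rw [FC_eq hg.integrable _ hε]; simp
  have hV : ∀ x : ℝ, (FC g (x + ε * Complex.I)).im = Hc ε g x := fun x => by
    rw [FC_eq hg.integrable _ hε]; simp
  have hpt : ∀ x : ℝ, |Hc ε g x| ^ p ≤ A * (Pc ε g x) ^ p -
      B * ((FC g (x + ε * Complex.I)) ^ (p : ℂ)).re := fun x => by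
    rw [← hU, ← hV]
    exact hAB _ (hre _ (by simpa using hε))
  have hcF : Continuous (fun x : ℝ => FC g (x + ε * Complex.I)) := by
    refine (FC_diff hg.integrable).continuousOn.comp_continuous (by fun_prop) fun x => by simp [hε]
  have hUp : ∀ x, 0 < Pc ε g x := fun x => by
    rw [← hU]; exact hre _ (by simpa using hε)
  have hbd : ∀ x : ℝ, ‖FC g (x + ε * Complex.I)‖ ≤ D * (1 + ‖x‖)⁻¹ := by
    intro x
    refine (hD _ (by simp)).trans ?_
    gcongr
    have := Complex.abs_re_le_norm (x + ε * Complex.I)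
    simpa using this
  have hdom : ∀ f : ℝ → ℝ, Continuous f → (∀ x : ℝ, |f x| ≤ ‖FC g (x + ε * Complex.I)‖) →
      Integrable (fun x => |f x| ^ p) := by
    intro f hf hfb
    have h1 : Integrable (fun x : ℝ => D ^ p * (1 + ‖x‖) ^ (-p)) :=
      (integrable_one_add_norm (by simpa using hp)).const_mul _
    refine h1.mono' (Continuous.aestronglyMeasurable (by
      exact hf.abs.rpow_const fun x => Or.inr (by linarith))) (Eventually.of_forall fun x => ?_)
    rw [Real.norm_eq_abs, abs_of_nonneg (by positivity)]
    calc |f x| ^ p ≤ (D * (1 + ‖x‖)⁻¹) ^ p := by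
          refine Real.rpow_le_rpow (abs_nonneg _) ((hfb x).trans (hbd x)) (by linarith)
      _ = _ := by
          rw [Real.mul_rpow hD0 (by positivity), Real.inv_rpow (by positivity), Real.rpow_neg (by positivity)]
  have hcU : Continuous (fun x => Pc ε g x) := by
    simp_rw [← hU]; exact Complex.continuous_re.comp hcF
  have hcV : Continuous (fun x => Hc ε g x) := by
    simp_rw [← hV]; exact Complex.continuous_im.comp hcF
  have hIU := hdom _ hcU (fun x => by rw [← hU]; exact Complex.abs_re_le_norm _)
  have hIV := hdom _ hcV (fun x => by rw [← hV]; exact Complex.abs_im_le_norm _)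
  have hreal : ∫ x, |Hc ε g x| ^ p ≤ A * ∫ x, |Pc ε g x| ^ p := by
    have hIre : ∫ x : ℝ, ((FC g (x + ε * Complex.I)) ^ (p : ℂ)).re = 0 := by
      have := integral_re hI
      simp only [RCLike.re_eq_complex_re] at this
      rw [this, hI0]; simp
    calc _ ≤ ∫ x, (A * |Pc ε g x| ^ p - B * ((FC g (x + ε * Complex.I)) ^ (p : ℂ)).re) := by
          refine integral_mono hIV ((hIU.const_mul A).sub (hI.re.const_mul B)) fun x => ?_
          simp only [abs_of_pos (hUp x)]; exact hpt x
      _ = _ := by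
          have h9 := integral_sub (hIU.const_mul A) (hI.re.const_mul B)
          simp only [RCLike.re_eq_complex_re] at h9
          rw [h9, integral_const_mul, integral_const_mul, hIre]; simp
  have conv : ∀ f : ℝ → ℝ, Integrable (fun x => |f x| ^ p) →
      ∫⁻ x, ‖f x‖ₑ ^ p = ENNReal.ofReal (∫ x, |f x| ^ p) := by
    intro f hf
    rw [ofReal_integral_eq_lintegral_ofReal hf (Eventually.of_forall fun x => by positivity)]
    congr 1; ext x
    rw [Real.enorm_eq_ofReal_abs, ENNReal.ofReal_rpow_of_nonneg (abs_nonneg _) (by linarith)]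
  calc ∫⁻ x, ‖Hc ε g x‖ₑ ^ p ≤ ENNReal.ofReal A * ∫⁻ x, ‖Pc ε g x‖ₑ ^ p := by
        rw [conv _ hIV, conv _ hIU, ← ENNReal.ofReal_mul hA]
        exact ENNReal.ofReal_le_ofReal hreal
    _ ≤ ENNReal.ofReal A * ∫⁻ x, (C1 * mx (fun s => ‖g s‖ₑ) x) ^ p := by
        gcongr with x
        refine (enorm_int_le _ g (fun s => ε / ((x - s) ^ 2 + ε ^ 2)) fun s => ?_).trans
          (hC1 g hg.meas x ε hε)
        rw [abs_of_nonneg (by positivity)]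
    _ ≤ _ := by
        simp_rw [ENNReal.mul_rpow_of_nonneg _ _ (by linarith : 0 ≤ p)]
        rw [lintegral_const_mul' _ _ (by simp [ENNReal.rpow_eq_top_iff]; intros; linarith)]
        have := hC2 _ hg.meas.enorm
        calc _ ≤ ENNReal.ofReal A * ((C1 : ℝ≥0∞) ^ p * (C2 * ∫⁻ x, ‖g x‖ₑ ^ p)) := by gcongr
          _ = _ := by
            push_cast
            rw [ENNReal.coe_rpow_of_nonneg _ (by linarith)]
            simp only [ENNReal.ofReal, mul_assoc]


lemma qk_bd {ε : ℝ} (hε : 0 < ε) (r : ℝ) : ‖r / (r ^ 2 + ε ^ 2)‖ ≤ 1 / ε := by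
  rw [Real.norm_eq_abs, abs_div, abs_of_pos (by positivity : 0 < r ^ 2 + ε ^ 2),
    div_le_div_iff₀ (by positivity) hε]
  nlinarith [sq_nonneg (|r| - ε), sq_abs r, abs_nonneg r]

lemma Hc_intg {g : ℝ → ℝ} (hg : Integrable g) {ε : ℝ} (hε : 0 < ε) (x : ℝ) :
    Integrable (fun s => (x - s) / ((x - s) ^ 2 + ε ^ 2) * g s) :=
  hg.bdd_mul (Measurable.aestronglyMeasurable (by fun_prop))
    (Eventually.of_forall fun s => qk_bd hε (x - s))

lemma Hc_cont {g : ℝ → ℝ} (hg : Integrable g) {ε : ℝ} (hε : 0 < ε) : Continuous (Hc ε g) := by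
  have hcF : Continuous (fun x : ℝ => FC g (x + ε * Complex.I)) := by
    refine (FC_diff hg).continuousOn.comp_continuous (by fun_prop) fun x => by simp [hε]
  have hV : ∀ x : ℝ, Hc ε g x = (FC g (x + ε * Complex.I)).im := fun x => by
    rw [FC_eq hg _ hε]; simp
  have : Hc ε g = fun x : ℝ => (FC g (x + ε * Complex.I)).im := funext hV
  rw [this]
  exact Complex.continuous_im.comp hcF

lemma rpow_le_of_le {p : ℝ} (hp : 1 < p) (a b c : ℝ≥0∞) (h : a ≤ b + c) :
    a ^ p ≤ 2 ^ (p - 1) * (b ^ p + c ^ p) :=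
  (ENNReal.rpow_le_rpow h (by linarith)).trans (ENNReal.rpow_add_le_mul_rpow_add_rpow _ _ hp.le)

lemma two_rpow_ne {p : ℝ} : (2 : ℝ≥0∞) ^ (p - 1) = ((2 : ℝ≥0) ^ (p - 1) : ℝ≥0) := by
  rw [ENNReal.coe_rpow_of_ne_zero (by norm_num)]; rfl

lemma riesz_le2 (p : ℝ) (hp : 1 < p) (hp2 : p ≤ 2) : ∃ C : ℝ≥0, ∀ (ε : ℝ), 0 < ε →
    ∀ g : ℝ → ℝ, Bcs g → ∫⁻ x, ‖Hc ε g x‖ₑ ^ p ≤ C * ∫⁻ x, ‖g x‖ₑ ^ p := by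
  obtain ⟨C, hC⟩ := riesz_pos p hp hp2
  refine ⟨2 ^ (p - 1) * (C + C), fun ε hε g hg => ?_⟩
  have hpart : ∀ f : ℝ → ℝ, Measurable f → (∀ x, |f x| ≤ |g x|) → Bcs f := by
    intro f hf hle
    obtain ⟨B, hB0, hB⟩ := hg.bdd
    obtain ⟨R, hR0, hR⟩ := hg.supp
    refine ⟨hf, ⟨B, hB0, fun x => (hle x).trans (hB x)⟩, ⟨R, hR0, fun x hx => ?_⟩⟩
    have := hle x
    rw [hR x hx] at this
    simpa using this
  have h1 : ∀ x, |max (g x) 0| ≤ |g x| := fun x => by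
    rw [abs_of_nonneg (le_max_right _ _)]; exact max_le (le_abs_self _) (abs_nonneg _)
  have h2 : ∀ x, |max (-g x) 0| ≤ |g x| := fun x => by
    rw [abs_of_nonneg (le_max_right _ _)]; exact max_le (neg_le_abs _) (abs_nonneg _)
  have b1 := hpart (fun x => max (g x) 0) (hg.meas.max measurable_const) h1
  have b2 := hpart (fun x => max (-g x) 0) (hg.meas.neg.max measurable_const) h2
  have e : ∀ x, Hc ε g x = Hc ε (fun x => max (g x) 0) x - Hc ε (fun x => max (-g x) 0) x := by
    intro x
    rw [Hc, Hc, Hc, ← integral_sub (Hc_intg b1.integrable hε x) (Hc_intg b2.integrable hε x)]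
    congr 1; ext s
    rw [← mul_sub]
    congr 1
    have := max_zero_sub_eq_self (g s)
    rw [max_comm, max_comm (-g s)] at *
    exact this.symm
  calc _ ≤ ∫⁻ x, 2 ^ (p - 1) * (‖Hc ε (fun x => max (g x) 0) x‖ₑ ^ p +
        ‖Hc ε (fun x => max (-g x) 0) x‖ₑ ^ p) := by
        refine lintegral_mono fun x => rpow_le_of_le hp _ _ _ ?_
        rw [e x]; exact enorm_sub_le
    _ = 2 ^ (p - 1) * ((∫⁻ x, ‖Hc ε (fun x => max (g x) 0) x‖ₑ ^ p) +
        ∫⁻ x, ‖Hc ε (fun x => max (-g x) 0) x‖ₑ ^ p) := by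
        rw [lintegral_const_mul' _ _ (by rw [two_rpow_ne]; simp), lintegral_add_left]
        exact (Hc_cont b1.integrable hε).measurable.enorm.pow_const _
    _ ≤ 2 ^ (p - 1) * (C * (∫⁻ x, ‖g x‖ₑ ^ p) + C * (∫⁻ x, ‖g x‖ₑ ^ p)) := by
        gcongr
        · refine (hC ε hε _ b1 fun s => le_max_right _ _).trans ?_
          gcongr _ * ?_
          refine lintegral_mono fun x => ?_
          refine ENNReal.rpow_le_rpow ?_ (by linarith)
          rw [Real.enorm_eq_ofReal_abs, Real.enorm_eq_ofReal_abs]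
          exact ENNReal.ofReal_le_ofReal (h1 x)
        · refine (hC ε hε _ b2 fun s => le_max_right _ _).trans ?_
          gcongr _ * ?_
          refine lintegral_mono fun x => ?_
          refine ENNReal.rpow_le_rpow ?_ (by linarith)
          rw [Real.enorm_eq_ofReal_abs, Real.enorm_eq_ofReal_abs]
          exact ENNReal.ofReal_le_ofReal (h2 x)
    _ = _ := by rw [two_rpow_ne]; push_cast; ring

lemma Hc_anti {g h : ℝ → ℝ} (hg : Integrable g) (hh : Integrable h) {ε : ℝ} (hε : 0 < ε) :
    ∫ x, Hc ε g x * h x = - ∫ x, g x * Hc ε h x := by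
  have hI : Integrable (Function.uncurry fun x s : ℝ =>
      (x - s) / ((x - s) ^ 2 + ε ^ 2) * (h x * g s)) (volume.prod volume) := by
    refine (hh.mul_prod hg).bdd_mul (c := 1 / ε)
      (f := fun z : ℝ × ℝ => (z.1 - z.2) / ((z.1 - z.2) ^ 2 + ε ^ 2))
      (Measurable.aestronglyMeasurable (by fun_prop)) (Eventually.of_forall fun z => qk_bd hε _)
  have := integral_integral_swap hI
  calc ∫ x, Hc ε g x * h x = ∫ x, ∫ s, (x - s) / ((x - s) ^ 2 + ε ^ 2) * (h x * g s) := by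
        congr 1; ext x
        rw [Hc, ← integral_mul_const]
        congr 1; ext s; ring
    _ = _ := this
    _ = _ := by
        rw [← integral_neg]
        congr 1; ext s
        rw [Hc, ← integral_const_mul, ← integral_neg]
        congr 1; ext x
        rw [show (s - x) ^ 2 = (x - s) ^ 2 by ring]
        ring

lemma riesz_ge2 (p : ℝ) (hp : 2 ≤ p) : ∃ C : ℝ≥0, ∀ (ε : ℝ), 0 < ε →
    ∀ g : ℝ → ℝ, Bcs g → ∫⁻ x, ‖Hc ε g x‖ₑ ^ p ≤ C * ∫⁻ x, ‖g x‖ₑ ^ p := by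
  set q := p / (p - 1) with hq
  have hpq : p.HolderConjugate q := by
    rw [Real.holderConjugate_iff]
    refine ⟨by linarith, ?_⟩
    have : p - 1 ≠ 0 := by linarith
    rw [hq]; field_simp; ring
  have hq2 : q ≤ 2 := by rw [hq, div_le_iff₀ (by linarith)]; linarith
  obtain ⟨C, hC⟩ := riesz_le2 q hpq.symm.lt hq2
  refine ⟨C ^ (p / q), fun ε hε g hg => ?_⟩
  set v := Hc ε g with hv
  have hvc : Continuous v := Hc_cont hg.integrable hε
  have hcut : ∀ N : ℕ, ∫⁻ x in closedBall 0 (N : ℝ), ‖v x‖ₑ ^ p ≤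
      (C ^ (p / q) : ℝ≥0) * ∫⁻ x, ‖g x‖ₑ ^ p := by
    intro N
    set h : ℝ → ℝ := (closedBall 0 (N : ℝ)).indicator fun x => |v x| ^ (p - 2) * v x with hh
    have hfc : Continuous fun x => |v x| ^ (p - 2) * v x :=
      (hvc.abs.rpow_const fun x => Or.inr (by linarith)).mul hvc
    have hhB : Bcs h := by
      refine ⟨hfc.measurable.indicator measurableSet_closedBall, ?_, ⟨N + 1, by positivity, ?_⟩⟩
      · obtain ⟨B, hB⟩ := (isCompact_closedBall (0 : ℝ) (N : ℝ)).exists_bound_of_continuousOn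
          hfc.continuousOn
        refine ⟨max B 0, le_max_right _ _, fun x => ?_⟩
        by_cases hx : x ∈ closedBall (0 : ℝ) (N : ℝ)
        · rw [hh, Set.indicator_of_mem hx]; exact (hB x hx).trans (le_max_left _ _)
        · rw [hh, Set.indicator_of_notMem hx]; simp
      · intro x hx
        rw [hh, Set.indicator_of_notMem]
        simp only [mem_closedBall, dist_zero_right, not_le]; linarith
    set I := ∫⁻ x in closedBall 0 (N : ℝ), ‖v x‖ₑ ^ p with hI
    have hItop : I ≠ ∞ := by
      obtain ⟨B, hB⟩ := (isCompact_closedBall (0 : ℝ) (N : ℝ)).exists_bound_of_continuousOn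
          hvc.continuousOn
      refine ne_top_of_le_ne_top (b := ∫⁻ x in closedBall (0 : ℝ) (N : ℝ), ENNReal.ofReal B ^ p) ?_ ?_
      · rw [lintegral_const]
        exact ENNReal.mul_ne_top (ENNReal.rpow_ne_top_of_nonneg (by linarith) (by simp))
          (by rw [Measure.restrict_apply_univ]; exact measure_closedBall_lt_top.ne)
      · refine setLIntegral_mono measurable_const fun x hx => ?_
        refine ENNReal.rpow_le_rpow ?_ (by linarith)
        rw [← ofReal_norm]
        exact ENNReal.ofReal_le_ofReal (hB x hx)
    have hvh : ∀ x, ‖v x * h x‖ₑ = (closedBall 0 (N : ℝ)).indicator (fun x => ‖v x‖ₑ ^ p) x := by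
      intro x
      by_cases hx : x ∈ closedBall (0 : ℝ) (N : ℝ)
      · rw [hh, Set.indicator_of_mem hx, Set.indicator_of_mem hx, Real.enorm_eq_ofReal_abs,
          Real.enorm_eq_ofReal_abs, ENNReal.ofReal_rpow_of_nonneg (abs_nonneg _) (by linarith)]
        congr 1
        rw [abs_mul, abs_mul, abs_of_nonneg (by positivity : 0 ≤ |v x| ^ (p - 2))]
        rcases eq_or_lt_of_le (abs_nonneg (v x)) with h0 | h0
        · rw [← h0, zero_mul, Real.zero_rpow (by linarith)]
        · nth_rw 2 [show p = (p - 2) + 1 + 1 by ring]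
          rw [Real.rpow_add_one h0.ne', Real.rpow_add_one h0.ne']
          ring
      · rw [hh, Set.indicator_of_notMem hx, Set.indicator_of_notMem hx]; simp
    have hhq : ∀ x, ‖h x‖ₑ ^ q = (closedBall 0 (N : ℝ)).indicator (fun x => ‖v x‖ₑ ^ p) x := by
      intro x
      by_cases hx : x ∈ closedBall (0 : ℝ) (N : ℝ)
      · rw [hh, Set.indicator_of_mem hx, Set.indicator_of_mem hx, Real.enorm_eq_ofReal_abs,
          Real.enorm_eq_ofReal_abs, ENNReal.ofReal_rpow_of_nonneg (abs_nonneg _) hpq.symm.pos.le,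
          ENNReal.ofReal_rpow_of_nonneg (abs_nonneg _) (by linarith)]
        congr 1
        rw [abs_mul, abs_of_nonneg (by positivity : 0 ≤ |v x| ^ (p - 2))]
        rcases eq_or_lt_of_le (abs_nonneg (v x)) with h0 | h0
        · rw [← h0, mul_zero, Real.zero_rpow hpq.symm.pos.ne', Real.zero_rpow (by linarith)]
        · rw [← Real.rpow_add_one h0.ne', ← Real.rpow_mul h0.le]
          congr 1
          rw [hq, show p - 2 + 1 = p - 1 by ring, mul_div_cancel₀]
          linarith
      · rw [hh, Set.indicator_of_notMem hx, Set.indicator_of_notMem hx]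
        simp [hpq.symm.pos]
    have e1 : I = ‖∫ x, v x * h x‖ₑ := by
      have hn : ∀ x, 0 ≤ v x * h x := by
        intro x
        by_cases hx : x ∈ closedBall (0 : ℝ) (N : ℝ)
        · rw [hh, Set.indicator_of_mem hx, mul_left_comm]
          exact mul_nonneg (by positivity) (mul_self_nonneg _)
        · rw [hh, Set.indicator_of_notMem hx]; simp
      have hint : ∫⁻ x, ‖v x * h x‖ₑ = I := by
        simp_rw [hvh]; rw [lintegral_indicator measurableSet_closedBall]
      rw [integral_eq_lintegral_of_nonneg_ae (Eventually.of_forall hn)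
        (hvc.measurable.mul hhB.meas).aestronglyMeasurable, Real.enorm_eq_ofReal_abs,
        abs_of_nonneg ENNReal.toReal_nonneg, ENNReal.ofReal_toReal]
      · rw [← hint]; congr 1; ext x; rw [Real.enorm_eq_ofReal_abs, abs_of_nonneg (hn x)]
      · convert hItop using 1
        rw [← hint]; congr 1; ext x; rw [Real.enorm_eq_ofReal_abs, abs_of_nonneg (hn x)]
    have e2 : I ≤ (∫⁻ x, ‖g x‖ₑ ^ p) ^ (1 / p) * (C * I) ^ (1 / q) := by
      calc I = ‖∫ x, g x * Hc ε h x‖ₑ := by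
            rw [e1, hv, Hc_anti hg.integrable hhB.integrable hε, enorm_neg]
        _ ≤ ∫⁻ x, ‖g x‖ₑ * ‖Hc ε h x‖ₑ := by
            refine (enorm_integral_le_lintegral_enorm _).trans (lintegral_mono fun x => ?_)
            rw [enorm_mul]
        _ ≤ _ := ENNReal.lintegral_mul_le_Lp_mul_Lq _ hpq hg.meas.enorm.aemeasurable
            (Hc_cont hhB.integrable hε).measurable.enorm.aemeasurable
        _ ≤ _ := by
            gcongr _ * ?_ ^ _
            · exact one_div_nonneg.2 hpq.symm.pos.le
            refine (hC ε hε h hhB).trans ?_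
            simp_rw [hhq]; rw [lintegral_indicator measurableSet_closedBall]
    rcases eq_or_ne I 0 with hI0 | hI0
    · rw [hI0]; exact zero_le
    have hqp := hpq.symm.pos
    have hp0 := hpq.pos
    have hsum : 1 / p + 1 / q = 1 := by rw [one_div, one_div]; exact hpq.inv_add_inv_eq_one
    have e3 : I ^ (1 / p) ≤ (∫⁻ x, ‖g x‖ₑ ^ p) ^ (1 / p) * C ^ (1 / q) := by
      have h5 : I ^ (1 / p) * I ^ (1 / q) ≤
          ((∫⁻ x, ‖g x‖ₑ ^ p) ^ (1 / p) * C ^ (1 / q)) * I ^ (1 / q) := by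
        rw [← ENNReal.rpow_add _ _ hI0 hItop, hsum, ENNReal.rpow_one]
        refine e2.trans (le_of_eq ?_)
        rw [ENNReal.mul_rpow_of_nonneg _ _ (by positivity), mul_assoc]
      refine (ENNReal.mul_le_mul_iff_left ?_ ?_).1 h5
      · simp [ENNReal.rpow_eq_zero_iff, hI0, hItop]
      · exact ENNReal.rpow_ne_top_of_nonneg (by positivity) hItop
    have e4 := ENNReal.rpow_le_rpow e3 hp0.le
    rw [ENNReal.mul_rpow_of_nonneg _ _ hp0.le, ← ENNReal.rpow_mul, ← ENNReal.rpow_mul,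
      ← ENNReal.rpow_mul, one_div_mul_cancel hp0.ne', ENNReal.rpow_one, ENNReal.rpow_one,
      one_div_mul_eq_div] at e4
    refine e4.trans (le_of_eq ?_)
    rw [ENNReal.coe_rpow_of_nonneg _ (by positivity), mul_comm]
  have hmono : ∫⁻ x, ‖v x‖ₑ ^ p =
      ⨆ N : ℕ, ∫⁻ x in closedBall 0 (N : ℝ), ‖v x‖ₑ ^ p := by
    rw [← setLIntegral_iUnion_of_directed, iUnion_closedBall_nat, setLIntegral_univ]
    exact Monotone.directed_le fun a b hab => closedBall_subset_closedBall (by exact_mod_cast hab)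
  rw [hmono]
  exact iSup_le hcut

lemma riesz (p : ℝ) (hp : 1 < p) : ∃ C : ℝ≥0, ∀ (ε : ℝ), 0 < ε →
    ∀ g : ℝ → ℝ, Bcs g → ∫⁻ x, ‖Hc ε g x‖ₑ ^ p ≤ C * ∫⁻ x, ‖g x‖ₑ ^ p := by
  rcases le_total p 2 with h | h
  · exact riesz_le2 p hp h
  · exact riesz_ge2 p h


lemma pois_int (x : ℝ) {s : ℝ} (hs : 0 < s) :
    Integrable (fun y : ℝ => s / ((x - y) ^ 2 + s ^ 2)) ∧ ∫ y : ℝ, s / ((x - y) ^ 2 + s ^ 2) = π := by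
  have e : (fun y : ℝ => s / ((x - y) ^ 2 + s ^ 2)) =
      fun y => (fun w : ℝ => s⁻¹ * (1 + (w / s) ^ 2)⁻¹) (x - y) := by
    ext y
    field_simp
    ring
  have h1 : Integrable (fun w : ℝ => s⁻¹ * (1 + (w / s) ^ 2)⁻¹) :=
    (integrable_inv_one_add_sq.comp_div hs.ne').const_mul _
  rw [e]
  refine ⟨h1.comp_sub_left x, ?_⟩
  rw [integral_sub_left_eq_self (fun w : ℝ => s⁻¹ * (1 + (w / s) ^ 2)⁻¹) volume x,
    integral_const_mul, Measure.integral_comp_div (fun w : ℝ => (1 + w ^ 2)⁻¹),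
    integral_univ_inv_one_add_sq, abs_of_pos hs, smul_eq_mul, inv_mul_cancel_left₀ hs.ne']

lemma FC_pois {g : ℝ → ℝ} (hg : Bcs g) {ε s : ℝ} (hε : 0 < ε) (hs : ε ≤ s) (x : ℝ) :
    Integrable (fun y : ℝ => ((s / ((x - y) ^ 2 + s ^ 2) : ℝ) : ℂ) * FC g (y + ε * Complex.I)) ∧
    ∫ y : ℝ, ((s / ((x - y) ^ 2 + s ^ 2) : ℝ) : ℂ) * FC g (y + ε * Complex.I) =
      π * FC g (x + (ε + s : ℝ) * Complex.I) := by
  have hs0 : 0 < s := by linarith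
  set z0 : ℂ := x + (ε + s : ℝ) * Complex.I with hz0
  set w0 : ℂ := x + (ε - s : ℝ) * Complex.I with hw0
  have hw0im : w0.im ≤ 0 := by simp [hw0]; linarith
  have hz0im : z0.im = ε + s := by simp [hz0]
  have hzw : z0 - w0 = 2 * s * Complex.I := by rw [hz0, hw0]; push_cast; ring
  set F := FC g with hF
  obtain ⟨D, hD0, hD⟩ := FC_bd hg hε
  have hUo : IsOpen {z : ℂ | 0 < z.im} := isOpen_lt continuous_const Complex.continuous_im
  have hFd : DifferentiableOn ℂ F {z | 0 < z.im} := FC_diff hg.integrable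
  have hne : ∀ z : ℂ, 0 < z.im → z - w0 ≠ 0 := by
    intro z hz h
    have := congrArg Complex.im h
    simp only [Complex.sub_im, Complex.zero_im] at this
    linarith
  set H : ℂ → ℂ := fun z => F z - F z0 * (2 * s * Complex.I) / (z - w0) with hH
  have hHd : DifferentiableOn ℂ H {z | 0 < z.im} := by
    refine hFd.sub (DifferentiableOn.div (by fun_prop) (by fun_prop) fun z hz => hne z hz)
  have hHz0 : H z0 = 0 := by
    simp only [hH]
    rw [hzw, mul_div_cancel_right₀, sub_self]
    simp [hs0.ne']
  have hz0U : {z : ℂ | 0 < z.im} ∈ 𝓝 z0 := hUo.mem_nhds (by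
    show 0 < z0.im
    rw [hz0im]; linarith)
  set E : ℂ → ℂ := fun z => dslope H z0 z - F z / (z - w0) with hE
  have hEd : DifferentiableOn ℂ E {z | 0 < z.im} := by
    refine ((Complex.differentiableOn_dslope hz0U).2 hHd).sub
      (hFd.div (by fun_prop) fun z hz => hne z hz)
  -- bounds
  have hlow : ∀ (a : ℂ) (c : ℝ), 0 < c → ∀ z : ℂ, c ≤ ‖z - a‖ →
      1 + ‖z‖ ≤ ((1 + ‖a‖) / c + 1) * ‖z - a‖ := by
    intro a c hc z h
    have h2 : ‖z‖ ≤ ‖z - a‖ + ‖a‖ := by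
      have := norm_add_le (z - a) a
      simpa using this
    have h3 : 1 + ‖a‖ ≤ (1 + ‖a‖) / c * ‖z - a‖ := by
      rw [div_mul_eq_mul_div, le_div_iff₀ hc]; gcongr
    linarith
  have hlow' : ∀ a : ℂ, ∀ c : ℝ, 0 < c → ∀ z : ℂ, c ≤ ‖z - a‖ →
      ‖z - a‖⁻¹ ≤ ((1 + ‖a‖) / c + 1) * (1 + ‖z‖)⁻¹ := by
    intro a c hc z h
    rw [← div_eq_mul_inv, inv_eq_one_div, div_le_div_iff₀ (by linarith) (by positivity), one_mul]
    exact hlow a c hc z h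
  have hw0d : ∀ z : ℂ, ε ≤ z.im → ε ≤ ‖z - w0‖ := by
    intro z hz
    have := Complex.abs_im_le_norm (z - w0)
    rw [Complex.sub_im] at this
    exact ((le_abs_self _).trans this).trans' (by linarith)
  obtain ⟨M, hM⟩ := (isCompact_closedBall z0 (s / 2)).exists_bound_of_continuousOn
    (hEd.continuousOn.mono (fun z hz => by
      rw [mem_closedBall, dist_eq_norm] at hz
      have := (Complex.abs_im_le_norm (z - z0)).trans hz
      rw [Complex.sub_im, hz0im] at this
      have := (abs_le.1 this).1
      show 0 < z.im
      linarith))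
  set D1 := (1 + ‖w0‖) / ε + 1 with hD1
  set D2 := (1 + ‖z0‖) / (s / 2) + 1 with hD2
  set B1 := (D + ‖F z0 * (2 * s * Complex.I)‖ * D1) * D2 + D * D1 with hB1
  have hB1' : ∀ z : ℂ, ε ≤ z.im → s / 2 ≤ ‖z - z0‖ → ‖E z‖ ≤ B1 * ((1 + ‖z‖)⁻¹ * (1 + ‖z‖)⁻¹) := by
    intro z hz hzz
    have hne0 : z ≠ z0 := by
      rintro rfl
      simp at hzz
      linarith
    have h1 := hlow' w0 ε hε z (hw0d z hz)
    have h2 := hlow' z0 (s / 2) (by positivity) z hzz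
    have h3 := hD z hz
    have hHb : ‖H z‖ ≤ (D + ‖F z0 * (2 * s * Complex.I)‖ * D1) * (1 + ‖z‖)⁻¹ := by
      simp only [hH]
      refine (norm_sub_le _ _).trans ?_
      rw [norm_div, div_eq_mul_inv]
      calc _ ≤ D * (1 + ‖z‖)⁻¹ + ‖F z0 * (2 * s * Complex.I)‖ * (D1 * (1 + ‖z‖)⁻¹) := by gcongr
        _ = _ := by ring
    simp only [hE]
    rw [dslope_of_ne _ hne0, slope_def_field, hHz0, sub_zero]
    refine (norm_sub_le _ _).trans ?_
    rw [norm_div, norm_div, div_eq_mul_inv, div_eq_mul_inv]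
    calc _ ≤ ((D + ‖F z0 * (2 * s * Complex.I)‖ * D1) * (1 + ‖z‖)⁻¹) * (D2 * (1 + ‖z‖)⁻¹) +
        (D * (1 + ‖z‖)⁻¹) * (D1 * (1 + ‖z‖)⁻¹) := by gcongr
      _ = _ := by rw [hB1]; ring
  set B2 := |M| * (1 + ‖z0‖ + s) ^ 2 with hB2
  have hD1p : 0 < D1 := by positivity
  have hD2p : 0 < D2 := by positivity
  have hB1p : 0 ≤ B1 := by positivity
  have hbd : ∀ z : ℂ, ε ≤ z.im → ‖E z‖ ≤ (B1 + B2) * (1 + ‖z‖) ^ (-(2 : ℝ)) := by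
    intro z hz
    rw [Real.rpow_neg (by positivity), Real.rpow_two, pow_two, mul_inv, add_mul]
    rcases le_total (s / 2) ‖z - z0‖ with h | h
    · refine (hB1' z hz h).trans ?_
      have : 0 ≤ B2 * ((1 + ‖z‖)⁻¹ * (1 + ‖z‖)⁻¹) := by positivity
      linarith
    · have h1 := hM z (by rw [mem_closedBall, dist_eq_norm]; exact h)
      have h2 : ‖z‖ ≤ ‖z - z0‖ + ‖z0‖ := by
        have := norm_add_le (z - z0) z0
        simpa using this
      have h3 : |M| ≤ B2 * ((1 + ‖z‖)⁻¹ * (1 + ‖z‖)⁻¹) := by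
        rw [hB2, ← mul_inv, ← div_eq_mul_inv, le_div_iff₀ (by positivity), ← pow_two]
        have : 1 + ‖z‖ ≤ 1 + ‖z0‖ + s := by linarith
        gcongr
      have : 0 ≤ B1 * ((1 + ‖z‖)⁻¹ * (1 + ‖z‖)⁻¹) := by positivity
      linarith [le_abs_self M]
  obtain ⟨hI, hI0⟩ := line_int_zero E hEd 2 _ ε one_lt_two hε hbd
  have key : ∀ y : ℝ, ((s / ((x - y) ^ 2 + s ^ 2) : ℝ) : ℂ) * F (y + ε * Complex.I) =
      (2 * Complex.I)⁻¹ * E (y + ε * Complex.I) + ((s / ((x - y) ^ 2 + s ^ 2) : ℝ) : ℂ) * F z0 := by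
    intro y
    have ha : (y : ℂ) + ε * Complex.I - z0 = (y - x) - s * Complex.I := by
      rw [hz0]; push_cast; ring
    have hb : (y : ℂ) + ε * Complex.I - w0 = (y - x) + s * Complex.I := by
      rw [hw0]; push_cast; ring
    have ha0 : ((y : ℂ) - x) - s * Complex.I ≠ 0 := by
      intro h
      have := congrArg Complex.im h
      simp at this; linarith
    have hb0 : ((y : ℂ) - x) + s * Complex.I ≠ 0 := by
      intro h
      have := congrArg Complex.im h
      simp at this; linarith
    have hne0 : (y : ℂ) + ε * Complex.I ≠ z0 := by
      intro h; rw [h, sub_self] at ha; exact ha0 ha.symm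
    have hc : ((s / ((x - y) ^ 2 + s ^ 2) : ℝ) : ℂ) =
        s / ((((y : ℂ) - x) - s * Complex.I) * (((y : ℂ) - x) + s * Complex.I)) := by
      push_cast
      congr 1
      linear_combination ((s : ℂ) ^ 2) * Complex.I_sq
    simp only [hE]
    rw [dslope_of_ne _ hne0, slope_def_field, hHz0, sub_zero, ha, hb, hc]
    simp only [hH]
    rw [hb]
    have hI2 : (2 * Complex.I : ℂ) ≠ 0 := by simp
    set a := ((y : ℂ) - x) - s * Complex.I with haa
    set b := ((y : ℂ) - x) + s * Complex.I with hbb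
    have hab : b = a + 2 * s * Complex.I := by rw [haa, hbb]; ring
    have hII := Complex.I_ne_zero
    field_simp
    rw [hab]
    ring
  have hP := pois_int x hs0
  simp only [key]
  have hi1 : Integrable (fun y : ℝ => (2 * Complex.I)⁻¹ * E (y + ε * Complex.I)) := hI.const_mul _
  have hi2 : Integrable (fun y : ℝ => ((s / ((x - y) ^ 2 + s ^ 2) : ℝ) : ℂ) * F z0) :=
    hP.1.ofReal.mul_const _
  refine ⟨hi1.add hi2, ?_⟩
  rw [integral_add hi1 hi2, integral_const_mul, hI0, integral_mul_const]
  have := integral_ofReal (𝕜 := ℂ) (f := fun y : ℝ => s / ((x - y) ^ 2 + s ^ 2)) (μ := volume)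
  simp only [Complex.coe_algebraMap, RCLike.ofReal] at this
  erw [this, hP.2]
  simp

lemma Hc_mx : ∃ C : ℝ≥0, ∀ (g : ℝ → ℝ), Bcs g → ∀ (ε t : ℝ), 0 < ε → 2 * ε ≤ t → ∀ x,
    ‖Hc t g x‖ₑ ≤ C * mx (fun s => ‖Hc ε g s‖ₑ) x := by
  obtain ⟨C, hC⟩ := Pc_mx
  refine ⟨C, fun g hg ε t hε ht x => ?_⟩
  obtain ⟨h1, h2⟩ := FC_pois hg hε (s := t - ε) (by linarith) x
  rw [add_sub_cancel, FC_eq hg.integrable _ (by linarith : 0 < t)] at h2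
  have him := integral_im h1
  simp only [RCLike.im_eq_complex_im] at him
  rw [h2, Complex.im_ofReal_mul] at him
  have e : ∀ y : ℝ, (((((t - ε) / ((x - y) ^ 2 + (t - ε) ^ 2) : ℝ)) : ℂ) *
      FC g (y + ε * Complex.I)).im = (t - ε) / ((x - y) ^ 2 + (t - ε) ^ 2) * Hc ε g y := by
    intro y
    rw [Complex.im_ofReal_mul, FC_eq hg.integrable _ hε]; simp
  simp only [e] at him
  have h3 : Hc t g x = π⁻¹ * ∫ y, (t - ε) / ((x - y) ^ 2 + (t - ε) ^ 2) * Hc ε g y := by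
    rw [him]
    simp [Real.pi_ne_zero]
  rw [h3, enorm_mul]
  have h4 : ‖π⁻¹‖ₑ ≤ 1 := by
    rw [Real.enorm_eq_ofReal_abs, abs_of_pos (by positivity)]
    rw [← ENNReal.ofReal_one]
    exact ENNReal.ofReal_le_ofReal (inv_le_one_of_one_le₀ (by linarith [Real.pi_gt_three]))
  calc _ ≤ 1 * _ := mul_le_mul_left h4 _
    _ ≤ _ := by
      rw [one_mul]
      refine (enorm_int_le _ _ (fun y => (t - ε) / ((x - y) ^ 2 + (t - ε) ^ 2)) fun y => ?_).trans
        (hC _ (Hc_cont hg.integrable hε).measurable x (t - ε) (by linarith))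
      have : 0 < t - ε := by linarith
      rw [abs_of_nonneg (by positivity)]

lemma rpow_iSup {ι : Sort*} (f : ι → ℝ≥0∞) {p : ℝ} (hp : 0 < p) :
    (⨆ i, f i) ^ p = ⨆ i, f i ^ p := (ENNReal.orderIsoRpow p hp).map_iSup f

lemma Hc_max (p : ℝ) (hp : 1 < p) : ∃ C : ℝ≥0, ∀ g : ℝ → ℝ, Bcs g →
    ∫⁻ x, (⨆ k : ℤ, ‖Hc ((2 : ℝ) ^ k) g x‖ₑ) ^ p ≤ C * ∫⁻ x, ‖g x‖ₑ ^ p := by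
  obtain ⟨C1, hC1⟩ := Hc_mx
  obtain ⟨C2, hC2⟩ := mx_strong (E := ℝ) (by simp) p hp
  obtain ⟨C3, hC3⟩ := riesz p hp
  refine ⟨C1 ^ p * C2 * C3, fun g hg => ?_⟩
  have hp0 : 0 < p := by linarith
  have e : ∀ x, (⨆ k : ℤ, ‖Hc ((2 : ℝ) ^ k) g x‖ₑ) ^ p =
      ⨆ J : ℕ, (⨆ (k : ℤ) (_ : -(J : ℤ) ≤ k), ‖Hc ((2 : ℝ) ^ k) g x‖ₑ) ^ p := by
    intro x
    rw [← rpow_iSup _ hp0]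
    congr 1
    apply le_antisymm
    · refine iSup_le fun k => le_iSup_of_le k.natAbs (le_iSup₂_of_le k ?_ le_rfl)
      omega
    · refine iSup_le fun J => iSup₂_le fun k _ => le_iSup (fun k : ℤ => ‖Hc ((2 : ℝ) ^ k) g x‖ₑ) k
  simp_rw [e]
  rw [lintegral_iSup]
  · refine iSup_le fun J => ?_
    have h0 : (0 : ℝ) < 2 ^ (-(J : ℤ) - 1) := by positivity
    calc _ ≤ ∫⁻ x, (C1 * mx (fun s => ‖Hc (2 ^ (-(J : ℤ) - 1)) g s‖ₑ) x) ^ p := by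
          refine lintegral_mono fun x => ENNReal.rpow_le_rpow ?_ hp0.le
          refine iSup₂_le fun k hk => hC1 g hg _ _ h0 ?_ x
          rw [← zpow_one_add₀ (by norm_num)]
          exact zpow_le_zpow_right₀ (by norm_num) (by omega)
      _ ≤ _ := by
          simp_rw [ENNReal.mul_rpow_of_nonneg _ _ hp0.le]
          rw [lintegral_const_mul' _ _ (ENNReal.rpow_ne_top_of_nonneg hp0.le (by simp))]
          calc _ ≤ (C1 : ℝ≥0∞) ^ p * (C2 * (C3 * ∫⁻ x, ‖g x‖ₑ ^ p)) := by
                gcongr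
                refine (hC2 _ (Hc_cont hg.integrable h0).measurable.enorm).trans ?_
                gcongr
                exact hC3 _ h0 g hg
            _ = _ := by
                push_cast
                rw [ENNReal.coe_rpow_of_nonneg _ hp0.le]
                ring
  · intro J
    refine Measurable.pow_const (Measurable.iSup fun k => Measurable.iSup fun _ => ?_) _
    exact (Hc_cont hg.integrable (by positivity)).measurable.enorm
  · intro J J' h x
    refine ENNReal.rpow_le_rpow ?_ hp0.le
    refine iSup₂_le fun k hk => le_iSup₂_of_le k ?_ le_rfl
    have : (J : ℤ) ≤ J' := by exact_mod_cast h
    linarith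

/-- truncated Hilbert transform -/
def Ht (t : ℝ) (g : ℝ → ℝ) (x : ℝ) : ℝ := ∫ s : ℝ, (if t < |x - s| then (x - s)⁻¹ else 0) * g s

lemma Ht_kbd {t : ℝ} (ht : 0 < t) (r : ℝ) : ‖(if t < |r| then r⁻¹ else 0 : ℝ)‖ ≤ 1 / t := by
  split_ifs with h
  · rw [norm_inv, Real.norm_eq_abs, ← one_div]; exact one_div_le_one_div_of_le ht h.le
  · simp; positivity

lemma Ht_meas (t x : ℝ) : Measurable (fun s : ℝ => (if t < |x - s| then (x - s)⁻¹ else 0 : ℝ)) := by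
  refine Measurable.ite (measurableSet_lt measurable_const (by fun_prop)) (by fun_prop)
    measurable_const

lemma Ht_intg {g : ℝ → ℝ} (hg : Integrable g) {t : ℝ} (ht : 0 < t) (x : ℝ) :
    Integrable (fun s => (if t < |x - s| then (x - s)⁻¹ else 0) * g s) :=
  hg.bdd_mul (Ht_meas t x).aestronglyMeasurable (Eventually.of_forall fun s => Ht_kbd ht (x - s))

theorem hil_max (p : ℝ) (hp : 1 < p) : ∃ C : ℝ≥0, ∀ g : ℝ → ℝ, Bcs g →
    ∫⁻ x, (⨆ k : ℤ, ‖Ht ((2 : ℝ) ^ k) g x‖ₑ) ^ p ≤ C * ∫⁻ x, ‖g x‖ₑ ^ p := by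
  obtain ⟨C1, hC1⟩ := Hc_max p hp
  obtain ⟨C2, hC2⟩ := mx_strong (E := ℝ) (by simp) p hp
  obtain ⟨C3, hC3⟩ := Pc_mx
  refine ⟨2 ^ (p - 1) * (C1 + C3 ^ p * C2), fun g hg => ?_⟩
  have hp0 : 0 < p := by linarith
  have hpt : ∀ x, (⨆ k : ℤ, ‖Ht ((2 : ℝ) ^ k) g x‖ₑ) ≤
      (⨆ k : ℤ, ‖Hc ((2 : ℝ) ^ k) g x‖ₑ) + C3 * mx (fun s => ‖g s‖ₑ) x := by
    intro x
    refine iSup_le fun k => ?_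
    have ht : (0 : ℝ) < 2 ^ k := by positivity
    generalize htk : (2 : ℝ) ^ k = t at ht
    have h1 : Ht t g x = Hc t g x + ∫ s : ℝ, ((if t < |x - s| then (x - s)⁻¹ else 0) -
        (x - s) / ((x - s) ^ 2 + t ^ 2)) * g s := by
      simp_rw [sub_mul]
      rw [integral_sub (Ht_intg hg.integrable ht x) (Hc_intg hg.integrable ht x), Ht, Hc]
      ring
    rw [h1]
    refine (enorm_add_le _ _).trans (add_le_add ?_ ?_)
    · rw [← htk]; exact le_iSup (fun k : ℤ => ‖Hc ((2 : ℝ) ^ k) g x‖ₑ) k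
    · refine (enorm_int_le _ _ (fun y => t / ((x - y) ^ 2 + t ^ 2)) fun y => ?_).trans
        (hC3 _ hg.meas x t ht)
      generalize x - y = r
      split_ifs with h
      · have hr : 0 < |r| := by linarith
        have hr0 : r ≠ 0 := abs_pos.1 hr
        have : r⁻¹ - r / (r ^ 2 + t ^ 2) = t ^ 2 / (r * (r ^ 2 + t ^ 2)) := by
          have : r ^ 2 + t ^ 2 ≠ 0 := by positivity
          field_simp; ring
        rw [this, abs_div, abs_mul, abs_of_pos (by positivity : 0 < r ^ 2 + t ^ 2),
          abs_of_pos (by positivity : 0 < t ^ 2), div_le_div_iff₀ (by positivity) (by positivity)]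
        have : t * t * (r ^ 2 + t ^ 2) ≤ t * |r| * (r ^ 2 + t ^ 2) := by gcongr
        nlinarith
      · rw [zero_sub, abs_neg, abs_div, abs_of_pos (by positivity : 0 < r ^ 2 + t ^ 2)]
        gcongr
        exact not_lt.1 h
  calc _ ≤ ∫⁻ x, 2 ^ (p - 1) * ((⨆ k : ℤ, ‖Hc ((2 : ℝ) ^ k) g x‖ₑ) ^ p +
        (C3 * mx (fun s => ‖g s‖ₑ) x) ^ p) := lintegral_mono fun x => rpow_le_of_le hp _ _ _ (hpt x)
    _ = 2 ^ (p - 1) * ((∫⁻ x, (⨆ k : ℤ, ‖Hc ((2 : ℝ) ^ k) g x‖ₑ) ^ p) +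
        C3 ^ p * ∫⁻ x, (mx (fun s => ‖g s‖ₑ) x) ^ p) := by
        rw [lintegral_const_mul' _ _ (by rw [two_rpow_ne]; simp), lintegral_add_left]
        · simp_rw [ENNReal.mul_rpow_of_nonneg _ _ hp0.le]
          rw [lintegral_const_mul' _ _ (ENNReal.rpow_ne_top_of_nonneg hp0.le (by simp))]
        · exact Measurable.pow_const (Measurable.iSup fun k =>
            (Hc_cont hg.integrable (by positivity)).measurable.enorm) _
    _ ≤ 2 ^ (p - 1) * (C1 * (∫⁻ x, ‖g x‖ₑ ^ p) + C3 ^ p * (C2 * ∫⁻ x, ‖g x‖ₑ ^ p)) := by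
        gcongr
        · exact hC1 g hg
        · exact hC2 _ hg.meas.enorm
    _ = _ := by
        rw [two_rpow_ne]; push_cast
        rw [ENNReal.coe_rpow_of_nonneg _ hp0.le]; ring


section Rot
variable {E : Type*} [NormedAddCommGroup E] [InnerProductSpace ℝ E] [FiniteDimensional ℝ E]
  [MeasurableSpace E] [BorelSpace E]

lemma fub_line (θ : E) (hθ : ‖θ‖ = 1) (F : E → ℝ≥0∞) (hF : Measurable F) :
    ∫⁻ x, F x = ∫⁻ w : (Submodule.span ℝ {θ})ᗮ, ∫⁻ s : ℝ, F (s • θ + w) := by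
  set K := Submodule.span ℝ {θ}
  have h1 : MeasurePreserving (K.orthogonalDecomposition.symm) :=
    LinearIsometryEquiv.measurePreserving _
  have h2 : MeasurePreserving (@WithLp.toLp 2 (K × Kᗮ)) := WithLp.volume_preserving_toLp _ _
  have h3 : MeasurePreserving (LinearIsometryEquiv.toSpanUnitSingleton (𝕜 := ℝ) θ hθ) :=
    LinearIsometryEquiv.measurePreserving _
  have h4 : MeasurePreserving (Prod.map (LinearIsometryEquiv.toSpanUnitSingleton (𝕜 := ℝ) θ hθ)
      (id : Kᗮ → Kᗮ)) (volume.prod volume) (volume.prod volume) := h3.prod (MeasurePreserving.id _)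
  have h5 := (h1.comp h2).comp h4
  rw [← h5.lintegral_comp hF]
  refine (lintegral_prod_symm _ (hF.comp h5.measurable).aemeasurable).trans ?_
  congr 1

/-- directional truncated Hilbert transform -/
def Hd (t : ℝ) (g : E → ℝ) (x θ : E) : ℝ :=
  ∫ r : ℝ, (if t < |r| then r⁻¹ else 0) * g (x - r • θ)

lemma Hd_meas (t : ℝ) (g : E → ℝ) (hg : Measurable g) :
    Measurable (fun q : E × E => Hd t g q.1 q.2) := by
  have : Measurable (fun z : (E × E) × ℝ => (if t < |z.2| then z.2⁻¹ else 0) *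
      g (z.1.1 - z.2 • z.1.2)) := by
    refine Measurable.mul (Measurable.ite (measurableSet_lt measurable_const (by fun_prop))
      (by fun_prop) measurable_const) (hg.comp (by fun_prop))
  exact (this.stronglyMeasurable.integral_prod_right').measurable

lemma Bcs.line {g : E → ℝ} (hg : Bcs g) (θ w : E) (hθ : ‖θ‖ = 1) :
    Bcs (fun s : ℝ => g (s • θ + w)) := by
  obtain ⟨B, hB0, hB⟩ := hg.bdd
  obtain ⟨R, hR0, hR⟩ := hg.supp
  refine ⟨hg.meas.comp (by fun_prop), ⟨B, hB0, fun s => hB _⟩, ⟨R + ‖w‖, by positivity, ?_⟩⟩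
  intro s hs
  refine hR _ ?_
  have : ‖s • θ‖ ≤ ‖s • θ + w‖ + ‖w‖ := by
    have := norm_sub_le (s • θ + w) w
    simpa using this
  rw [norm_smul, hθ, mul_one] at this
  linarith

lemma Hd_max (p : ℝ) (hp : 1 < p) : ∃ C : ℝ≥0, ∀ g : E → ℝ, Bcs g → ∀ θ : E, ‖θ‖ = 1 →
    ∫⁻ x, (⨆ k : ℤ, ‖Hd ((2 : ℝ) ^ k) g x θ‖ₑ) ^ p ≤ C * ∫⁻ x, ‖g x‖ₑ ^ p := by
  obtain ⟨C, hC⟩ := hil_max p hp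
  refine ⟨C, fun g hg θ hθ => ?_⟩
  have hm : Measurable (fun x : E => (⨆ k : ℤ, ‖Hd ((2 : ℝ) ^ k) g x θ‖ₑ) ^ p) := by
    refine Measurable.pow_const (Measurable.iSup fun k => ?_) _
    exact ((Hd_meas _ g hg.meas).comp (measurable_id.prodMk measurable_const)).enorm
  rw [fub_line θ hθ _ hm, fub_line θ hθ _ (hg.meas.enorm.pow_const p)]
  rw [← lintegral_const_mul' _ _ (by simp)]
  refine lintegral_mono fun w => ?_
  refine le_trans (le_of_eq ?_) (hC _ (hg.line θ w hθ))
  congr 1; ext s; congr 2; ext k; congr 1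
  rw [Hd, Ht, ← integral_sub_left_eq_self _ volume s]
  congr 1; ext r
  rw [sub_smul]
  congr 2
  abel

lemma polar (f : E → ℝ) (hf : Integrable f) (hE : 0 < Module.finrank ℝ E) :
    ‖∫ x, f x‖ₑ ≤ ∫⁻ θ : sphere (0 : E) 1,
      ‖∫ r in Set.Ioi (0 : ℝ), r ^ (Module.finrank ℝ E - 1) * f (r • (θ : E))‖ₑ
      ∂(volume : Measure E).toSphere := by
  have : Nontrivial E := Module.finrank_pos_iff.1 hE
  have hmp := (volume : Measure E).measurePreserving_homeomorphUnitSphereProd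
  have hms : MeasurableSet ({0}ᶜ : Set E) := (measurableSet_singleton _).compl
  have e1 : ∫ x, f x = ∫ x : ({0}ᶜ : Set E), f x ∂(volume.comap Subtype.val) := by
    rw [integral_subtype_comap hms, restrict_compl_singleton]
  have e2 : ∫ x : ({0}ᶜ : Set E), f x ∂(volume.comap Subtype.val) =
      ∫ z, f (z.2.1 • z.1.1) ∂((volume : Measure E).toSphere.prod
        (Measure.volumeIoiPow (Module.finrank ℝ E - 1))) := by
    rw [← hmp.integral_comp (homeomorphUnitSphereProd E).measurableEmbedding
      (fun z : sphere (0 : E) 1 × Set.Ioi (0 : ℝ) => f (z.2.1 • z.1.1))]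
    congr 1; ext x
    congr 1
    have := (homeomorphUnitSphereProd E).symm_apply_apply x
    exact (congrArg Subtype.val this).symm
  have hI : Integrable (fun z : sphere (0 : E) 1 × Set.Ioi (0 : ℝ) => f (z.2.1 • z.1.1))
      ((volume : Measure E).toSphere.prod (Measure.volumeIoiPow (Module.finrank ℝ E - 1))) := by
    rw [← hmp.integrable_comp_emb (homeomorphUnitSphereProd E).measurableEmbedding]
    have : Integrable (fun x : ({0}ᶜ : Set E) => f x) (volume.comap Subtype.val) := by
      have := (integrableOn_iff_comap_subtypeVal hms).1 (hf.integrableOn (s := {0}ᶜ))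
      exact this
    convert this using 1
    ext x
    simp only [Function.comp]
    congr 1
    have := (homeomorphUnitSphereProd E).symm_apply_apply x
    exact (congrArg Subtype.val this)
  rw [e1, e2, integral_prod _ hI]
  refine (enorm_integral_le_lintegral_enorm _).trans (le_of_eq ?_)
  congr 1; ext θ; congr 1
  rw [Measure.volumeIoiPow, integral_withDensity_eq_integral_toReal_smul₀]
  · rw [← integral_subtype_comap measurableSet_Ioi
      (fun r : ℝ => r ^ (Module.finrank ℝ E - 1) * f (r • (θ : E)))]
    congr 1; ext r
    rw [ENNReal.toReal_ofReal (by have := (Set.mem_Ioi.1 r.2).le; positivity), smul_eq_mul]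
  · fun_prop
  · simp


lemma Hd_half (t : ℝ) (ht : 0 < t) {g : E → ℝ} (hg : Bcs g) (x θ : E) (hθ : ‖θ‖ = 1) :
    Hd t g x θ = ∫ r in Set.Ioi (0 : ℝ), (if t < r then r⁻¹ else 0) *
      (g (x - r • θ) - g (x + r • θ)) := by
  have hi : Integrable (fun r : ℝ => (if t < |r| then r⁻¹ else 0) * g (x - r • θ)) := by
    have h1 : Integrable (fun r : ℝ => g (x - r • θ)) := by
      have := (hg.line (-θ) x (by simpa using hθ)).integrable
      refine this.congr (Eventually.of_forall fun r => ?_)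
      simp only [smul_neg]
      congr 1; abel
    refine h1.bdd_mul (c := 1 / t) ?_ (Eventually.of_forall fun r => Ht_kbd ht r)
    exact (Measurable.ite (measurableSet_lt measurable_const (by fun_prop))
      (by fun_prop) measurable_const).aestronglyMeasurable
  rw [Hd, ← integral_add_compl measurableSet_Ioi hi (s := Set.Ioi (0 : ℝ)), Set.compl_Ioi]
  have := integral_comp_neg_Ioi (0 : ℝ) (fun r : ℝ => (if t < |r| then r⁻¹ else 0) * g (x - r • θ))
  rw [neg_zero] at this
  rw [← this, ← integral_add hi.integrableOn]
  · refine setIntegral_congr_fun measurableSet_Ioi fun r hr => ?_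
    simp only [abs_neg, abs_of_pos (Set.mem_Ioi.1 hr), neg_smul, sub_neg_eq_add]
    split_ifs
    · rw [inv_neg]; ring
    · ring
  · exact (hi.comp_neg).integrableOn

/-- truncated singular integral -/
def Tt (Ω : E → ℝ) (t : ℝ) (g : E → ℝ) (x : E) : ℝ :=
  ∫ y, (if t < ‖y‖ then Ω y else 0) * g (x - y)

structure OddKer (Ω : E → ℝ) : Prop where
  meas : Measurable Ω
  odd : ∀ y, Ω (-y) = - Ω y
  hom : ∀ (r : ℝ) y, 0 < r → y ≠ 0 → Ω (r • y) = (r ^ (Module.finrank ℝ E))⁻¹ * Ω y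
  bdd : ∃ M : ℝ≥0, ∀ y, ‖y‖ = 1 → ‖Ω y‖ₑ ≤ M

lemma OddKer.bd {Ω : E → ℝ} (h : OddKer Ω) {M : ℝ≥0} (hM : ∀ y, ‖y‖ = 1 → ‖Ω y‖ₑ ≤ M) (t : ℝ)
    (ht : 0 < t) (y : E) : ‖if t < ‖y‖ then Ω y else 0‖ ≤ (t ^ (Module.finrank ℝ E))⁻¹ * M := by
  split_ifs with h1
  · have hy : 0 < ‖y‖ := ht.trans h1
    have e : y = ‖y‖ • (‖y‖⁻¹ • y) := by rw [smul_smul, mul_inv_cancel₀ hy.ne', one_smul]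
    have hn : ‖(‖y‖⁻¹ • y)‖ = 1 := by rw [norm_smul]; simp [hy.ne']
    rw [e, h.hom _ _ hy (by intro h0; simp [h0] at hn), norm_mul]
    have h2 : ‖Ω (‖y‖⁻¹ • y)‖ ≤ M := by
      have := hM _ hn
      rw [enorm_eq_nnnorm] at this
      exact_mod_cast this
    refine mul_le_mul ?_ h2 (norm_nonneg _) (by positivity)
    rw [norm_inv, norm_pow, norm_norm]
    gcongr
  · simp; positivity

lemma Tt_le {Ω : E → ℝ} (h : OddKer Ω) {M : ℝ≥0} (hM : ∀ y, ‖y‖ = 1 → ‖Ω y‖ₑ ≤ M) (t : ℝ)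
    (ht : 0 < t) {g : E → ℝ} (hg : Bcs g) (hE : 0 < Module.finrank ℝ E) (x : E) :
    ‖Tt Ω t g x‖ₑ ≤ M * ∫⁻ θ : sphere (0 : E) 1, ‖Hd t g x θ‖ₑ ∂(volume : Measure E).toSphere := by
  have hkm : Measurable (fun y : E => if t < ‖y‖ then Ω y else 0) :=
    Measurable.ite (measurableSet_lt measurable_const (by fun_prop)) h.meas measurable_const
  have hi : Integrable (fun y => (if t < ‖y‖ then Ω y else 0) * g (x - y)) := by
    refine Integrable.bdd_mul (c := (t ^ (Module.finrank ℝ E))⁻¹ * M) ?_ hkm.aestronglyMeasurable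
      (Eventually.of_forall fun y => h.bd hM t ht y)
    exact hg.integrable.comp_sub_left x
  have hi' := hi.comp_neg
  have e1 : ∫ y, ((if t < ‖y‖ then Ω y else 0) * g (x - y) +
      (if t < ‖-y‖ then Ω (-y) else 0) * g (x - -y)) = 2 * Tt Ω t g x := by
    rw [integral_add hi hi', integral_neg_eq_self
      (fun y => (if t < ‖y‖ then Ω y else 0) * g (x - y)), Tt]
    ring
  have e2 := polar _ (hi.add hi') hE
  simp only [Pi.add_apply] at e2
  rw [e1] at e2
  have e3 : ‖Tt Ω t g x‖ₑ ≤ ‖2 * Tt Ω t g x‖ₑ := by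
    rw [enorm_mul]
    refine le_mul_of_one_le_left (by simp) ?_
    rw [enorm_eq_nnnorm]
    norm_num
  refine e3.trans (e2.trans ?_)
  rw [← lintegral_const_mul' _ _ (by simp)]
  refine lintegral_mono fun θ => ?_
  have hθ : ‖(θ : E)‖ = 1 := by simpa using θ.2
  refine le_trans (le_of_eq ?_) (mul_le_mul' (hM _ hθ) le_rfl)
  rw [Hd_half t ht hg x θ hθ, ← enorm_mul, ← integral_const_mul]
  congr 1
  refine setIntegral_congr_fun measurableSet_Ioi fun r hr => ?_
  have hr : 0 < r := hr
  simp only [norm_neg, norm_smul, hθ, mul_one, norm_of_nonneg hr.le, sub_neg_eq_add, h.odd,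
    h.hom r _ hr (by intro h0; simp [h0] at hθ : (θ : E) ≠ 0)]
  split_ifs
  · obtain ⟨j, hj⟩ : ∃ j, Module.finrank ℝ E = j + 1 := ⟨_, (Nat.succ_pred_eq_of_pos hE).symm⟩
    rw [hj, Nat.add_sub_cancel, pow_succ]
    field_simp
    ring
  · ring

lemma holder_fin {X : Type*} [MeasurableSpace X] (σ : Measure X) (p : ℝ) (hp : 1 < p)
    (G : X → ℝ≥0∞) (hG : Measurable G) :
    (∫⁻ θ, G θ ∂σ) ^ p ≤ σ Set.univ ^ (p - 1) * ∫⁻ θ, G θ ^ p ∂σ := by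
  have hq := Real.HolderConjugate.conjExponent hp
  have h3 := ENNReal.lintegral_mul_le_Lp_mul_Lq σ hq.symm (f := fun _ => 1)
    (g := G) aemeasurable_const hG.aemeasurable
  simp only [Pi.mul_apply, one_mul, ENNReal.one_rpow, lintegral_one] at h3
  refine (ENNReal.rpow_le_rpow h3 (by linarith)).trans (le_of_eq ?_)
  rw [ENNReal.mul_rpow_of_nonneg _ _ (by linarith), ← ENNReal.rpow_mul, ← ENNReal.rpow_mul]
  have : 1 / p * p = 1 := by field_simp
  rw [this, ENNReal.rpow_one]
  congr 2
  have h4 := hq.symm.sub_one_mul_conj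
  have h5 := hq.symm.ne_zero
  have : p ≠ 0 := by linarith
  have h6 := hq.inv_add_inv_eq_one
  field_simp at h6 ⊢
  linarith

lemma Tt_max {Ω : E → ℝ} (h : OddKer Ω) (hE : 0 < Module.finrank ℝ E) (p : ℝ) (hp : 1 < p) :
    ∃ C : ℝ≥0, ∀ g : E → ℝ, Bcs g →
    ∫⁻ x, (⨆ k : ℤ, ‖Tt Ω ((2 : ℝ) ^ k) g x‖ₑ) ^ p ≤ C * ∫⁻ x, ‖g x‖ₑ ^ p := by
  obtain ⟨M, hM⟩ := h.bdd
  obtain ⟨C, hC⟩ := Hd_max (E := E) p hp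
  have hS0 : (volume : Measure E).toSphere Set.univ ≠ ∞ := measure_ne_top _ _
  obtain ⟨σ, hσ⟩ : ∃ σ, σ = (volume : Measure E).toSphere := ⟨_, rfl⟩
  have hsf : IsFiniteMeasure σ := by rw [hσ]; infer_instance
  obtain ⟨S, hSd⟩ : ∃ S, S = σ Set.univ := ⟨_, rfl⟩
  have hS : S ≠ ∞ := by rw [hSd, hσ]; exact hS0
  have hD : (M : ℝ≥0∞) ^ p * (S ^ (p - 1) * (C * S)) ≠ ∞ := by
    refine ENNReal.mul_ne_top (ENNReal.rpow_ne_top_of_nonneg (by linarith) (by simp)) ?_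
    refine ENNReal.mul_ne_top (ENNReal.rpow_ne_top_of_nonneg (by linarith) hS) ?_
    exact ENNReal.mul_ne_top (by simp) hS
  refine ⟨((M : ℝ≥0∞) ^ p * (S ^ (p - 1) * (C * S))).toNNReal, fun g hg => ?_⟩
  rw [ENNReal.coe_toNNReal hD]
  obtain ⟨G, hG⟩ : ∃ G : E → E → ℝ≥0∞, G = fun x θ => ⨆ k : ℤ, ‖Hd ((2 : ℝ) ^ k) g x θ‖ₑ :=
    ⟨_, rfl⟩
  have hGm : Measurable (fun q : E × E => G q.1 q.2) := by
    rw [hG]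
    exact Measurable.iSup fun k => (Hd_meas _ g hg.meas).enorm
  have hGm' : Measurable (fun q : E × sphere (0 : E) 1 => G q.1 q.2) :=
    hGm.comp (measurable_fst.prodMk (measurable_subtype_coe.comp measurable_snd))
  have hGx : ∀ x, Measurable (fun θ : sphere (0 : E) 1 => G x θ) := fun x =>
    hGm'.comp (measurable_const.prodMk measurable_id)
  have h1 : ∀ x, (⨆ k : ℤ, ‖Tt Ω ((2 : ℝ) ^ k) g x‖ₑ) ^ p ≤
      (M : ℝ≥0∞) ^ p * (S ^ (p - 1) * ∫⁻ θ : sphere (0 : E) 1, G x θ ^ p ∂σ) := by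
    intro x
    have h2 : (⨆ k : ℤ, ‖Tt Ω ((2 : ℝ) ^ k) g x‖ₑ) ≤ M * ∫⁻ θ : sphere (0 : E) 1, G x θ ∂σ := by
      refine iSup_le fun k => (Tt_le h hM _ (by positivity) hg hE x).trans ?_
      rw [hσ]
      refine mul_le_mul' le_rfl (lintegral_mono fun θ => ?_)
      rw [hG]
      exact le_iSup (fun k : ℤ => ‖Hd ((2 : ℝ) ^ k) g x θ‖ₑ) k
    refine (ENNReal.rpow_le_rpow h2 (by linarith)).trans ?_
    rw [ENNReal.mul_rpow_of_nonneg _ _ (by linarith)]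
    rw [hSd]
    exact mul_le_mul' le_rfl (holder_fin σ p hp _ (hGx x))
  refine (lintegral_mono h1).trans ?_
  rw [lintegral_const_mul' _ _ (ENNReal.rpow_ne_top_of_nonneg (by linarith) (by simp)),
    lintegral_const_mul' _ _ (ENNReal.rpow_ne_top_of_nonneg (by linarith) hS)]
  rw [mul_assoc, mul_assoc]
  refine mul_le_mul' le_rfl (mul_le_mul' le_rfl ?_)
  rw [lintegral_lintegral_swap (hGm'.pow_const p).aemeasurable]
  calc _ ≤ ∫⁻ θ : sphere (0 : E) 1, C * (∫⁻ x, ‖g x‖ₑ ^ p) ∂σ := by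
        rw [hG]
        exact lintegral_mono fun θ => hC g hg θ (by simpa using θ.2)
    _ = _ := by rw [lintegral_const, hSd]; ring

end Rot


section Geo
variable {n : ℕ}

lemma toUp_apply (x' : EuclideanSpace ℝ (Fin (n - 1))) (t : ℝ) (i : Fin n) :
    toUp x' t i = if h : (i : ℕ) < n - 1 then x' ⟨i, h⟩ else t := rfl

lemma xinit_apply (x : EuclideanSpace ℝ (Fin n)) (i : Fin (n - 1)) :
    xinit x i = x (finUp i) := rfl

lemma xlast_eq (h : 0 < n) (x : EuclideanSpace ℝ (Fin n)) : xlast x = x (lastIdx n h) := by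
  simp [xlast, h, lastIdx]

lemma toUp_sub (x y : EuclideanSpace ℝ (Fin (n - 1))) (s t : ℝ) :
    toUp (x - y) (s - t) = toUp x s - toUp y t := by
  ext i; simp only [toUp_apply, PiLp.sub_apply]; split_ifs <;> simp

lemma toUp_smul (r : ℝ) (x : EuclideanSpace ℝ (Fin (n - 1))) (t : ℝ) :
    toUp (r • x) (r * t) = r • toUp x t := by
  ext i; simp only [toUp_apply, PiLp.smul_apply]; split_ifs <;> simp

lemma toUp_add (x y : EuclideanSpace ℝ (Fin (n - 1))) (s t : ℝ) :
    toUp (x + y) (s + t) = toUp x s + toUp y t := by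
  ext i; simp only [toUp_apply, PiLp.add_apply]; split_ifs <;> simp

lemma toUp_finUp (x' : EuclideanSpace ℝ (Fin (n - 1))) (t : ℝ) (i : Fin (n - 1)) :
    toUp x' t (finUp i) = x' i := by simp [toUp_apply, finUp]

lemma toUp_last (h : 0 < n) (x' : EuclideanSpace ℝ (Fin (n - 1))) (t : ℝ) :
    toUp x' t (lastIdx n h) = t := by simp [toUp_apply, lastIdx]

lemma idx_cases (h : 0 < n) (i : Fin n) : i = lastIdx n h ∨ ∃ j, i = finUp j := by
  by_cases hi : (i : ℕ) < n - 1
  · right; exact ⟨⟨i, hi⟩, rfl⟩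
  · left; ext; simp [lastIdx]; omega

lemma finUp_ne (h : 0 < n) (j : Fin (n - 1)) : finUp j ≠ lastIdx n h := by
  intro e; have := congrArg Fin.val e; simp [finUp, lastIdx] at this; omega

lemma finUp_inj : Function.Injective (finUp (n := n)) := by
  intro a b e; have := congrArg Fin.val e; simpa [finUp, Fin.ext_iff] using this

lemma xlast_toUp (h : 0 < n) (x' : EuclideanSpace ℝ (Fin (n - 1))) (t : ℝ) :
    xlast (toUp x' t) = t := by rw [xlast_eq h, toUp_last h]

lemma xinit_toUp (x' : EuclideanSpace ℝ (Fin (n - 1))) (t : ℝ) :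
    xinit (toUp x' t) = x' := by ext i; rw [xinit_apply, toUp_finUp]

lemma toUp_eta (h : 0 < n) (x : EuclideanSpace ℝ (Fin n)) : toUp (xinit x) (xlast x) = x := by
  ext i
  rcases idx_cases h i with rfl | ⟨j, rfl⟩
  · rw [toUp_last, xlast_eq h]
  · rw [toUp_finUp, xinit_apply]

lemma sum_idx {M : Type*} [AddCommMonoid M] (h : 0 < n) (F : Fin n → M) :
    ∑ i, F i = ∑ j, F (finUp j) + F (lastIdx n h) := by
  obtain ⟨m, rfl⟩ : ∃ m, n = m + 1 := ⟨n - 1, by omega⟩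
  rw [Fin.sum_univ_castSucc]
  rfl

lemma norm_toUp_sq (h : 0 < n) (x' : EuclideanSpace ℝ (Fin (n - 1))) (t : ℝ) :
    ‖toUp x' t‖ ^ 2 = ‖x'‖ ^ 2 + t ^ 2 := by
  rw [EuclideanSpace.norm_sq_eq, EuclideanSpace.norm_sq_eq, sum_idx h]
  simp [toUp_finUp, toUp_last]

lemma norm_toUp_zero (h : 0 < n) (x' : EuclideanSpace ℝ (Fin (n - 1))) :
    ‖toUp x' 0‖ = ‖x'‖ := by
  have := norm_toUp_sq h x' 0
  simp at this
  exact this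

lemma le_norm_toUp (h : 0 < n) (x' : EuclideanSpace ℝ (Fin (n - 1))) (t : ℝ) :
    ‖x'‖ ≤ ‖toUp x' t‖ :=
  abs_le_of_sq_le_sq' (by rw [norm_toUp_sq h]; nlinarith [sq_nonneg t]) (norm_nonneg _) |>.2

lemma le_norm_toUp' (h : 0 < n) (x' : EuclideanSpace ℝ (Fin (n - 1))) (t : ℝ) :
    t ≤ ‖toUp x' t‖ :=
  abs_le_of_sq_le_sq' (by rw [norm_toUp_sq h]; nlinarith [sq_nonneg ‖x'‖]) (norm_nonneg _) |>.2

lemma norm_toUp_le (h : 0 < n) (x' : EuclideanSpace ℝ (Fin (n - 1))) (t : ℝ) (ht : 0 ≤ t) :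
    ‖toUp x' t‖ ≤ ‖x'‖ + t := by
  refine abs_le_of_sq_le_sq' ?_ (by positivity) |>.2
  rw [norm_toUp_sq h]; nlinarith [norm_nonneg x', mul_nonneg (norm_nonneg x') ht]

lemma cone_cmp (h : 0 < n) {κ : ℝ} (hκ : 0 < κ) {x y z : EuclideanSpace ℝ (Fin (n - 1))} {t : ℝ}
    (ht : 0 < t) (hxy : dist x y < κ * t) :
    t + ‖x - z‖ ≤ (2 + κ) * ‖toUp (y - z) t‖ := by
  have h1 : ‖x - z‖ ≤ dist x y + ‖y - z‖ := by
    rw [dist_eq_norm]; simpa using norm_add_le (x - y) (y - z)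
  have h2 := le_norm_toUp h (y - z) t
  have h3 := le_norm_toUp' h (y - z) t
  nlinarith

lemma toUp_cont : Continuous (fun q : EuclideanSpace ℝ (Fin (n - 1)) × ℝ => toUp q.1 q.2) := by
  have : Continuous (fun q : EuclideanSpace ℝ (Fin (n - 1)) × ℝ => (fun i : Fin n =>
      if h : (i : ℕ) < n - 1 then q.1 ⟨i, h⟩ else q.2)) := by
    refine continuous_pi fun i => ?_
    split_ifs <;> fun_prop
  exact (PiLp.continuous_toLp 2 _).comp this

end Geo

section Ker
variable {n : ℕ}

/-- smooth away from the origin and homogeneous of degree `-d` -/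
structure IsKer (d : ℤ) (K : EuclideanSpace ℝ (Fin n) → ℝ) : Prop where
  smooth : ContDiffOn ℝ (⊤ : ℕ∞) K {0}ᶜ
  hom : ∀ (r : ℝ) X, 0 < r → X ≠ 0 → K (r • X) = r ^ (-d) * K X

namespace IsKer
variable {d e : ℤ} {K L : EuclideanSpace ℝ (Fin n) → ℝ}

lemma add (hK : IsKer d K) (hL : IsKer d L) : IsKer d (fun X => K X + L X) :=
  ⟨hK.smooth.add hL.smooth, fun r X hr hX => by rw [hK.hom r X hr hX, hL.hom r X hr hX]; ring⟩

lemma cmul (c : ℝ) (hK : IsKer d K) : IsKer d (fun X => c * K X) :=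
  ⟨contDiffOn_const.mul hK.smooth, fun r X hr hX => by rw [hK.hom r X hr hX]; ring⟩

lemma zero : IsKer d (fun _ : EuclideanSpace ℝ (Fin n) => (0 : ℝ)) :=
  ⟨contDiffOn_const, fun r X hr hX => by simp⟩

lemma sum {ι : Type*} (s : Finset ι) {F : ι → EuclideanSpace ℝ (Fin n) → ℝ}
    (h : ∀ i ∈ s, IsKer d (F i)) : IsKer d (fun X => ∑ i ∈ s, F i X) := by
  refine ⟨ContDiffOn.sum fun i hi => (h i hi).smooth, fun r X hr hX => ?_⟩
  rw [Finset.mul_sum]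
  exact Finset.sum_congr rfl fun i hi => (h i hi).hom r X hr hX

lemma mul (hK : IsKer d K) (hL : IsKer e L) : IsKer (d + e) (fun X => K X * L X) :=
  ⟨hK.smooth.mul hL.smooth, fun r X hr hX => by
    rw [hK.hom r X hr hX, hL.hom r X hr hX, neg_add, zpow_add₀ hr.ne']; ring⟩

lemma coord (i : Fin n) : IsKer (-1) (fun X : EuclideanSpace ℝ (Fin n) => X i) :=
  ⟨by fun_prop, fun r X hr hX => by simp⟩

lemma congr (hK : IsKer d K) (h : ∀ X, X ≠ 0 → L X = K X) : IsKer d L :=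
  ⟨hK.smooth.congr fun X hX => h X hX, fun r X hr hX => by
    rw [h X hX, h _ (smul_ne_zero hr.ne' hX), hK.hom r X hr hX]⟩

lemma diffAt (hK : IsKer d K) {X} (hX : X ≠ 0) : ContDiffAt ℝ (⊤ : ℕ∞) K X :=
  hK.smooth.contDiffAt (isOpen_compl_singleton.mem_nhds hX)

lemma pd (hK : IsKer d K) (i : Fin n) : IsKer (d + 1) (pd i K) := by
  refine ⟨?_, fun r X hr hX => ?_⟩
  · exact (hK.smooth.fderiv_of_isOpen isOpen_compl_singleton (by simp)).clm_apply contDiffOn_const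
  · have h1 : HasFDerivAt (fun Y => K (r • Y)) ((fderiv ℝ K (r • X)).comp
        (r • ContinuousLinearMap.id ℝ _)) X := by
      refine HasFDerivAt.comp X ?_ ((hasFDerivAt_id X).const_smul r)
      exact ((hK.diffAt (smul_ne_zero hr.ne' hX)).differentiableAt (by simp)).hasFDerivAt
    have h2 : HasFDerivAt (fun Y => r ^ (-d) * K Y) (r ^ (-d) • fderiv ℝ K X) X :=
      ((hK.diffAt hX).differentiableAt (by simp)).hasFDerivAt.const_mul _
    have h3 : (fun Y => K (r • Y)) =ᶠ[𝓝 X] (fun Y => r ^ (-d) * K Y) := by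
      filter_upwards [isOpen_compl_singleton.mem_nhds hX] with Y hY
      exact hK.hom r Y hr hY
    have h4 := (h2.congr_of_eventuallyEq h3).unique h1
    have h5 := congrArg (fun A => A (EuclideanSpace.single i 1)) h4
    simp only [ContinuousLinearMap.smul_apply, ContinuousLinearMap.comp_apply,
      ContinuousLinearMap.id_apply, map_smul, smul_eq_mul] at h5
    simp only [_root_.pd]
    rw [neg_add, zpow_add₀ hr.ne', zpow_neg_one]
    field_simp
    linarith

lemma bound (hK : IsKer d K) : ∃ C : ℝ, 0 < C ∧ ∀ X, X ≠ 0 → |K X| ≤ C * ‖X‖ ^ (-d) := by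
  have hc : ContinuousOn K (sphere 0 1) := hK.smooth.continuousOn.mono fun X hX => by
    simp only [mem_sphere_zero_iff_norm] at hX
    simp only [Set.mem_compl_iff, Set.mem_singleton_iff]
    rintro rfl; simp at hX
  obtain ⟨C, hC⟩ := (isCompact_sphere (0 : EuclideanSpace ℝ (Fin n)) 1).exists_bound_of_continuousOn hc
  refine ⟨|C| + 1, by positivity, fun X hX => ?_⟩
  have hX' : 0 < ‖X‖ := norm_pos_iff.2 hX
  have e : X = ‖X‖ • (‖X‖⁻¹ • X) := by rw [smul_smul, mul_inv_cancel₀ hX'.ne', one_smul]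
  conv_lhs => rw [e]
  rw [hK.hom _ _ hX' (smul_ne_zero (inv_ne_zero hX'.ne') hX), abs_mul, mul_comm,
    abs_of_pos (zpow_pos hX' _)]
  gcongr
  have := hC (‖X‖⁻¹ • X) (by simp [norm_smul, hX'.ne'])
  rw [Real.norm_eq_abs] at this
  linarith [le_abs_self C]

lemma fbound (hK : IsKer d K) : ∃ C : ℝ, 0 < C ∧ ∀ X, X ≠ 0 →
    ‖fderiv ℝ K X‖ ≤ C * ‖X‖ ^ (-(d + 1)) := by
  choose C hC0 hC using fun i => (hK.pd i).bound
  refine ⟨∑ i, C i + 1, by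
    have := Finset.sum_nonneg fun i (_ : i ∈ Finset.univ) => (hC0 i).le
    linarith, fun X hX => ?_⟩
  have hX' : 0 < ‖X‖ := norm_pos_iff.2 hX
  refine ContinuousLinearMap.opNorm_le_bound _ (by
    have := Finset.sum_nonneg fun i (_ : i ∈ Finset.univ) => (hC0 i).le
    positivity) fun v => ?_
  have hv : v = ∑ i, v i • EuclideanSpace.single i (1 : ℝ) := by
    ext j; simp [Finset.sum_apply, Pi.single_apply]
  conv_lhs => rw [hv, map_sum]
  refine (norm_sum_le _ _).trans ?_
  have : ∀ i ∈ Finset.univ, ‖fderiv ℝ K X (v i • EuclideanSpace.single i (1 : ℝ))‖ ≤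
      C i * ‖X‖ ^ (-(d + 1)) * ‖v‖ := by
    intro i _
    rw [map_smul, norm_smul, mul_comm]
    exact mul_le_mul (hC i X hX) (PiLp.norm_apply_le v i) (norm_nonneg _)
      (by have := hC0 i; positivity)
  refine (Finset.sum_le_sum this).trans ?_
  rw [← Finset.sum_mul, ← Finset.sum_mul]
  gcongr
  linarith

lemma lip {d : ℕ} (hK : IsKer d K) : ∃ C : ℝ, 0 < C ∧ ∀ X Y a, 0 < a → a ≤ ‖X‖ → a ≤ ‖Y‖ →
    |K X - K Y| ≤ C * (‖X - Y‖ / a ^ (d + 1)) := by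
  obtain ⟨C1, hC1, h1⟩ := hK.bound
  obtain ⟨C2, hC2, h2⟩ := hK.fbound
  refine ⟨4 * C1 + 2 ^ (d + 1) * C2, by positivity, fun X Y a ha hX hY => ?_⟩
  have hz : ∀ (Z : EuclideanSpace ℝ (Fin n)) (b : ℝ) (k : ℕ), 0 < b → b ≤ ‖Z‖ →
      ‖Z‖ ^ (-(k : ℤ)) ≤ (b ^ k)⁻¹ := by
    intro Z b k hb hbZ
    rw [zpow_neg, zpow_natCast]
    gcongr
  have hne : ∀ (Z : EuclideanSpace ℝ (Fin n)) (b : ℝ), 0 < b → b ≤ ‖Z‖ → Z ≠ 0 := by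
    intro Z b hb hbZ h0; rw [h0, norm_zero] at hbZ; linarith
  by_cases hc : ‖X - Y‖ ≤ a / 2
  · have hseg : ∀ Z ∈ segment ℝ X Y, a / 2 ≤ ‖Z‖ := by
      intro Z hZ
      have hd : ‖X - Z‖ ≤ ‖X - Y‖ := by
        have := (dist_add_dist_of_mem_segment hZ)
        rw [← dist_eq_norm, ← dist_eq_norm, ← this]
        linarith [dist_nonneg (x := Z) (y := Y)]
      have : ‖X‖ ≤ ‖Z‖ + ‖X - Z‖ := by simpa using norm_add_le Z (X - Z)
      linarith
    have := (convex_segment X Y).norm_image_sub_le_of_norm_hasFDerivWithin_le (𝕜 := ℝ) (f := K)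
      (f' := fderiv ℝ K) (C := C2 * ((a / 2) ^ (d + 1))⁻¹) (fun Z hZ =>
        ((hK.diffAt (hne Z (a / 2) (by positivity) (hseg Z hZ))).differentiableAt
          (by simp)).hasFDerivAt.hasFDerivWithinAt)
      (fun Z hZ => (h2 Z (hne Z (a / 2) (by positivity) (hseg Z hZ))).trans (by
        have := hz Z (a / 2) (d + 1) (by positivity) (hseg Z hZ)
        push_cast at this
        gcongr))
      (right_mem_segment ℝ X Y) (left_mem_segment ℝ X Y)
    rw [Real.norm_eq_abs] at this
    refine this.trans ?_
    rw [div_pow, inv_div]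
    have h5 : 0 ≤ ‖X - Y‖ / a ^ (d + 1) := by positivity
    have : C2 * (2 ^ (d + 1) / a ^ (d + 1)) * ‖X - Y‖ = 2 ^ (d + 1) * C2 * (‖X - Y‖ / a ^ (d + 1)) := by
      ring
    rw [this]
    gcongr
    linarith
  · push Not at hc
    have hX1 := h1 X (hne X a ha hX)
    have hY1 := h1 Y (hne Y a ha hY)
    have hX2 := hz X a d ha hX
    have hY2 := hz Y a d ha hY
    have h6 : |K X - K Y| ≤ 2 * C1 * (a ^ d)⁻¹ := by
      have := abs_sub (K X) (K Y)
      have := mul_le_mul_of_nonneg_left hX2 hC1.le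
      have := mul_le_mul_of_nonneg_left hY2 hC1.le
      linarith
    refine h6.trans ?_
    have h7 : (a ^ d)⁻¹ ≤ 2 * (‖X - Y‖ / a ^ (d + 1)) := by
      rw [pow_succ, inv_eq_one_div, ← mul_div_assoc, div_le_div_iff₀ (by positivity) (by positivity)]
      have : 0 < a ^ d := by positivity
      nlinarith
    have h5 : 0 ≤ ‖X - Y‖ / a ^ (d + 1) := by positivity
    have h8 : 2 * C1 * (a ^ d)⁻¹ ≤ 4 * C1 * (‖X - Y‖ / a ^ (d + 1)) := by nlinarith
    refine h8.trans ?_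
    gcongr
    have : 0 < 2 ^ (d + 1) * C2 := by positivity
    linarith

end IsKer
end Ker


section UOp
variable {n : ℕ}

def Uop (K : EuclideanSpace ℝ (Fin n) → ℝ) (g : EuclideanSpace ℝ (Fin (n - 1)) → ℝ)
    (x : EuclideanSpace ℝ (Fin n)) : ℝ := ∫ z, K (x - toUp z 0) * g z

def Wt (g : EuclideanSpace ℝ (Fin (n - 1)) → ℝ) : Prop :=
  Integrable (fun z => ((1 + ‖z‖) ^ (n - 1))⁻¹ * g z)

lemma Wt.aesm {g : EuclideanSpace ℝ (Fin (n - 1)) → ℝ} (h : Wt g) :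
    AEStronglyMeasurable g volume := by
  have h1 : Continuous (fun z : EuclideanSpace ℝ (Fin (n - 1)) => (1 + ‖z‖) ^ (n - 1)) := by
    fun_prop
  refine (h1.aestronglyMeasurable.mul h.aestronglyMeasurable).congr (Eventually.of_forall fun z => ?_)
  have : 0 < (1 + ‖z‖) ^ (n - 1) := by positivity
  simp only [Pi.mul_apply]
  field_simp

lemma Wt_of_memLp (hn : 2 ≤ n) {p : ℝ} (hp : 1 < p) {g : EuclideanSpace ℝ (Fin (n - 1)) → ℝ}
    (hg : MemLp g (ENNReal.ofReal p) volume) : Wt g := by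
  have hq := Real.HolderConjugate.conjExponent hp
  set q := Real.conjExponent p
  have h1 : Integrable (fun z => ‖g z‖ ^ p) := by
    have := hg.integrable_norm_rpow (by simp; linarith) (by simp)
    rwa [ENNReal.toReal_ofReal (by linarith)] at this
  have h2 : Integrable (fun z : EuclideanSpace ℝ (Fin (n - 1)) => (1 + ‖z‖) ^ (-((n - 1 : ℕ) * q))) := by
    refine integrable_one_add_norm ?_
    rw [finrank_euclideanSpace_fin]
    have : (0 : ℝ) < (n - 1 : ℕ) := by exact_mod_cast (by omega : 0 < n - 1)
    nlinarith [hq.symm.lt]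
  refine (h2.add h1).mono' ?_ (Eventually.of_forall fun z => ?_)
  · refine AEStronglyMeasurable.mul ?_ hg.1
    refine Continuous.aestronglyMeasurable ?_
    exact Continuous.inv₀ (by fun_prop) fun z => by positivity
  · have hz : 0 < 1 + ‖z‖ := by positivity
    have := Real.young_inequality_of_nonneg (a := ((1 + ‖z‖) ^ (n - 1))⁻¹) (b := ‖g z‖)
      (by positivity) (norm_nonneg _) hq.symm
    rw [norm_mul, norm_of_nonneg (by positivity : 0 ≤ ((1 + ‖z‖) ^ (n - 1))⁻¹)]
    refine this.trans (add_le_add ?_ ?_)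
    · have e : (((1 + ‖z‖) ^ (n - 1))⁻¹) ^ q = (1 + ‖z‖) ^ (-((n - 1 : ℕ) * q)) := by
        rw [← rpow_natCast, ← rpow_neg hz.le, ← rpow_mul hz.le]
        congr 1; ring
      rw [e]
      exact div_le_self (by positivity) hq.symm.lt.le
    · exact div_le_self (by positivity) hp.le

lemma up_low (h : 0 < n) {x₀ : EuclideanSpace ℝ (Fin n)} (hx : x₀ ∈ upperHalfSpace n) :
    ∃ ε > 0, ∃ c > 0, ∀ x ∈ ball x₀ ε, x ∈ upperHalfSpace n ∧
      ∀ z : EuclideanSpace ℝ (Fin (n - 1)), c * (1 + ‖z‖) ≤ ‖x - toUp z 0‖ := by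
  have ht : 0 < xlast x₀ := hx
  refine ⟨xlast x₀ / 2, by positivity, ((1 + (‖x₀‖ + xlast x₀)) * (2 / xlast x₀) + 1)⁻¹,
    by positivity, fun x hxb => ?_⟩
  have hd : ‖x - x₀‖ < xlast x₀ / 2 := by simpa [dist_eq_norm] using hxb
  have h1 : |xlast x - xlast x₀| ≤ ‖x - x₀‖ := by
    rw [xlast_eq h, xlast_eq h, ← PiLp.sub_apply]
    exact PiLp.norm_apply_le (x - x₀) _
  have h2 : xlast x₀ / 2 ≤ xlast x := by have := (abs_le.1 h1).1; linarith
  refine ⟨show 0 < xlast x by linarith, fun z => ?_⟩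
  rw [inv_mul_le_iff₀ (by positivity)]
  have e : x - toUp z 0 = toUp (xinit x - z) (xlast x) := by
    conv_lhs => rw [← toUp_eta h x]
    rw [← toUp_sub, sub_zero]
  have h3 : xlast x₀ / 2 ≤ ‖x - toUp z 0‖ := by
    rw [e]; exact h2.trans (le_norm_toUp' h _ _)
  have h4 : ‖z‖ ≤ ‖x‖ + ‖x - toUp z 0‖ := by
    rw [← norm_toUp_zero h z]
    have := norm_sub_le x (x - toUp z 0)
    rwa [sub_sub_cancel] at this
  have h5 : ‖x‖ ≤ ‖x₀‖ + xlast x₀ := by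
    have := norm_add_le (x - x₀) x₀
    rw [sub_add_cancel] at this
    linarith
  have h6 : 1 ≤ 2 / xlast x₀ * ‖x - toUp z 0‖ := by
    rw [div_mul_eq_mul_div, le_div_iff₀ ht]; linarith
  have h7 : 0 ≤ ‖x₀‖ := norm_nonneg _
  nlinarith [mul_le_mul_of_nonneg_left h6 (by positivity : 0 ≤ 1 + (‖x₀‖ + xlast x₀))]

lemma isOpen_up (h : 0 < n) : IsOpen (upperHalfSpace n) := by
  have : Continuous (fun x : EuclideanSpace ℝ (Fin n) => xlast x) := by
    simp only [xlast_eq h]; fun_prop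
  exact isOpen_lt continuous_const this

lemma up_ne {x : EuclideanSpace ℝ (Fin n)} (h : 0 < n) (hx : x ∈ upperHalfSpace n)
    (z : EuclideanSpace ℝ (Fin (n - 1))) : x - toUp z 0 ≠ 0 := by
  intro e
  have : xlast x = 0 := by
    rw [sub_eq_zero.1 e, xlast_toUp h]
  have h2 : 0 < xlast x := hx
  linarith

lemma zbd {X c s : ℝ} {m d : ℕ} (hm : m ≤ d) (hc : 0 < c) (hs : 1 ≤ s) (h : c * s ≤ X) :
    X ^ (-(d : ℤ)) ≤ (c ^ d)⁻¹ * (s ^ m)⁻¹ := by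
  rw [zpow_neg, zpow_natCast, ← mul_inv]
  gcongr
  calc c ^ d * s ^ m ≤ c ^ d * s ^ d := by gcongr
    _ = (c * s) ^ d := by rw [mul_pow]
    _ ≤ X ^ d := by gcongr

lemma toUp_cont0 : Continuous (fun z : EuclideanSpace ℝ (Fin (n - 1)) => toUp z 0) :=
  toUp_cont.comp (continuous_id.prodMk continuous_const)

lemma ker_cont (h : 0 < n) {F : Type*} [TopologicalSpace F] {K : EuclideanSpace ℝ (Fin n) → F}
    (hK : ContinuousOn K {0}ᶜ) {x} (hx : x ∈ upperHalfSpace n) :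
    Continuous (fun z : EuclideanSpace ℝ (Fin (n - 1)) => K (x - toUp z 0)) :=
  hK.comp_continuous (continuous_const.sub toUp_cont0) fun z => up_ne h hx z

lemma ker_dom (h : 0 < n) {d : ℕ} (hd : n - 1 ≤ d) {K : EuclideanSpace ℝ (Fin n) → ℝ}
    (hK : IsKer d K) {x₀ : EuclideanSpace ℝ (Fin n)} (hx : x₀ ∈ upperHalfSpace n) :
    ∃ ε > 0, ∃ C > 0, ∀ x ∈ ball x₀ ε, x ∈ upperHalfSpace n ∧
      ∀ z : EuclideanSpace ℝ (Fin (n - 1)), |K (x - toUp z 0)| ≤ C * ((1 + ‖z‖) ^ (n - 1))⁻¹ ∧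
        ‖fderiv ℝ K (x - toUp z 0)‖ ≤ C * ((1 + ‖z‖) ^ (n - 1))⁻¹ := by
  obtain ⟨ε, hε, c, hc, H⟩ := up_low h hx
  obtain ⟨C1, hC1, h1⟩ := hK.bound
  obtain ⟨C2, hC2, h2⟩ := hK.fbound
  refine ⟨ε, hε, C1 * (c ^ d)⁻¹ + C2 * (c ^ (d + 1))⁻¹, by positivity, fun x hxb => ?_⟩
  obtain ⟨hxu, hz⟩ := H x hxb
  refine ⟨hxu, fun z => ?_⟩
  have h3 := h1 _ (up_ne h hxu z)
  have h4 := h2 _ (up_ne h hxu z)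
  have h5 := zbd hd hc (by simp : 1 ≤ 1 + ‖z‖) (hz z)
  have h6 := zbd (by omega : n - 1 ≤ d + 1) hc (by simp : 1 ≤ 1 + ‖z‖) (hz z)
  push_cast at h6
  have hp1 : 0 ≤ C1 * (c ^ d)⁻¹ * ((1 + ‖z‖) ^ (n - 1))⁻¹ := by positivity
  have hp2 : 0 ≤ C2 * (c ^ (d + 1))⁻¹ * ((1 + ‖z‖) ^ (n - 1))⁻¹ := by positivity
  constructor
  · have := mul_le_mul_of_nonneg_left h5 hC1.le
    nlinarith
  · have := mul_le_mul_of_nonneg_left h6 hC2.le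
    nlinarith

lemma U_intg (h : 0 < n) {d : ℕ} (hd : n - 1 ≤ d) {K : EuclideanSpace ℝ (Fin n) → ℝ}
    (hK : IsKer d K) {g : EuclideanSpace ℝ (Fin (n - 1)) → ℝ} (hg : Wt g)
    {x : EuclideanSpace ℝ (Fin n)} (hx : x ∈ upperHalfSpace n) :
    Integrable (fun z => K (x - toUp z 0) * g z) := by
  obtain ⟨ε, hε, C, hC, H⟩ := ker_dom h hd hK hx
  have H := (H x (mem_ball_self hε)).2
  refine (hg.norm.const_mul C).mono' ((ker_cont h hK.smooth.continuousOn hx).aestronglyMeasurable.mul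
    hg.aesm) (Eventually.of_forall fun z => ?_)
  rw [norm_mul, norm_mul, Real.norm_eq_abs,
    norm_of_nonneg (by positivity : 0 ≤ ((1 + ‖z‖) ^ (n - 1))⁻¹), ← mul_assoc]
  gcongr
  exact (H z).1

lemma U_hasFDerivAt (h : 0 < n) {d : ℕ} (hd : n - 1 ≤ d) {K : EuclideanSpace ℝ (Fin n) → ℝ}
    (hK : IsKer d K) {g : EuclideanSpace ℝ (Fin (n - 1)) → ℝ} (hg : Wt g)
    {x : EuclideanSpace ℝ (Fin n)} (hx : x ∈ upperHalfSpace n) :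
    Integrable (fun z => g z • fderiv ℝ K (x - toUp z 0)) ∧
    HasFDerivAt (Uop K g) (∫ z, g z • fderiv ℝ K (x - toUp z 0)) x := by
  obtain ⟨ε, hε, C, hC, H⟩ := ker_dom h hd hK hx
  have hfc : ContinuousOn (fderiv ℝ K) {0}ᶜ :=
    (hK.smooth.fderiv_of_isOpen (m := 0) isOpen_compl_singleton (by simp)).continuousOn
  have hm : ∀ y ∈ ball x ε, AEStronglyMeasurable (fun z => g z • fderiv ℝ K (y - toUp z 0)) volume :=
    fun y hy => hg.aesm.smul (ker_cont h hfc (H y hy).1).aestronglyMeasurable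
  have hb : ∀ z, ∀ y ∈ ball x ε, ‖g z • fderiv ℝ K (y - toUp z 0)‖ ≤
      C * ‖((1 + ‖z‖) ^ (n - 1))⁻¹ * g z‖ := by
    intro z y hy
    rw [norm_smul, norm_mul, norm_of_nonneg (by positivity : 0 ≤ ((1 + ‖z‖) ^ (n - 1))⁻¹), ← mul_assoc,
      mul_comm]
    gcongr
    exact ((H y hy).2 z).2
  refine ⟨(hg.norm.const_mul C).mono' (hm x (mem_ball_self hε))
    (Eventually.of_forall fun z => hb z x (mem_ball_self hε)), ?_⟩
  refine hasFDerivAt_integral_of_dominated_of_fderiv_le (F := fun y z => K (y - toUp z 0) * g z)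
    (F' := fun y z => g z • fderiv ℝ K (y - toUp z 0))
    (bound := fun z => C * ‖((1 + ‖z‖) ^ (n - 1))⁻¹ * g z‖) (ball_mem_nhds x hε) ?_
    (U_intg h hd hK hg hx) (hm x (mem_ball_self hε)) (Eventually.of_forall hb) (hg.norm.const_mul C) ?_
  · filter_upwards [ball_mem_nhds x hε] with y hy
    exact (U_intg h hd hK hg (H y hy).1).aestronglyMeasurable
  · refine Eventually.of_forall fun z y hy => ?_
    have h1 := ((hK.diffAt (up_ne h (H y hy).1 z)).differentiableAt (by simp)).hasFDerivAt
    exact (h1.comp y ((hasFDerivAt_id y).sub_const _)).mul_const (g z)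

lemma U_pd (h : 0 < n) {d : ℕ} (hd : n - 1 ≤ d) {K : EuclideanSpace ℝ (Fin n) → ℝ}
    (hK : IsKer d K) {g : EuclideanSpace ℝ (Fin (n - 1)) → ℝ} (hg : Wt g)
    {x : EuclideanSpace ℝ (Fin n)} (hx : x ∈ upperHalfSpace n) (i : Fin n) :
    pd i (Uop K g) x = Uop (pd i K) g x := by
  obtain ⟨h1, h2⟩ := U_hasFDerivAt h hd hK hg hx
  rw [pd, h2.fderiv, ContinuousLinearMap.integral_apply h1, Uop]
  congr 1; ext z
  simp [pd, mul_comm]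

lemma U_contDiffOn (h : 0 < n) {g : EuclideanSpace ℝ (Fin (n - 1)) → ℝ} (hg : Wt g) (k : ℕ) :
    ∀ {d : ℕ} (_ : n - 1 ≤ d) {K : EuclideanSpace ℝ (Fin n) → ℝ} (_ : IsKer d K),
    ContDiffOn ℝ k (Uop K g) (upperHalfSpace n) := by
  induction k with
  | zero =>
    intro d hd K hK
    refine contDiffOn_zero.2 fun x hx => ?_
    exact (U_hasFDerivAt h hd hK hg hx).2.continuousAt.continuousWithinAt
  | succ k ih =>
    intro d hd K hK
    push_cast
    rw [contDiffOn_succ_iff_fderiv_of_isOpen (isOpen_up h)]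
    refine ⟨fun x hx => (U_hasFDerivAt h hd hK hg hx).2.differentiableAt.differentiableWithinAt,
      by simp, ?_⟩
    have h1 : ContDiffOn ℝ k (fun x => ∑ i, Uop (pd i K) g x •
        (EuclideanSpace.proj i : EuclideanSpace ℝ (Fin n) →L[ℝ] ℝ)) (upperHalfSpace n) := by
      refine ContDiffOn.sum fun i _ => ContDiffOn.smul (ih (d := d + 1) (by omega) ?_) contDiffOn_const
      exact_mod_cast hK.pd i
    refine h1.congr fun x hx => ?_
    ext v
    have hv : v = ∑ i, v i • EuclideanSpace.single i (1 : ℝ) := by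
      ext j; simp [Finset.sum_apply, Pi.single_apply]
    conv_lhs => rw [hv, map_sum]
    simp only [ContinuousLinearMap.sum_apply, ContinuousLinearMap.smul_apply, map_smul, smul_eq_mul]
    refine Finset.sum_congr rfl fun i _ => ?_
    rw [← U_pd h hd hK hg hx, pd, mul_comm]
    simp

end UOp


section GoodS
variable {n : ℕ}

lemma ntMax_meas {F : Type*} [NormedAddCommGroup F] (κ : ℝ) (u : EuclideanSpace ℝ (Fin n) → F) :
    Measurable (ntMax κ u) := by
  refine measurable_of_Ioi fun a => IsOpen.measurableSet ?_
  have : ntMax κ u ⁻¹' Set.Ioi a = ⋃ (y : EuclideanSpace ℝ (Fin (n - 1))) (t : ℝ)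
      (_ : 0 < t ∧ a < (‖u (toUp y t)‖₊ : ℝ≥0∞)), ball y (κ * t) := by
    ext x
    simp only [ntMax, Set.mem_preimage, Set.mem_Ioi, lt_iSup_iff, Set.mem_iUnion, mem_ball]
    constructor
    · rintro ⟨y, t, ⟨h1, h2⟩, h3⟩; exact ⟨y, t, ⟨h1, h3⟩, h2⟩
    · rintro ⟨y, t, ⟨h1, h2⟩, h3⟩; exact ⟨y, t, ⟨h1, h3⟩, h2⟩
  rw [this]
  exact isOpen_iUnion fun y => isOpen_iUnion fun t => isOpen_iUnion fun _ => isOpen_ball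

lemma ntMax_le {F : Type*} [NormedAddCommGroup F] {κ : ℝ} {u : EuclideanSpace ℝ (Fin n) → F}
    {x : EuclideanSpace ℝ (Fin (n - 1))} {A : ℝ≥0∞}
    (h : ∀ y t, 0 < t → dist x y < κ * t → ‖u (toUp y t)‖ₑ ≤ A) : ntMax κ u x ≤ A :=
  iSup_le fun y => iSup_le fun t => iSup_le fun ht => h y t ht.1 ht.2

lemma le_ntMax {F : Type*} [NormedAddCommGroup F] {κ : ℝ} {u : EuclideanSpace ℝ (Fin n) → F}
    {x : EuclideanSpace ℝ (Fin (n - 1))} {y t} (ht : 0 < t) (h : dist x y < κ * t) :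
    ‖u (toUp y t)‖ₑ ≤ ntMax κ u x :=
  le_iSup_of_le y (le_iSup_of_le t (le_iSup_of_le ⟨ht, h⟩ le_rfl))

lemma toUp_mem (h : 0 < n) (y : EuclideanSpace ℝ (Fin (n - 1))) {t : ℝ} (ht : 0 < t) :
    toUp y t ∈ upperHalfSpace n := by
  show 0 < xlast _
  rwa [xlast_toUp h]

lemma toUp_sub0 (y z : EuclideanSpace ℝ (Fin (n - 1))) (t : ℝ) :
    toUp y t - toUp z 0 = toUp (y - z) t := by rw [← toUp_sub, sub_zero]

def Good (p κ : ℝ) (B : EuclideanSpace ℝ (Fin n) → ℝ) : Prop :=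
  ∃ C : ℝ≥0, ∀ g : EuclideanSpace ℝ (Fin (n - 1)) → ℝ, MemLp g (ENNReal.ofReal p) volume →
    ∫⁻ x, (ntMax κ (Uop B g) x) ^ p ≤ C * ∫⁻ z, ‖g z‖ₑ ^ p

lemma good_of_meas {p κ : ℝ} {B : EuclideanSpace ℝ (Fin n) → ℝ} (C : ℝ≥0)
    (H : ∀ g : EuclideanSpace ℝ (Fin (n - 1)) → ℝ, Measurable g →
      MemLp g (ENNReal.ofReal p) volume →
      ∫⁻ x, (ntMax κ (Uop B g) x) ^ p ≤ C * ∫⁻ z, ‖g z‖ₑ ^ p) : Good p κ B := by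
  refine ⟨C, fun g hg => ?_⟩
  obtain ⟨g', hg', he⟩ := hg.1.aemeasurable
  have e1 : Uop B g = Uop B g' := by
    ext x
    refine integral_congr_ae ?_
    filter_upwards [he] with z hz
    rw [hz]
  rw [e1]
  refine (H g' hg' ((memLp_congr_ae he).1 hg)).trans (le_of_eq ?_)
  congr 1
  refine lintegral_congr_ae ?_
  filter_upwards [he] with z hz
  rw [hz]

lemma good_mx (hn : 2 ≤ n) {p : ℝ} (hp : 1 < p) :
    ∃ C : ℝ≥0, ∀ g : EuclideanSpace ℝ (Fin (n - 1)) → ℝ, Measurable g →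
    ∫⁻ x, (mx (fun z => ‖g z‖ₑ) x) ^ p ≤ C * ∫⁻ z, ‖g z‖ₑ ^ p := by
  obtain ⟨C, hC⟩ := mx_strong (E := EuclideanSpace ℝ (Fin (n - 1)))
    (by rw [finrank_euclideanSpace_fin]; omega) p hp
  exact ⟨C, fun g hg => hC _ hg.enorm⟩

lemma pk_int_le (D : ℝ) : ∃ C : ℝ≥0, ∀ g : EuclideanSpace ℝ (Fin (n - 1)) → ℝ,
    Measurable g → ∀ (k : EuclideanSpace ℝ (Fin (n - 1)) → ℝ) x t, 0 < t →
    (∀ z, |k z| ≤ D * pk (n - 1) t ‖x - z‖) →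
    ‖∫ z, k z * g z‖ₑ ≤ C * mx (fun z => ‖g z‖ₑ) x := by
  obtain ⟨C, hC⟩ := pk_mx (E := EuclideanSpace ℝ (Fin (n - 1)))
  rw [finrank_euclideanSpace_fin] at hC
  refine ⟨Real.toNNReal D * C, fun g hg k x t ht hk => ?_⟩
  refine (enorm_int_le k g _ hk).trans ?_
  have : ∀ z, ENNReal.ofReal (D * pk (n - 1) t ‖x - z‖) * ‖g z‖ₑ =
      (Real.toNNReal D : ℝ≥0∞) * (ENNReal.ofReal (pk (n - 1) t ‖x - z‖) * ‖g z‖ₑ) := by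
    intro z
    rw [ENNReal.ofReal_mul' (pk_nonneg _ ht (norm_nonneg _)), mul_assoc]
    rfl
  simp only [this]
  rw [lintegral_const_mul' _ _ (by simp)]
  push_cast
  rw [mul_assoc]
  gcongr
  exact hC _ hg.enorm x t ht

lemma good_type1 (hn : 2 ≤ n) {p κ : ℝ} (hp : 1 < p) (hκ : 0 < κ)
    {B h : EuclideanSpace ℝ (Fin n) → ℝ} (hh : IsKer n h)
    (hB : ∀ X, B X = xlast X * h X) : Good p κ B := by
  have h0 : 0 < n := by omega
  obtain ⟨A, hA0, hA⟩ := hh.bound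
  obtain ⟨C1, hC1⟩ := pk_int_le (n := n) (A * (2 + κ) ^ n)
  obtain ⟨C2, hC2⟩ := good_mx hn hp
  have hpk : ∀ (x y z : EuclideanSpace ℝ (Fin (n - 1))) t, 0 < t → dist x y < κ * t →
      |B (toUp (y - z) t)| ≤ A * (2 + κ) ^ n * pk (n - 1) t ‖x - z‖ := by
    intro x y z t ht hxy
    have h1 := cone_cmp h0 hκ (z := z) ht hxy
    have h2 : 0 < t + ‖x - z‖ := by positivity
    have h3 : 0 < ‖toUp (y - z) t‖ := lt_of_lt_of_le ht (le_norm_toUp' h0 _ _)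
    have h4 := hA _ (norm_pos_iff.1 h3)
    rw [hB, xlast_toUp h0, abs_mul, abs_of_pos ht, pk, Nat.sub_add_cancel (by omega)]
    have h5 : ‖toUp (y - z) t‖ ^ (-(n : ℤ)) ≤ (2 + κ) ^ n * ((t + ‖x - z‖) ^ n)⁻¹ := by
      rw [zpow_neg, zpow_natCast, ← div_eq_mul_inv, inv_eq_one_div,
        div_le_div_iff₀ (by positivity) (by positivity), one_mul, ← mul_pow]
      gcongr
    calc t * |h (toUp (y - z) t)| ≤ t * (A * ((2 + κ) ^ n * ((t + ‖x - z‖) ^ n)⁻¹)) := by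
          gcongr
          exact h4.trans (by gcongr)
      _ = _ := by ring
  refine good_of_meas (C1 ^ p * C2) fun g hg hgp => ?_
  have h6 : ∀ x, (ntMax κ (Uop B g) x) ^ p ≤ ((C1 ^ p : ℝ≥0) : ℝ≥0∞) * (mx (fun z => ‖g z‖ₑ) x) ^ p := by
    intro x
    rw [ENNReal.coe_rpow_of_nonneg _ (by linarith), ← ENNReal.mul_rpow_of_nonneg _ _ (by linarith)]
    refine ENNReal.rpow_le_rpow (ntMax_le fun y t ht hxy => ?_) (by linarith)
    simp only [Uop, toUp_sub0]
    exact hC1 g hg _ x t ht fun z => hpk x y z t ht hxy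
  refine (lintegral_mono h6).trans ?_
  rw [lintegral_const_mul' _ _ (by simp)]
  push_cast
  rw [mul_assoc]
  gcongr
  exact hC2 g hg

lemma pk_big (m : ℕ) {t r c : ℝ} (ht : 0 < t) (hr0 : 0 ≤ r) (hr : r ≤ c * t) :
    ((t + r) ^ m)⁻¹ ≤ (1 + c) * pk m t r := by
  rw [pk, pow_succ, inv_eq_one_div, ← mul_div_assoc, div_le_div_iff₀ (by positivity) (by positivity)]
  have : 0 < (t + r) ^ m := by positivity
  nlinarith

lemma type2_diff (hn : 2 ≤ n) {κ : ℝ} (hκ : 0 < κ)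
    {B : EuclideanSpace ℝ (Fin n) → ℝ} (hB : IsKer ((n - 1 : ℕ) : ℤ) B) :
    ∃ D : ℝ, ∀ (x y z : EuclideanSpace ℝ (Fin (n - 1))) t t', 0 < t → t ≤ t' → t' ≤ 2 * t →
      dist x y < κ * t →
      |B (toUp (y - z) t) - (if t' < ‖x - z‖ then B (toUp (x - z) 0) else 0)| ≤
        D * pk (n - 1) t ‖x - z‖ := by
  have h0 : 0 < n := by omega
  obtain ⟨A, hA0, hA⟩ := hB.bound
  obtain ⟨L, hL0, hL⟩ := hB.lip
  refine ⟨A * (2 + κ) ^ (n - 1) * 3 + L * (1 + κ) * (2 + κ) ^ (n - 1 + 1),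
    fun x y z t t' ht htt' htt2 hxy => ?_⟩
  have h1 := cone_cmp h0 hκ (z := z) ht hxy
  have h2 : 0 < t + ‖x - z‖ := by positivity
  have h3 : 0 < ‖toUp (y - z) t‖ := lt_of_lt_of_le ht (le_norm_toUp' h0 _ _)
  have hpk := pk_nonneg (n - 1) ht (norm_nonneg (x - z))
  split_ifs with hc
  · have hlip := hL (toUp (y - z) t) (toUp (x - z) 0) ((t + ‖x - z‖) / (2 + κ)) (by positivity)
      (by rw [div_le_iff₀ (by positivity)]; linarith)
      (by rw [norm_toUp_zero h0, div_le_iff₀ (by positivity)]; nlinarith [norm_nonneg (x - z)])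
    have h4 : ‖toUp (y - z) t - toUp (x - z) 0‖ ≤ (1 + κ) * t := by
      rw [← toUp_sub, sub_zero]
      refine (norm_toUp_le h0 _ _ ht.le).trans ?_
      rw [sub_sub_sub_cancel_right, ← dist_eq_norm, dist_comm]
      linarith
    refine hlip.trans ?_
    calc L * (‖toUp (y - z) t - toUp (x - z) 0‖ / ((t + ‖x - z‖) / (2 + κ)) ^ (n - 1 + 1))
        ≤ L * ((1 + κ) * t / ((t + ‖x - z‖) / (2 + κ)) ^ (n - 1 + 1)) := by gcongr
      _ = L * (1 + κ) * (2 + κ) ^ (n - 1 + 1) * pk (n - 1) t ‖x - z‖ := by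
          rw [pk, div_pow]; field_simp
      _ ≤ _ := by
          gcongr
          have : 0 < A * (2 + κ) ^ (n - 1) * 3 := by positivity
          linarith
  · rw [sub_zero]
    have h4 := hA _ (norm_pos_iff.1 h3)
    have h5 : ‖toUp (y - z) t‖ ^ (-((n - 1 : ℕ) : ℤ)) ≤
        (2 + κ) ^ (n - 1) * ((t + ‖x - z‖) ^ (n - 1))⁻¹ := by
      rw [zpow_neg, zpow_natCast, ← div_eq_mul_inv, inv_eq_one_div,
        div_le_div_iff₀ (by positivity) (by positivity), one_mul, ← mul_pow]
      gcongr
    have h6 := pk_big (n - 1) (c := 2) ht (norm_nonneg (x - z)) (by linarith)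
    calc |B (toUp (y - z) t)| ≤ A * ((2 + κ) ^ (n - 1) * ((1 + 2) * pk (n - 1) t ‖x - z‖)) :=
          h4.trans (by gcongr; exact h5.trans (by gcongr))
      _ = A * (2 + κ) ^ (n - 1) * 3 * pk (n - 1) t ‖x - z‖ := by ring
      _ ≤ _ := by
          gcongr
          have : 0 < L * (1 + κ) * (2 + κ) ^ (n - 1 + 1) := by positivity
          linarith

lemma oddKer_of (hn : 2 ≤ n) {B : EuclideanSpace ℝ (Fin n) → ℝ} (hB : IsKer ((n - 1 : ℕ) : ℤ) B)
    (hodd : ∀ x', B (toUp (-x') 0) = - B (toUp x' 0)) :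
    OddKer (fun x' : EuclideanSpace ℝ (Fin (n - 1)) => B (toUp x' 0)) := by
  have h0 : 0 < n := by omega
  have hne : ∀ y : EuclideanSpace ℝ (Fin (n - 1)), y ≠ 0 → toUp y 0 ≠ 0 := by
    intro y hy
    rw [← norm_ne_zero_iff, norm_toUp_zero h0]; simpa using hy
  refine ⟨?_, hodd, ?_, ?_⟩
  · refine measurable_of_continuousOn_compl_singleton 0 ?_
    exact hB.smooth.continuousOn.comp toUp_cont0.continuousOn fun y hy => hne y hy
  · intro r y hr hy
    have := hB.hom r (toUp y 0) hr (hne y hy)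
    rw [← toUp_smul, mul_zero] at this
    simp only [this, finrank_euclideanSpace_fin, zpow_neg, zpow_natCast]
  · obtain ⟨A, hA0, hA⟩ := hB.bound
    refine ⟨Real.toNNReal A, fun y hy => ?_⟩
    have h1 := hA (toUp y 0) (hne y (by rintro rfl; simp at hy))
    rw [norm_toUp_zero h0, hy, one_zpow, mul_one] at h1
    rw [Real.enorm_eq_ofReal_abs]
    exact ENNReal.ofReal_le_ofReal h1

lemma exists_dyadic {t : ℝ} (ht : 0 < t) : ∃ k : ℤ, t ≤ (2 : ℝ) ^ k ∧ (2 : ℝ) ^ k ≤ 2 * t := by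
  obtain ⟨k, h1, h2⟩ := exists_mem_Ioc_zpow ht (by norm_num : (1 : ℝ) < 2)
  refine ⟨k + 1, h2, ?_⟩
  rw [zpow_add_one₀ (by norm_num)]
  linarith

lemma trunc_lim {p κ : ℝ} (hp : 1 < p) (hn : 2 ≤ n) {B : EuclideanSpace ℝ (Fin n) → ℝ}
    (hB : IsKer ((n - 1 : ℕ) : ℤ) B) (C : ℝ≥0)
    (H : ∀ g : EuclideanSpace ℝ (Fin (n - 1)) → ℝ, Bcs g →
      ∫⁻ x, (ntMax κ (Uop B g) x) ^ p ≤ C * ∫⁻ z, ‖g z‖ₑ ^ p) : Good p κ B := by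
  have h0 : 0 < n := by omega
  refine good_of_meas C fun g hg hgp => ?_
  have hW := Wt_of_memLp hn hp hgp
  set gN : ℕ → EuclideanSpace ℝ (Fin (n - 1)) → ℝ := fun N z =>
    if ‖z‖ ≤ N + 1 ∧ |g z| ≤ N then g z else 0 with hgN
  have hbc : ∀ N, Bcs (gN N) := by
    intro N
    refine ⟨?_, ⟨N, by positivity, fun z => ?_⟩, ⟨N + 1, by positivity, fun z hz => ?_⟩⟩
    · refine Measurable.ite ?_ hg measurable_const
      exact (measurableSet_le measurable_norm measurable_const).inter
        (measurableSet_le (hg.norm : Measurable fun z => ‖g z‖) measurable_const)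
    · simp only [hgN]; split_ifs with hc
      · exact hc.2
      · simp
    · simp only [hgN]; rw [if_neg]; rintro ⟨h1, _⟩; linarith
  have hle : ∀ N z, ‖gN N z‖ ≤ ‖g z‖ := by
    intro N z; simp only [hgN]; split_ifs <;> simp
  have hlim : ∀ z, Tendsto (fun N => gN N z) atTop (𝓝 (g z)) := by
    intro z
    refine tendsto_const_nhds.congr' ?_
    filter_upwards [eventually_ge_atTop ⌈max ‖z‖ |g z|⌉₊] with N hN
    have h1 : max ‖z‖ |g z| ≤ N := (Nat.le_ceil _).trans (by exact_mod_cast hN)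
    simp only [hgN]
    rw [if_pos ⟨by linarith [le_max_left ‖z‖ |g z|], (le_max_right _ _).trans h1⟩]
  have hU : ∀ x ∈ upperHalfSpace n, Tendsto (fun N => Uop B (gN N) x) atTop (𝓝 (Uop B g x)) := by
    intro x hx
    have hi := U_intg h0 le_rfl hB hW hx
    refine tendsto_integral_of_dominated_convergence (fun z => ‖B (x - toUp z 0) * g z‖) ?_
      hi.norm ?_ ?_
    · intro N
      exact (ker_cont h0 hB.smooth.continuousOn hx).aestronglyMeasurable.mul
        (hbc N).meas.aestronglyMeasurable
    · intro N; refine Eventually.of_forall fun z => ?_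
      rw [norm_mul, norm_mul]
      gcongr
      exact hle N z
    · exact Eventually.of_forall fun z => (hlim z).const_mul _
  have h1 : ∀ x, (ntMax κ (Uop B g) x) ^ p ≤ liminf (fun N => (ntMax κ (Uop B (gN N)) x) ^ p) atTop := by
    intro x
    have e : liminf (fun N => (ntMax κ (Uop B (gN N)) x) ^ p) atTop =
        (liminf (fun N => (ntMax κ (Uop B (gN N)) x)) atTop) ^ p := by
      have := (ENNReal.orderIsoRpow p (by linarith)).liminf_apply
        (u := fun N => ntMax κ (Uop B (gN N)) x) (f := atTop) (by isBoundedDefault)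
        (by isBoundedDefault) (by isBoundedDefault) (by isBoundedDefault)
      simpa using this.symm
    rw [e]
    refine ENNReal.rpow_le_rpow (ntMax_le fun y t ht hxy => ?_) (by linarith)
    have h2 := ((hU _ (toUp_mem h0 y ht)).enorm).liminf_eq
    rw [← h2]
    exact liminf_le_liminf (Eventually.of_forall fun N => le_ntMax ht hxy)
  calc _ ≤ ∫⁻ x, liminf (fun N => (ntMax κ (Uop B (gN N)) x) ^ p) atTop := lintegral_mono h1
    _ ≤ liminf (fun N => ∫⁻ x, (ntMax κ (Uop B (gN N)) x) ^ p) atTop :=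
        lintegral_liminf_le fun N => (ntMax_meas κ _).pow_const p
    _ ≤ liminf (fun _ : ℕ => C * ∫⁻ z, ‖g z‖ₑ ^ p) atTop := by
        refine liminf_le_liminf (Eventually.of_forall fun N => ?_)
        refine (H _ (hbc N)).trans ?_
        gcongr with z
        have := hle N z
        exact enorm_le_iff_norm_le.2 this
    _ = _ := by simp

lemma good_type2 (hn : 2 ≤ n) {p κ : ℝ} (hp : 1 < p) (hκ : 0 < κ)
    {B : EuclideanSpace ℝ (Fin n) → ℝ} (hB : IsKer ((n - 1 : ℕ) : ℤ) B)
    (hodd : ∀ x', B (toUp (-x') 0) = - B (toUp x' 0)) : Good p κ B := by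
  have h0 : 0 < n := by omega
  have hO := oddKer_of hn hB hodd
  obtain ⟨D, hD⟩ := type2_diff hn hκ hB
  obtain ⟨C1, hC1⟩ := pk_int_le (n := n) D
  obtain ⟨C2, hC2⟩ := good_mx hn hp
  obtain ⟨C3, hC3⟩ := Tt_max hO (by rw [finrank_euclideanSpace_fin]; omega) p hp
  obtain ⟨M, hM⟩ := hO.bdd
  refine trunc_lim hp hn hB (2 ^ (p - 1) * (C3 + C1 ^ p * C2)) fun g hg => ?_
  have h6 : ∀ x, (ntMax κ (Uop B g) x) ^ p ≤ (2 : ℝ≥0∞) ^ (p - 1) *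
      ((⨆ k : ℤ, ‖Tt (fun x' => B (toUp x' 0)) ((2 : ℝ) ^ k) g x‖ₑ) ^ p +
      ((C1 ^ p : ℝ≥0) : ℝ≥0∞) * (mx (fun z => ‖g z‖ₑ) x) ^ p) := by
    intro x
    rw [ENNReal.coe_rpow_of_nonneg _ (by linarith), ← ENNReal.mul_rpow_of_nonneg _ _ (by linarith)]
    refine rpow_le_of_le hp _ _ _ (ntMax_le fun y t ht hxy => ?_)
    obtain ⟨k, hk1, hk2⟩ := exists_dyadic ht
    have e1 : Tt (fun x' => B (toUp x' 0)) ((2 : ℝ) ^ k) g x = ∫ z,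
        (if (2 : ℝ) ^ k < ‖x - z‖ then B (toUp (x - z) 0) else 0) * g z := by
      rw [Tt, ← integral_sub_left_eq_self _ volume x]
      simp only [sub_sub_cancel]
    have hi1 : Integrable (fun z => (if (2 : ℝ) ^ k < ‖x - z‖ then B (toUp (x - z) 0) else 0) * g z) := by
      refine Integrable.bdd_mul (c := (((2 : ℝ) ^ k) ^ (Module.finrank ℝ
        (EuclideanSpace ℝ (Fin (n - 1)))))⁻¹ * M) hg.integrable ?_
        (Eventually.of_forall fun z => hO.bd hM _ (by positivity) (x - z))
      refine Measurable.aestronglyMeasurable ?_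
      exact Measurable.ite (measurableSet_lt measurable_const (by fun_prop))
        (hO.meas.comp (by fun_prop)) measurable_const
    have hi2 : Integrable (fun z => B (toUp (y - z) t) * g z) := by
      obtain ⟨ε, hε, c, hc, Hc⟩ := ker_dom h0 le_rfl hB (toUp_mem h0 y ht)
      have Hc := Hc _ (mem_ball_self hε)
      have := hg.integrable.bdd_mul (c := c) (ker_cont h0 hB.smooth.continuousOn
        (toUp_mem h0 y ht)).aestronglyMeasurable (Eventually.of_forall fun z => by
          refine (Hc.2 z).1.trans (mul_le_of_le_one_right hc.le (inv_le_one_of_one_le₀ ?_))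
          exact one_le_pow₀ (by simp))
      simpa only [toUp_sub0] using this
    have e2 : Uop B g (toUp y t) = Tt (fun x' => B (toUp x' 0)) ((2 : ℝ) ^ k) g x +
        ∫ z, (B (toUp (y - z) t) - (if (2 : ℝ) ^ k < ‖x - z‖ then B (toUp (x - z) 0) else 0)) * g z := by
      simp only [Uop, toUp_sub0, e1, sub_mul]
      rw [integral_sub hi2 hi1]
      ring
    rw [e2]
    refine (enorm_add_le _ _).trans (add_le_add ?_ ?_)
    · exact le_iSup (fun k : ℤ => ‖Tt (fun x' => B (toUp x' 0)) ((2 : ℝ) ^ k) g x‖ₑ) k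
    · exact hC1 g hg.meas _ x t ht fun z => hD x y z t _ ht hk1 hk2 hxy
  refine (lintegral_mono h6).trans ?_
  rw [lintegral_const_mul' _ _ (ENNReal.rpow_ne_top_of_nonneg (by linarith) (by simp))]
  rw [two_rpow_ne]
  push_cast
  rw [mul_assoc]
  gcongr
  rw [lintegral_add_left' ?_]
  · rw [lintegral_const_mul' _ _ (by simp), add_mul, mul_assoc]
    gcongr
    · exact hC3 g hg
    · exact hC2 g hg.meas
  · refine (Measurable.pow_const (Measurable.iSup fun k => Measurable.enorm ?_) p).aemeasurable
    refine (StronglyMeasurable.integral_prod_right' (f := fun q : EuclideanSpace ℝ (Fin (n - 1)) ×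
      EuclideanSpace ℝ (Fin (n - 1)) => (if (2 : ℝ) ^ k < ‖q.2‖ then B (toUp q.2 0) else 0) *
        g (q.1 - q.2)) (Measurable.stronglyMeasurable ?_)).measurable
    refine Measurable.mul (Measurable.ite (measurableSet_lt measurable_const (by fun_prop))
        (hO.meas.comp measurable_snd) measurable_const) (hg.meas.comp (by fun_prop))

end GoodS


section Ipd
variable {n : ℕ}

def ipd : List (Fin n) → (EuclideanSpace ℝ (Fin n) → ℝ) → (EuclideanSpace ℝ (Fin n) → ℝ)
  | [], f => f
  | i :: l, f => pd i (ipd l f)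

lemma ipd_append (l₁ l₂ : List (Fin n)) (f : EuclideanSpace ℝ (Fin n) → ℝ) :
    ipd (l₁ ++ l₂) f = ipd l₁ (ipd l₂ f) := by
  induction l₁ with
  | nil => rfl
  | cons i l ih => simp only [List.cons_append, ipd, ih]

lemma pd_congr {f g : EuclideanSpace ℝ (Fin n) → ℝ} {x} (h : f =ᶠ[𝓝 x] g) (i : Fin n) :
    pd i f x = pd i g x := by rw [pd, pd, h.fderiv_eq]

lemma pd_eqOn {S : Set (EuclideanSpace ℝ (Fin n))} (hS : IsOpen S)
    {f g : EuclideanSpace ℝ (Fin n) → ℝ} (h : ∀ x ∈ S, f x = g x) (i : Fin n) :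
    ∀ x ∈ S, pd i f x = pd i g x := fun x hx =>
  pd_congr (by filter_upwards [hS.mem_nhds hx] with y hy using h y hy) i

lemma ipd_eqOn {S : Set (EuclideanSpace ℝ (Fin n))} (hS : IsOpen S)
    {f g : EuclideanSpace ℝ (Fin n) → ℝ} (h : ∀ x ∈ S, f x = g x) (l : List (Fin n)) :
    ∀ x ∈ S, ipd l f x = ipd l g x := by
  induction l with
  | nil => exact h
  | cons i l ih => exact pd_eqOn hS ih i

lemma pd_smooth {S : Set (EuclideanSpace ℝ (Fin n))} (hS : IsOpen S)
    {f : EuclideanSpace ℝ (Fin n) → ℝ} (h : ContDiffOn ℝ (⊤ : ℕ∞) f S) (i : Fin n) :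
    ContDiffOn ℝ (⊤ : ℕ∞) (pd i f) S :=
  (h.fderiv_of_isOpen hS (by simp)).clm_apply contDiffOn_const

lemma ipd_smooth {S : Set (EuclideanSpace ℝ (Fin n))} (hS : IsOpen S)
    {f : EuclideanSpace ℝ (Fin n) → ℝ} (h : ContDiffOn ℝ (⊤ : ℕ∞) f S) (l : List (Fin n)) :
    ContDiffOn ℝ (⊤ : ℕ∞) (ipd l f) S := by
  induction l with
  | nil => exact h
  | cons i l ih => exact pd_smooth hS ih i

lemma mpd_ipd {S : Set (EuclideanSpace ℝ (Fin n))} (hS : IsOpen S)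
    {f : EuclideanSpace ℝ (Fin n) → ℝ} (h : ContDiffOn ℝ (⊤ : ℕ∞) f S) (k : ℕ)
    (d : Fin k → Fin n) : ∀ x ∈ S, mpd k d f x = ipd (List.ofFn d) f x := by
  induction k with
  | zero => intro x hx; simp [mpd, ipd]
  | succ k ih =>
    intro x hx
    rw [List.ofFn_succ, ipd, ← pd_eqOn hS (ih (fun i => d i.succ)) (d 0) x hx]
    rw [mpd, iteratedFDeriv_succ_apply_left, pd]
    have h1 : DifferentiableAt ℝ (iteratedFDeriv ℝ k f) x :=
      (h.contDiffAt (hS.mem_nhds hx)).differentiableAt_iteratedFDeriv (by exact_mod_cast ENat.coe_lt_top k)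
    have h2 := ((ContinuousMultilinearMap.apply ℝ (fun _ : Fin k => EuclideanSpace ℝ (Fin n)) ℝ
      (fun i => EuclideanSpace.single (d i.succ) (1 : ℝ))).hasFDerivAt).comp x h1.hasFDerivAt
    have h3 := h2.fderiv
    have e : mpd k (fun i => d i.succ) f = (ContinuousMultilinearMap.apply ℝ
      (fun _ : Fin k => EuclideanSpace ℝ (Fin n)) ℝ
      (fun i => EuclideanSpace.single (d i.succ) (1 : ℝ))) ∘ iteratedFDeriv ℝ k f := rfl
    rw [e, h3]
    rfl

lemma pd_comm {S : Set (EuclideanSpace ℝ (Fin n))} (hS : IsOpen S)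
    {f : EuclideanSpace ℝ (Fin n) → ℝ} (h : ContDiffOn ℝ (⊤ : ℕ∞) f S) (i j : Fin n) :
    ∀ x ∈ S, pd i (pd j f) x = pd j (pd i f) x := by
  intro x hx
  have hc := h.contDiffAt (hS.mem_nhds hx)
  have hs := hc.isSymmSndFDerivAt (by
    rw [minSmoothness_of_isRCLikeNormedField]; exact WithTop.coe_le_coe.2 (le_top : (2 : ℕ∞) ≤ ⊤))
  have h1 : DifferentiableAt ℝ (fderiv ℝ f) x :=
    (hc.fderiv_right (m := (⊤ : ℕ∞)) (by simp)).differentiableAt (by simp)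
  have e : ∀ a b, pd a (pd b f) x = fderiv ℝ (fderiv ℝ f) x (EuclideanSpace.single a 1)
      (EuclideanSpace.single b 1) := by
    intro a b
    have := (h1.hasFDerivAt.clm_apply (hasFDerivAt_const (EuclideanSpace.single b (1 : ℝ)) x)).fderiv
    have e2 : pd b f = fun y => fderiv ℝ f y (EuclideanSpace.single b 1) := rfl
    rw [e2, pd, this]
    simp
  rw [e, e]
  exact hs _ _

lemma ipd_perm {S : Set (EuclideanSpace ℝ (Fin n))} (hS : IsOpen S)
    {f : EuclideanSpace ℝ (Fin n) → ℝ} (h : ContDiffOn ℝ (⊤ : ℕ∞) f S) {l₁ l₂ : List (Fin n)}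
    (hl : l₁.Perm l₂) : ∀ x ∈ S, ipd l₁ f x = ipd l₂ f x := by
  induction hl with
  | nil => intro x hx; rfl
  | cons i _ ih => exact pd_eqOn hS ih i
  | swap i j l => exact pd_comm hS (ipd_smooth hS h l) j i
  | trans _ _ ih1 ih2 => intro x hx; rw [ih1 x hx, ih2 x hx]

lemma pd_sum {ι : Type*} (s : Finset ι) {F : ι → EuclideanSpace ℝ (Fin n) → ℝ} (c : ι → ℝ)
    {x} (h : ∀ i ∈ s, DifferentiableAt ℝ (F i) x) (j : Fin n) :
    pd j (fun y => ∑ i ∈ s, c i * F i y) x = ∑ i ∈ s, c i * pd j (F i) x := by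
  rw [pd, fderiv_fun_sum (fun i hi => (h i hi).const_mul (c i)), ContinuousLinearMap.sum_apply]
  refine Finset.sum_congr rfl fun i hi => ?_
  rw [fderiv_const_mul (h i hi), pd]; simp

lemma ipd_sum {S : Set (EuclideanSpace ℝ (Fin n))} (hS : IsOpen S) {ι : Type*} (s : Finset ι)
    {F : ι → EuclideanSpace ℝ (Fin n) → ℝ} (c : ι → ℝ)
    (h : ∀ i ∈ s, ContDiffOn ℝ (⊤ : ℕ∞) (F i) S) (l : List (Fin n)) : ∀ x ∈ S,
    ipd l (fun y => ∑ i ∈ s, c i * F i y) x = ∑ i ∈ s, c i * ipd l (F i) x := by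
  induction l with
  | nil => intro x hx; rfl
  | cons j l ih =>
    intro x hx
    rw [ipd, pd_eqOn hS ih j x hx, pd_sum s c (fun i hi =>
      ((ipd_smooth hS (h i hi) l).contDiffAt (hS.mem_nhds hx)).differentiableAt (by simp)) j]
    rfl

lemma IsKer.ipd {K : EuclideanSpace ℝ (Fin n) → ℝ} {d : ℕ} (hK : IsKer d K) (l : List (Fin n)) :
    IsKer ((d + l.length : ℕ) : ℤ) (ipd l K) := by
  induction l with
  | nil => exact hK
  | cons i l ih =>
    have := ih.pd i
    convert this using 1
    all_goals first | rfl | (simp; ring)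

lemma U_ipd (h : 0 < n) {d : ℕ} (hd : n - 1 ≤ d) {K : EuclideanSpace ℝ (Fin n) → ℝ}
    (hK : IsKer d K) {g : EuclideanSpace ℝ (Fin (n - 1)) → ℝ} (hg : Wt g) (l : List (Fin n)) :
    ∀ x ∈ upperHalfSpace n, ipd l (Uop K g) x = Uop (ipd l K) g x := by
  induction l with
  | nil => intro x hx; rfl
  | cons i l ih =>
    intro x hx
    rw [ipd, pd_eqOn (isOpen_up h) ih i x hx, U_pd h (by omega) (hK.ipd l) hg hx]
    rfl

lemma U_smooth (h : 0 < n) {d : ℕ} (hd : n - 1 ≤ d) {K : EuclideanSpace ℝ (Fin n) → ℝ}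
    (hK : IsKer d K) {g : EuclideanSpace ℝ (Fin (n - 1)) → ℝ} (hg : Wt g) :
    ContDiffOn ℝ (⊤ : ℕ∞) (Uop K g) (upperHalfSpace n) :=
  contDiffOn_infty.2 fun k => U_contDiffOn h hg k hd hK

lemma U_congr (h : 0 < n) {K L : EuclideanSpace ℝ (Fin n) → ℝ} (e : ∀ X, X ≠ 0 → K X = L X)
    (g : EuclideanSpace ℝ (Fin (n - 1)) → ℝ) {x} (hx : x ∈ upperHalfSpace n) :
    Uop K g x = Uop L g x := by
  simp only [Uop]
  congr 1; ext z
  rw [e _ (up_ne h hx z)]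

end Ipd

section IBP
variable {n : ℕ}

def toUpL : EuclideanSpace ℝ (Fin (n - 1)) →L[ℝ] EuclideanSpace ℝ (Fin n) :=
  LinearMap.toContinuousLinearMap
    { toFun := fun z => toUp z 0
      map_add' := fun x y => by have := toUp_add x y 0 0; rwa [add_zero] at this
      map_smul' := fun r x => by have := toUp_smul r x 0; rwa [mul_zero] at this }

lemma toUpL_apply (z : EuclideanSpace ℝ (Fin (n - 1))) : toUpL z = toUp z 0 := rfl

lemma toUp_single (j : Fin (n - 1)) :
    toUp (EuclideanSpace.single j (1 : ℝ)) 0 = EuclideanSpace.single (finUp j) 1 := by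
  ext i
  rw [toUp_apply]
  by_cases hi : (i : ℕ) < n - 1
  · simp [hi, finUp, Fin.ext_iff, Pi.single_apply]
  · have : i ≠ finUp j := by
      intro e; rw [e] at hi; simp [finUp] at hi
    simp [hi, Pi.single_apply, this]

lemma ibp1 (h : 0 < n) {d : ℕ} (hd : n - 1 ≤ d) {B : EuclideanSpace ℝ (Fin n) → ℝ}
    (hB : IsKer d B) (j : Fin (n - 1)) {f g : EuclideanSpace ℝ (Fin (n - 1)) → ℝ} (hf : Wt f)
    (hg : Wt g) (hfg : ∀ φ : EuclideanSpace ℝ (Fin (n - 1)) → ℝ, ContDiff ℝ (⊤ : ℕ∞) φ →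
      HasCompactSupport φ → ∫ y, pd j φ y * f y = - ∫ y, φ y * g y)
    {x} (hx : x ∈ upperHalfSpace n) : Uop (pd (finUp j) B) f x = Uop B g x := by
  let χ : ContDiffBump (0 : EuclideanSpace ℝ (Fin (n - 1))) := ⟨1, 2, by norm_num, by norm_num⟩
  obtain ⟨M, hM⟩ : ∃ M, ∀ y, ‖fderiv ℝ χ y‖ ≤ M :=
    (χ.contDiff.continuous_fderiv (n := 1) (by simp)).bounded_above_of_compact_support
      (χ.hasCompactSupport.fderiv ℝ)
  have hM0 : 0 ≤ M := (norm_nonneg _).trans (hM 0)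
  set b : EuclideanSpace ℝ (Fin (n - 1)) → ℝ := fun y => B (x - toUp y 0) with hb
  have hbs : ContDiff ℝ (⊤ : ℕ∞) b := by
    rw [contDiff_iff_contDiffAt]
    intro y
    exact (hB.diffAt (up_ne h hx y)).comp y ((contDiff_const.sub toUpL.contDiff).contDiffAt)
  have hbd : ∀ y, HasFDerivAt b (-(fderiv ℝ B (x - toUp y 0)).comp toUpL) y := by
    intro y
    have h1 := ((hB.diffAt (up_ne h hx y)).differentiableAt (by simp)).hasFDerivAt
    have h2 : HasFDerivAt (fun y => x - toUp y 0) (-(toUpL (n := n))) y :=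
      (toUpL.hasFDerivAt (x := y)).const_sub x
    have := h1.comp y h2
    rwa [ContinuousLinearMap.comp_neg] at this
  set R : ℕ → ℝ := fun N => ((N : ℝ) + 1)⁻¹ with hR
  have hR0 : ∀ N, 0 < R N := fun N => by simp only [hR]; positivity
  have hR1 : ∀ N, R N ≤ 1 := fun N => by
    simp only [hR]; exact inv_le_one_of_one_le₀ (by simp)
  have hRl : Tendsto R atTop (𝓝 0) := by
    simpa [hR, one_div] using tendsto_one_div_add_atTop_nhds_zero_nat (𝕜 := ℝ)
  set c : ℕ → EuclideanSpace ℝ (Fin (n - 1)) → ℝ := fun N y => χ (R N • y) with hc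
  have hcs : ∀ N, ContDiff ℝ (⊤ : ℕ∞) (c N) := fun N =>
    χ.contDiff.comp (contDiff_const_smul _)
  have hcc : ∀ N, HasCompactSupport (c N) := fun N =>
    χ.hasCompactSupport.comp_smul (hR0 N).ne'
  have hcd : ∀ N y, HasFDerivAt (c N) (R N • fderiv ℝ χ (R N • y)) y := by
    intro N y
    have h1 := ((χ.contDiff (n := 1)).differentiable (by simp) (R N • y)).hasFDerivAt
    have := h1.comp y ((hasFDerivAt_id y).const_smul (R N))
    have e : R N • fderiv ℝ χ (R N • y) = (fderiv ℝ χ (R N • y)).comp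
        (R N • ContinuousLinearMap.id ℝ (EuclideanSpace ℝ (Fin (n - 1)))) := by
      ext v; simp
    rw [e]; exact this
  have hc1 : ∀ N y, |c N y| ≤ 1 := by
    intro N y; simp only [hc]; rw [abs_of_nonneg χ.nonneg]; exact χ.le_one
  have hcl : ∀ y, Tendsto (fun N => c N y) atTop (𝓝 1) := by
    intro y
    refine tendsto_const_nhds.congr' ?_
    have h1 : Tendsto (fun N => ‖R N • y‖) atTop (𝓝 0) := by
      have := (hRl.smul_const y).norm
      simpa using this
    filter_upwards [h1.eventually (gt_mem_nhds (by norm_num : (0 : ℝ) < 1))] with N hN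
    simp only [hc]
    rw [χ.one_of_mem_closedBall]
    simpa using hN.le
  have hpd : ∀ N y, pd j (fun y => c N y * b y) y =
      R N * fderiv ℝ χ (R N • y) (EuclideanSpace.single j 1) * b y
        - c N y * pd (finUp j) B (x - toUp y 0) := by
    intro N y
    rw [pd, (show HasFDerivAt (fun y => c N y * b y) _ y from (hcd N y).mul (hbd y)).fderiv]
    simp [pd, toUpL_apply, toUp_single]
    ring
  have key : ∀ N, ∫ y, (R N * fderiv ℝ χ (R N • y) (EuclideanSpace.single j 1) * b y
        - c N y * pd (finUp j) B (x - toUp y 0)) * f y = - ∫ y, (c N y * b y) * g y := by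
    intro N
    rw [← hfg _ ((hcs N).mul hbs) ((hcc N).mul_right)]
    simp only [← hpd]
  have hfB := U_intg h hd hB hf hx
  have hB' : IsKer ((d + 1 : ℕ) : ℤ) (pd (finUp j) B) := by exact_mod_cast hB.pd (finUp j)
  have hfB' := U_intg h (by omega) hB' hf hx
  have hgB := U_intg h hd hB hg hx
  have hbc : Continuous b := hbs.continuous
  have hpc : Continuous (fun y => pd (finUp j) B (x - toUp y 0)) := ker_cont h hB'.smooth.continuousOn hx
  have L1 : Tendsto (fun N => - ∫ y, (c N y * b y) * g y) atTop (𝓝 (- Uop B g x)) := by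
    refine Tendsto.neg (tendsto_integral_of_dominated_convergence _ (fun N => ?_) hgB.norm ?_ ?_)
    · exact ((hcs N).continuous.mul hbc).aestronglyMeasurable.mul hg.aesm
    · refine fun N => Eventually.of_forall fun y => ?_
      rw [mul_assoc, norm_mul]
      exact mul_le_of_le_one_left (norm_nonneg _) (hc1 N y)
    · refine Eventually.of_forall fun y => ?_
      have := ((hcl y).mul_const (b y)).mul_const (g y)
      rwa [one_mul] at this
  have L2 : Tendsto (fun N => ∫ y, (R N * fderiv ℝ χ (R N • y) (EuclideanSpace.single j 1) * b y
        - c N y * pd (finUp j) B (x - toUp y 0)) * f y) atTop (𝓝 (- Uop (pd (finUp j) B) f x)) := by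
    have e : - Uop (pd (finUp j) B) f x = ∫ y, -(pd (finUp j) B (x - toUp y 0) * f y) := by
      rw [integral_neg]; rfl
    rw [e]
    have hb1 : ∀ N y, |R N * fderiv ℝ χ (R N • y) (EuclideanSpace.single j 1)| ≤ R N * M := by
      intro N y
      rw [abs_mul, abs_of_pos (hR0 N)]
      have := ContinuousLinearMap.le_of_opNorm_le _ (hM (R N • y)) (EuclideanSpace.single j (1 : ℝ))
      simp at this
      exact mul_le_mul_of_nonneg_left this (hR0 N).le
    refine tendsto_integral_of_dominated_convergence (fun y => M * ‖b y * f y‖ +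
      ‖pd (finUp j) B (x - toUp y 0) * f y‖) (fun N => ?_) ((hfB.norm.const_mul M).add hfB'.norm) ?_ ?_
    · refine AEStronglyMeasurable.mul (Continuous.aestronglyMeasurable ?_) hf.aesm
      have : Continuous (fun y => fderiv ℝ χ (R N • y) (EuclideanSpace.single j (1 : ℝ))) :=
        ((χ.contDiff.continuous_fderiv (n := 1) (by simp)).comp
          (continuous_const_smul _)).clm_apply continuous_const
      exact ((continuous_const.mul this).mul hbc).sub ((hcs N).continuous.mul hpc)
    · refine fun N => Eventually.of_forall fun y => ?_
      rw [sub_mul]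
      refine (norm_sub_le _ _).trans (add_le_add ?_ ?_)
      · rw [mul_assoc _ (b y), norm_mul]
        refine mul_le_mul_of_nonneg_right ((hb1 N y).trans ?_) (norm_nonneg _)
        exact mul_le_of_le_one_left hM0 (hR1 N)
      · rw [mul_assoc, norm_mul]
        exact mul_le_of_le_one_left (norm_nonneg _) (hc1 N y)
    · refine Eventually.of_forall fun y => ?_
      have h1 : Tendsto (fun N => R N * fderiv ℝ χ (R N • y) (EuclideanSpace.single j 1)) atTop (𝓝 0) := by
        refine squeeze_zero_norm (fun N => hb1 N y) ?_
        simpa using hRl.mul_const M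
      have := ((h1.mul_const (b y)).sub ((hcl y).mul_const (pd (finUp j) B (x - toUp y 0)))).mul_const (f y)
      simpa using this
  have := tendsto_nhds_unique (L2.congr key) L1
  linarith

lemma ipd_cs (l : List (Fin n)) {φ : EuclideanSpace ℝ (Fin n) → ℝ} (h : HasCompactSupport φ) :
    HasCompactSupport (ipd l φ) := by
  induction l with
  | nil => exact h
  | cons i l ih => exact ih.fderiv_apply ℝ _

/-- scalar weak derivative -/
def SWD {m : ℕ} (k : ℕ) (d : Fin k → Fin m) (f g : EuclideanSpace ℝ (Fin m) → ℝ) : Prop :=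
  ∀ φ : EuclideanSpace ℝ (Fin m) → ℝ, ContDiff ℝ (⊤ : ℕ∞) φ → HasCompactSupport φ →
    ∫ y, ipd (List.ofFn d) φ y * f y = (-1) ^ k * ∫ y, φ y * g y

lemma swd_of {m q : ℕ} {p : ℝ} (hp : 1 < p) {k : ℕ} {d : Fin k → Fin m}
    {f g : EuclideanSpace ℝ (Fin m) → EuclideanSpace ℝ (Fin q)}
    (hf : MemLp f (ENNReal.ofReal p) volume) (hg : MemLp g (ENNReal.ofReal p) volume)
    (h : IsWeakDeriv k d f g) (α : Fin q) : SWD k d (fun y => f y α) (fun y => g y α) := by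
  intro φ hφ hφc
  have hp1 : 1 ≤ ENNReal.ofReal p := by
    rw [← ENNReal.ofReal_one]; exact ENNReal.ofReal_le_ofReal hp.le
  have h1 := h φ hφ hφc
  have e : ∀ y, mpd k d φ y = ipd (List.ofFn d) φ y := fun y =>
    mpd_ipd isOpen_univ hφ.contDiffOn k d y trivial
  simp only [e] at h1
  have hs : Continuous (ipd (List.ofFn d) φ) :=
    (continuousOn_univ.1 (ipd_smooth isOpen_univ hφ.contDiffOn _).continuousOn)
  have i1 := (hf.locallyIntegrable hp1).integrable_smul_left_of_hasCompactSupport hs (ipd_cs _ hφc)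
  have i2 := (hg.locallyIntegrable hp1).integrable_smul_left_of_hasCompactSupport hφ.continuous hφc
  have h2 := congrArg (EuclideanSpace.proj α : EuclideanSpace ℝ (Fin q) →L[ℝ] ℝ) h1
  rw [map_smul, ← ContinuousLinearMap.integral_comp_comm _ i1,
    ← ContinuousLinearMap.integral_comp_comm _ i2] at h2
  simpa using h2

lemma ibp_k (hn : 2 ≤ n) {p : ℝ} (hp : 1 < p) (ℓ : ℕ) (f : EuclideanSpace ℝ (Fin (n - 1)) → ℝ)
    (g : (k : ℕ) → (Fin k → Fin (n - 1)) → EuclideanSpace ℝ (Fin (n - 1)) → ℝ)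
    (hf : MemLp f (ENNReal.ofReal p) volume)
    (hg : ∀ k ≤ ℓ, ∀ d, MemLp (g k d) (ENNReal.ofReal p) volume ∧ SWD k d f (g k d)) (k : ℕ) :
    k ≤ ℓ → ∀ (d : Fin k → Fin (n - 1)) {e : ℕ} (_ : n - 1 ≤ e) {B : EuclideanSpace ℝ (Fin n) → ℝ}
    (_ : IsKer e B) {x} (_ : x ∈ upperHalfSpace n),
    Uop (ipd (List.ofFn (fun i => finUp (d i))) B) f x = Uop B (g k d) x := by
  have h0 : 0 < n := by omega
  have hp1 : 1 ≤ ENNReal.ofReal p := by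
    rw [← ENNReal.ofReal_one]; exact ENNReal.ofReal_le_ofReal hp.le
  induction k with
  | zero =>
    intro hk d e he B hB x hx
    have : f =ᵐ[volume] g 0 d := by
      refine ae_eq_of_integral_contDiff_smul_eq (hf.locallyIntegrable hp1)
        ((hg 0 hk d).1.locallyIntegrable hp1) fun φ h1 h2 => ?_
      have := (hg 0 hk d).2 φ h1 h2
      simpa [ipd] using this
    simp only [List.ofFn_zero, ipd]
    refine integral_congr_ae ?_
    filter_upwards [this] with z hz
    rw [hz]
  | succ k ih =>
    intro hk d e he B hB x hx
    rw [List.ofFn_succ_last, ipd_append]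
    have hB' : IsKer ((e + 1 : ℕ) : ℤ) (pd (finUp (d (Fin.last k))) B) := by
      exact_mod_cast hB.pd _
    have := ih (by omega) (fun i => d i.castSucc) (by omega : n - 1 ≤ e + 1) hB' hx
    simp only [ipd]
    rw [this]
    refine ibp1 h0 he hB _ (Wt_of_memLp hn hp (hg k (by omega) _).1) (Wt_of_memLp hn hp (hg (k + 1) hk d).1)
      (fun φ hφ hφc => ?_) hx
    have h1 := (hg k (by omega) (fun i => d i.castSucc)).2 (pd (d (Fin.last k)) φ)
      (contDiffOn_univ.1 (pd_smooth isOpen_univ hφ.contDiffOn _)) (ipd_cs [d (Fin.last k)] hφc)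
    have h2 := (hg (k + 1) hk d).2 φ hφ hφc
    rw [List.ofFn_succ_last, ipd_append] at h2
    simp only [ipd] at h2
    rw [h1, pow_succ] at h2
    have h3 : ((-1 : ℝ) ^ k) ≠ 0 := by positivity
    have h4 := mul_left_cancel₀ h3 (h2.trans (mul_assoc _ _ _))
    rw [h4]; ring

end IBP

section KERN
variable {n : ℕ}

/-- radial power -/
def rho (s : ℝ) (X : EuclideanSpace ℝ (Fin n)) : ℝ := (‖X‖ ^ 2) ^ (-s / 2)

/-- Kronecker delta -/
def dl (i j : Fin n) : ℝ := if i = j then 1 else 0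

lemma rho_eq (s : ℝ) {X : EuclideanSpace ℝ (Fin n)} (hX : X ≠ 0) :
    (∑ i, X i * X i) * rho (s + 2) X = rho s X := by
  have h1 : ∑ i, X i * X i = ‖X‖ ^ 2 := by
    rw [EuclideanSpace.real_norm_sq_eq]; exact Finset.sum_congr rfl fun i _ => by ring
  have h2 : 0 < ‖X‖ ^ 2 := by have := norm_pos_iff.2 hX; positivity
  rw [h1, rho, rho]
  nth_rewrite 1 [← rpow_one (‖X‖ ^ 2)]
  rw [← rpow_add h2]
  congr 1; ring

/-- partial derivative away from the origin -/
def DD (i : Fin n) (f f' : EuclideanSpace ℝ (Fin n) → ℝ) : Prop :=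
  ∀ X, X ≠ 0 → DifferentiableAt ℝ f X ∧ pd i f X = f' X

lemma DD.congr {i : Fin n} {f f' g' : EuclideanSpace ℝ (Fin n) → ℝ} (h : DD i f f')
    (e : ∀ X, X ≠ 0 → f' X = g' X) : DD i f g' := fun X hX => ⟨(h X hX).1, (h X hX).2.trans (e X hX)⟩

lemma DD.add {i : Fin n} {f f' g g' : EuclideanSpace ℝ (Fin n) → ℝ} (h : DD i f f') (k : DD i g g') :
    DD i (fun X => f X + g X) (fun X => f' X + g' X) := fun X hX => by
  refine ⟨(h X hX).1.add (k X hX).1, ?_⟩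
  show _ = _ + _
  rw [← (h X hX).2, ← (k X hX).2, pd, fderiv_fun_add (h X hX).1 (k X hX).1]; rfl

lemma DD.mul {i : Fin n} {f f' g g' : EuclideanSpace ℝ (Fin n) → ℝ} (h : DD i f f') (k : DD i g g') :
    DD i (fun X => f X * g X) (fun X => f' X * g X + f X * g' X) := fun X hX => by
  refine ⟨(h X hX).1.mul (k X hX).1, ?_⟩
  show _ = _ + _
  rw [← (h X hX).2, ← (k X hX).2, pd, fderiv_fun_mul (h X hX).1 (k X hX).1]
  simp [pd]; ring

lemma DD.cmul {i : Fin n} {f f' : EuclideanSpace ℝ (Fin n) → ℝ} (c : ℝ) (h : DD i f f') :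
    DD i (fun X => c * f X) (fun X => c * f' X) := fun X hX => by
  refine ⟨(h X hX).1.const_mul c, ?_⟩
  show _ = c * _
  rw [← (h X hX).2, pd, fderiv_const_mul (h X hX).1]
  simp [pd]

lemma DD.sum {ι : Type*} (s : Finset ι) {i : Fin n} {f f' : ι → EuclideanSpace ℝ (Fin n) → ℝ}
    (h : ∀ a, DD i (f a) (f' a)) :
    DD i (fun X => ∑ a ∈ s, f a X) (fun X => ∑ a ∈ s, f' a X) := fun X hX => by
  refine ⟨DifferentiableAt.fun_sum fun a _ => (h a X hX).1, ?_⟩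
  rw [pd, fderiv_fun_sum (fun a _ => (h a X hX).1), ContinuousLinearMap.sum_apply]
  exact Finset.sum_congr rfl fun a _ => (h a X hX).2

lemma DD.coord (i j : Fin n) : DD i (fun X => X j) (fun _ => dl i j) := fun X _ => by
  have h := (EuclideanSpace.proj j : EuclideanSpace ℝ (Fin n) →L[ℝ] ℝ).hasFDerivAt (x := X)
  have h' : HasFDerivAt (fun X : EuclideanSpace ℝ (Fin n) => X j) _ X := h
  refine ⟨h'.differentiableAt, ?_⟩
  rw [pd, h'.fderiv]
  simp [dl, Pi.single_apply, eq_comm]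

lemma DD_rho (s : ℝ) (i : Fin n) : DD i (rho s) (fun X => -s * (X i * rho (s + 2) X)) := fun X hX => by
  have h2 : 0 < ‖X‖ ^ 2 := by have := norm_pos_iff.2 hX; positivity
  have h1 : HasFDerivAt (fun X : EuclideanSpace ℝ (Fin n) => ‖X‖ ^ 2) (2 • innerSL ℝ X) X :=
    (hasStrictFDerivAt_norm_sq X).hasFDerivAt
  have h3 : HasFDerivAt (rho s) _ X := h1.rpow_const (p := -s / 2) (Or.inl h2.ne')
  refine ⟨h3.differentiableAt, ?_⟩
  rw [pd, h3.fderiv]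
  have e : -s / 2 - 1 = - (s + 2) / 2 := by ring
  simp [rho, e, EuclideanSpace.inner_single_right]
  ring

lemma rho_ker (s : ℕ) : IsKer (s : ℤ) (rho (n := n) s) := by
  refine ⟨?_, ?_⟩
  · intro X hX
    have hX : X ≠ 0 := hX
    refine ContDiffAt.contDiffWithinAt ?_
    have h2 : ‖X‖ ^ 2 ≠ 0 := by have := norm_pos_iff.2 hX; positivity
    exact (contDiff_norm_sq ℝ).contDiffAt.rpow_const_of_ne h2
  · intro r X hr hX
    rw [rho, rho, norm_smul, mul_pow, mul_rpow (by positivity) (by positivity)]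
    congr 1
    rw [norm_of_nonneg hr.le, ← rpow_natCast r 2, ← rpow_mul hr.le, ← rpow_intCast]
    congr 1; push_cast; ring

/-- Lame kernel divided by `t` -/
def HH (c1 c2 : ℝ) (α β : Fin n) (X : EuclideanSpace ℝ (Fin n)) : ℝ :=
  c1 * dl α β * rho n X + c2 * (X α * X β * rho (n + 2) X)

lemma HH_ker (c1 c2 : ℝ) (α β : Fin n) : IsKer (n : ℤ) (HH c1 c2 α β) := by
  have h1 := (rho_ker (n := n) n).cmul (c1 * dl α β)
  have h2 := (((IsKer.coord α).mul (IsKer.coord β)).mul (rho_ker (n := n) (n + 2))).cmul c2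
  have e : (-1 + -1 + ((n + 2 : ℕ) : ℤ)) = n := by push_cast; ring
  rw [e] at h2
  refine (h1.add h2).congr fun X _ => ?_
  simp [HH]

lemma HH_neg (c1 c2 : ℝ) (α β : Fin n) (X) : HH c1 c2 α β (-X) = HH c1 c2 α β X := by
  simp [HH, rho]

/-- Lame kernel -/
def KK (N : Fin n) (c1 c2 : ℝ) (α β : Fin n) (X : EuclideanSpace ℝ (Fin n)) : ℝ :=
  X N * HH c1 c2 α β X

lemma cast_pred (h : 0 < n) : (-1 + (n : ℤ)) = ((n - 1 : ℕ) : ℤ) := by omega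

lemma KK_ker (h : 0 < n) (N : Fin n) (c1 c2 : ℝ) (α β : Fin n) :
    IsKer ((n - 1 : ℕ) : ℤ) (KK N c1 c2 α β) := by
  have := (IsKer.coord N).mul (HH_ker c1 c2 α β)
  rwa [cast_pred h] at this

lemma DD_HH (c1 c2 : ℝ) (α β i : Fin n) : DD i (HH c1 c2 α β) (fun X =>
    c1 * dl α β * (-n * (X i * rho (n + 2) X)) + c2 * ((dl i α * X β + X α * dl i β) * rho (n + 2) X
      + X α * X β * (-(n + 2) * (X i * rho (n + 4) X)))) := by
  refine (((DD_rho n i).cmul (c1 * dl α β)).add ((((DD.coord i α).mul (DD.coord i β)).mul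
    (DD_rho (n + 2) i)).cmul c2)).congr fun X hX => ?_
  have : (n : ℝ) + 2 + 2 = n + 4 := by ring
  simp only [this]

lemma DD_KK (N : Fin n) (c1 c2 : ℝ) (α β i : Fin n) : DD i (KK N c1 c2 α β) (fun X =>
    dl i N * (c1 * dl α β * rho n X + c2 * (X α * X β * rho (n + 2) X)) + X N * (
    c1 * dl α β * (-n * (X i * rho (n + 2) X)) + c2 * ((dl i α * X β + X α * dl i β) * rho (n + 2) X
      + X α * X β * (-(n + 2) * (X i * rho (n + 4) X))))) :=
  ((DD.coord i N).mul (DD_HH c1 c2 α β i)).congr fun X hX => rfl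

lemma DD.pd {i j : Fin n} {f f' f'' : EuclideanSpace ℝ (Fin n) → ℝ} (h : DD i f f') (k : DD j f' f'') :
    DD j (pd i f) f'' := fun X hX => by
  have : _root_.pd i f =ᶠ[𝓝 X] f' := by
    filter_upwards [isOpen_compl_singleton.mem_nhds hX] with Y hY using (h Y hY).2
  exact ⟨(k X hX).1.congr_of_eventuallyEq this, (pd_congr this j).trans (k X hX).2⟩

lemma sum_dl (i : Fin n) (F : Fin n → ℝ) : ∑ s, dl s i * F s = F i := by simp [dl]

lemma rho_eq' {s s' : ℝ} (e : s' = s + 2) {X : EuclideanSpace ℝ (Fin n)} (hX : X ≠ 0) :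
    (∑ i, X i * X i) * rho s' X = rho s X := by rw [e, rho_eq s hX]

lemma div_KK (N : Fin n) (c1 c2 : ℝ) (β : Fin n) {X : EuclideanSpace ℝ (Fin n)} (hX : X ≠ 0) :
    ∑ γ, pd γ (KK N c1 c2 γ β) X = c1 * (dl β N * rho n X) + c1 * (-n * (X N * X β * rho (n + 2) X)) := by
  have h4 := rho_eq' (s := n + 2) (s' := n + 4) (by ring) hX
  have e : ∀ γ, pd γ (KK N c1 c2 γ β) X = dl γ β * (c1 * (dl γ N * rho n X)) +
      c2 * (dl γ N * (X γ * X β * rho (n + 2) X)) + 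
      c1 * (dl γ β * (- n * (X N * X γ * rho (n + 2) X))) + c2 * (X N * X β * rho (n + 2) X)
      + c2 * (dl γ β * (X N * X γ * rho (n + 2) X))
      + c2 * (- (n + 2) * X N * X β * (X γ * X γ * rho (n + 4) X)) := by
    intro γ
    rw [(DD_KK N c1 c2 γ β γ X hX).2]
    have : dl γ γ = 1 := by simp [dl]
    rw [this]; ring
  simp only [e, Finset.sum_add_distrib, ← Finset.mul_sum, sum_dl, ← Finset.sum_mul, h4]
  simp
  ring

lemma DD_div (N : Fin n) (c1 c2 : ℝ) (α β : Fin n) :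
    DD α (fun X => ∑ γ, pd γ (KK N c1 c2 γ β) X) (fun X =>
      - (n * c1) * ((dl β N * X α + dl α N * X β + X N * dl α β) * rho (n + 2) X
        - (n + 2) * X N * X α * X β * rho (n + 4) X)) := by
  have h1 := (((DD_rho n α).cmul (dl β N)).cmul c1).add
    (((((DD.coord α N).mul (DD.coord α β)).mul (DD_rho (n + 2) α)).cmul (-n)).cmul c1)
  intro X hX
  have e : (fun X => ∑ γ, _root_.pd γ (KK N c1 c2 γ β) X) =ᶠ[𝓝 X] 
    (fun X => c1 * (dl β N * rho n X) + c1 * (-n * (X N * X β * rho (n + 2) X))) := by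
    filter_upwards [isOpen_compl_singleton.mem_nhds hX] with Y hY using div_KK N c1 c2 β hY
  refine ⟨(h1 X hX).1.congr_of_eventuallyEq e, (pd_congr e α).trans ((h1 X hX).2.trans ?_)⟩
  have : (n : ℝ) + 2 + 2 = n + 4 := by ring
  simp only [this]
  ring

lemma lap_KK (N : Fin n) (c1 c2 : ℝ) (α β : Fin n) {X : EuclideanSpace ℝ (Fin n)} (hX : X ≠ 0) :
    ∑ s, pd s (pd s (KK N c1 c2 α β)) X = 2 * c2 *
      ((dl β N * X α + dl α N * X β + X N * dl α β) * rho (n + 2) X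
        - (n + 2) * X N * X α * X β * rho (n + 4) X) := by
  have h4 := rho_eq' (s := n + 2) (s' := n + 4) (by ring) hX
  have h6 := rho_eq' (s := n + 4) (s' := n + 6) (by ring) hX
  have e : ∀ s, pd s (pd s (KK N c1 c2 α β)) X = 
      dl s N * (c1 * dl α β * (-2 * n * (X s * rho (n + 2) X)))
      + c1 * dl α β * (-n * X N * rho (n + 2) X)
      + c1 * dl α β * (n * (n + 2) * X N * (X s * X s * rho (n + 4) X))
      + dl s N * (c2 * (2 * dl s α * X β * rho (n + 2) X))
      + dl s N * (c2 * (2 * dl s β * X α * rho (n + 2) X))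
      + dl s α * (c2 * (2 * dl s β * X N * rho (n + 2) X))
      + dl s N * (c2 * (- 2 * (n + 2) * X s * X α * X β * rho (n + 4) X))
      + dl s α * (c2 * (- 2 * (n + 2) * X s * X N * X β * rho (n + 4) X))
      + dl s β * (c2 * (- 2 * (n + 2) * X s * X N * X α * rho (n + 4) X))
      + c2 * (- (n + 2) * X N * X α * X β * rho (n + 4) X)
      + c2 * ((n + 2) * (n + 4) * X N * X α * X β * (X s * X s * rho (n + 6) X)) := by
    intro s
    have k1 := (DD_HH c1 c2 α β s).cmul (dl s N)
    have k2 := ((DD.coord s s).mul (DD_rho (n + 2) s)).cmul (-n) |>.cmul (c1 * dl α β)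
    have k3 := (((DD.coord s β).cmul (dl s α)).add ((DD.coord s α).cmul (dl s β))).mul (DD_rho (n + 2) s)
    have k4 := ((DD.coord s α).mul (DD.coord s β)).mul (((DD.coord s s).mul (DD_rho (n + 4) s)).cmul (-(n + 2)))
    have k5 := (DD.coord s N).mul (k2.add ((k3.add k4).cmul c2))
    have k6 := ((DD_KK N c1 c2 α β s).congr (g' := _) (fun Y hY => ?_)).pd (k1.add k5)
    · rw [(k6 X hX).2]
      have e1 : (n : ℝ) + 2 + 2 = n + 4 := by ring
      have e2 : (n : ℝ) + 4 + 2 = n + 6 := by ring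
      have : dl s s = 1 := by simp [dl]
      simp only [this, e1, e2]; ring
    · simp only [HH]; ring
  simp only [e, Finset.sum_add_distrib, ← Finset.mul_sum, sum_dl, ← Finset.sum_mul, h4, h6]
  have s1 : ∀ i j : Fin n, dl i j = dl j i := fun i j => by simp [dl, eq_comm]
  rw [s1 N α, s1 N β]
  simp
  ring

lemma pde_KK (N : Fin n) {c1 c2 mu lam : ℝ} (hc : 2 * mu * c2 = n * (lam + mu) * c1) (α β : Fin n)
    {X : EuclideanSpace ℝ (Fin n)} (hX : X ≠ 0) :
    mu * ∑ s, pd s (pd s (KK N c1 c2 α β)) X +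
      (lam + mu) * pd α (fun Y => ∑ γ, pd γ (KK N c1 c2 γ β) Y) X = 0 := by
  rw [lap_KK N c1 c2 α β hX, (DD_div N c1 c2 α β X hX).2]
  linear_combination ((dl β N * X α + dl α N * X β + X N * dl α β) * rho (n + 2) X
        - (n + 2) * X N * X α * X β * rho (n + 4) X) * hc

lemma pde_KK' (h : 0 < n) (N : Fin n) {c1 c2 mu lam : ℝ} (hc : 2 * mu * c2 = n * (lam + mu) * c1)
    (α β : Fin n) {X : EuclideanSpace ℝ (Fin n)} (hX : X ≠ 0) :
    mu * ∑ s, pd s (pd s (KK N c1 c2 α β)) X +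
      (lam + mu) * ∑ γ, pd α (pd γ (KK N c1 c2 γ β)) X = 0 := by
  rw [← pde_KK N hc α β hX]
  congr 2
  have := (DD.sum Finset.univ (i := α) (f := fun γ => pd γ (KK N c1 c2 γ β))
    (f' := fun γ => pd α (pd γ (KK N c1 c2 γ β))) (fun γ Y hY => ⟨?_, rfl⟩) X hX).2
  · exact this.symm
  · exact (((KK_ker h N c1 c2 γ β).pd γ).diffAt hY).differentiableAt (by simp)

lemma euler_HH (c1 c2 : ℝ) (α β : Fin n) {X : EuclideanSpace ℝ (Fin n)} (hX : X ≠ 0) :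
    ∑ i, pd i (KK i c1 c2 α β) X = 0 := by
  have h4 := rho_eq' (s := n + 2) (s' := n + 4) (by ring) hX
  have h2 := rho_eq' (s := n) (s' := n + 2) (by ring) hX
  have e : ∀ i, pd i (KK i c1 c2 α β) X = HH c1 c2 α β X +
     c1 * dl α β * (-n * (X i * X i * rho (n + 2) X)) + dl i α * (c2 * X i * X β * rho (n + 2) X)
     + dl i β * (c2 * X i * X α * rho (n + 2) X) 
     + c2 * (X α * X β * (-(n + 2) * (X i * X i * rho (n + 4) X))) := by
    intro i
    rw [(DD_KK i c1 c2 α β i X hX).2]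
    have : dl i i = 1 := by simp [dl]
    rw [this, HH]; ring
  simp only [e, Finset.sum_add_distrib, ← Finset.mul_sum, sum_dl, ← Finset.sum_mul, h4, h2]
  simp [HH]
  ring

end KERN

section RED
variable {n : ℕ}

/-- reduction to tangential derivatives of good kernels -/
def Red (p κ : ℝ) (k : ℕ) (F : EuclideanSpace ℝ (Fin n) → ℝ) : Prop :=
  ∃ (ι : Type) (_ : Fintype ι) (d : ι → Fin k → Fin (n - 1)) (B : ι → EuclideanSpace ℝ (Fin n) → ℝ),
    (∀ i, IsKer ((n - 1 : ℕ) : ℤ) (B i) ∧ Good p κ (B i)) ∧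
    ∀ X, X ≠ 0 → F X = ∑ i, ipd (List.ofFn (fun a => finUp (d i a))) (B i) X

namespace Red
variable {p κ : ℝ} {k : ℕ} {F G : EuclideanSpace ℝ (Fin n) → ℝ}

lemma congr (h : Red p κ k F) (e : ∀ X, X ≠ 0 → G X = F X) : Red p κ k G := by
  obtain ⟨ι, _, d, B, hB, hF⟩ := h
  exact ⟨ι, _, d, B, hB, fun X hX => (e X hX).trans (hF X hX)⟩

lemma zero : Red p κ k (fun _ : EuclideanSpace ℝ (Fin n) => (0 : ℝ)) :=
  ⟨Empty, inferInstance, fun i => i.elim, fun i => i.elim, fun i => i.elim, fun X _ => by simp⟩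

lemma add (h : Red p κ k F) (h' : Red p κ k G) : Red p κ k (fun X => F X + G X) := by
  obtain ⟨ι, _, d, B, hB, hF⟩ := h
  obtain ⟨ι', _, d', B', hB', hF'⟩ := h'
  refine ⟨ι ⊕ ι', inferInstance, Sum.elim d d', Sum.elim B B', ?_, fun X hX => ?_⟩
  · rintro (i | i)
    · exact hB i
    · exact hB' i
  · show F X + G X = _
    rw [hF X hX, hF' X hX, Fintype.sum_sum_type]; rfl

lemma sum {ι : Type*} (s : Finset ι) {H : ι → EuclideanSpace ℝ (Fin n) → ℝ}
    (h : ∀ i ∈ s, Red p κ k (H i)) : Red p κ k (fun X => ∑ i ∈ s, H i X) := by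
  classical
  induction s using Finset.induction_on with
  | empty => simpa using zero
  | insert a s ha ih =>
    simp only [Finset.sum_insert ha]
    exact (h a (by simp)).add (ih fun i hi => h i (by simp [hi]))

lemma cmul (hp : 0 < p) (c : ℝ) (h : Red p κ k F) : Red p κ k (fun X => c * F X) := by
  obtain ⟨ι, _, d, B, hB, hF⟩ := h
  refine ⟨ι, inferInstance, d, fun i X => c * B i X, fun i => ⟨(hB i).1.cmul c, ?_⟩, fun X hX => ?_⟩
  · obtain ⟨C, hC⟩ := (hB i).2
    refine ⟨‖c‖₊ ^ p * C, fun g hg => ?_⟩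
    have e : ∀ x, ntMax κ (Uop (fun X => c * B i X) g) x ≤ ‖c‖ₑ * ntMax κ (Uop (B i) g) x := by
      intro x
      refine ntMax_le fun y t ht hd => ?_
      have : Uop (fun X => c * B i X) g (toUp y t) = c * Uop (B i) g (toUp y t) := by
        simp only [Uop, mul_assoc]; rw [integral_const_mul]
      rw [this, enorm_mul]
      gcongr
      exact le_ntMax ht hd
    calc _ ≤ ∫⁻ x, ‖c‖ₑ ^ p * (ntMax κ (Uop (B i) g) x) ^ p := lintegral_mono fun x => by
            rw [← ENNReal.mul_rpow_of_nonneg _ _ hp.le]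
            exact ENNReal.rpow_le_rpow (e x) hp.le
      _ = ‖c‖ₑ ^ p * ∫⁻ x, (ntMax κ (Uop (B i) g) x) ^ p :=
          lintegral_const_mul' _ _ (ENNReal.rpow_ne_top_of_nonneg hp.le (by simp))
      _ ≤ ‖c‖ₑ ^ p * (C * ∫⁻ z, ‖g z‖ₑ ^ p) := by gcongr; exact hC g hg
      _ = _ := by
          rw [← mul_assoc]; congr 1
          rw [ENNReal.coe_mul, ENNReal.coe_rpow_of_nonneg _ hp.le]; rfl
  · show c * F X = _
    rw [hF X hX, Finset.mul_sum]
    refine Finset.sum_congr rfl fun i _ => ?_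
    have := ipd_sum (isOpen_compl_singleton (x := (0 : EuclideanSpace ℝ (Fin n)))) ({()} : Finset Unit) (F := fun _ => B i)
      (fun _ => c) (fun _ _ => (hB i).1.smooth) (List.ofFn (fun a => finUp (d i a))) X hX
    simpa using this.symm

lemma pd (h : Red p κ k F) (j : Fin (n - 1)) : Red p κ (k + 1) (pd (finUp j) F) := by
  obtain ⟨ι, _, d, B, hB, hF⟩ := h
  refine ⟨ι, inferInstance, fun i => Fin.cons j (d i), B, hB, fun X hX => ?_⟩
  have h1 := pd_eqOn (isOpen_compl_singleton (x := (0 : EuclideanSpace ℝ (Fin n)))) hF (finUp j) X hX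
  rw [h1]
  have := pd_sum Finset.univ (F := fun i => ipd (List.ofFn (fun a => finUp (d i a))) (B i))
    (fun _ : ι => (1 : ℝ)) (x := X) (fun i _ => 
    (((hB i).1.ipd _).diffAt hX).differentiableAt (by simp)) (finUp j)
  simp only [one_mul] at this
  rw [this]
  refine Finset.sum_congr rfl fun i _ => ?_
  rw [List.ofFn_succ]
  rfl

lemma base (h : IsKer ((n - 1 : ℕ) : ℤ) F) (h' : Good p κ F) : Red p κ 0 F :=
  ⟨Unit, inferInstance, fun _ i => i.elim0, fun _ => F, fun _ => ⟨h, h'⟩, fun X _ => by simp [ipd]⟩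

end Red

lemma red_KK (hn : 2 ≤ n) {p κ : ℝ} (hp : 1 < p) (hκ : 0 < κ) (h : 0 < n) {c1 c2 mu lam : ℝ}
    (hmu : 0 < mu) (hlam : 0 < 2 * mu + lam) (hc : 2 * mu * c2 = n * (lam + mu) * c1) (k : ℕ) :
    ∀ (l : List (Fin n)), l.length = k → ∀ α β, Red p κ k (ipd l (KK (lastIdx n h) c1 c2 α β)) := by
  set N := lastIdx n h with hN
  have hS := isOpen_compl_singleton (x := (0 : EuclideanSpace ℝ (Fin n)))
  have hp0 : 0 < p := by linarith
  have hKs := fun N α β => (KK_ker h N c1 c2 α β).smooth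
  induction k using Nat.strong_induction_on with
  | _ k ih =>
  have tang : ∀ (l : List (Fin n)) (j : Fin (n - 1)), (finUp j :: l).length = k →
      ∀ α β, Red p κ k (ipd (finUp j :: l) (KK N c1 c2 α β)) := by
    intro l j hl α β
    have hl' : l.length + 1 = k := hl
    have := (ih l.length (by omega) l rfl α β).pd j
    rw [hl'] at this
    exact this
  have tang' : ∀ (l : List (Fin n)) (j : Fin (n - 1)), finUp j ∈ l → l.length = k →
      ∀ α β, Red p κ k (ipd l (KK N c1 c2 α β)) := by
    intro l j hj hl α β
    have hp := List.perm_cons_erase hj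
    exact (tang _ j (by rw [← hp.length_eq, hl]) α β).congr fun X hX =>
      ipd_perm hS (hKs N α β) hp X hX
  intro l hl α β
  by_cases hj : ∃ j, finUp j ∈ l
  · obtain ⟨j, hj⟩ := hj
    exact tang' l j hj hl α β
  push Not at hj
  have hall : ∀ i ∈ l, i = N := by
    intro i hi
    rcases idx_cases h i with e | ⟨j, rfl⟩
    · exact e
    · exact absurd hi (hj j)
  match l, hl, hall with
  | [], hl, _ =>
    have : k = 0 := by simpa using hl.symm
    subst this
    exact Red.base (KK_ker h N c1 c2 α β) (good_type1 hn hp hκ (HH_ker c1 c2 α β) fun X => by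
      rw [xlast_eq h]; rfl)
  | [i], hl, hall =>
    have hi := hall i (by simp)
    subst hi
    have : k = 1 := by simpa using hl.symm
    subst this
    have h1 : ∀ j : Fin (n - 1), Red p κ 1 (pd (finUp j) (KK (finUp j) c1 c2 α β)) := fun j =>
      (Red.base (KK_ker h _ c1 c2 α β) (good_type2 hn hp hκ (KK_ker h _ c1 c2 α β) fun x' => by
        have : toUp (n := n) (-x') 0 = - toUp x' 0 := by
          have := toUp_smul (n := n) (-1) x' 0
          simpa using this
        rw [this]
        simp [KK, HH_neg])).pd j
    refine ((Red.sum Finset.univ fun j _ => h1 j).cmul hp0 (-1)).congr fun X hX => ?_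
    have := euler_HH c1 c2 α β hX
    rw [sum_idx h] at this
    simp only [ipd]
    linarith
  | i :: i' :: l', hl, hall =>
    have hi := hall i (by simp)
    have hi' := hall i' (by simp)
    rw [hi, hi']
    have hl2 : l'.length + 2 = k := by simpa using hl
    have perm : ∀ a b : Fin n, (a :: b :: l').Perm (l' ++ [a, b]) := fun a b =>
      (List.perm_append_comm (l₁ := [a, b]) (l₂ := l'))
    -- operator
    have op : ∀ a b α, ∀ X ∈ ({0}ᶜ : Set (EuclideanSpace ℝ (Fin n))),
        ipd (a :: b :: l') (KK N c1 c2 α β) X = ipd l' (pd a (pd b (KK N c1 c2 α β))) X := by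
      intro a b α X hX
      rw [ipd_perm hS (hKs N α β) (perm a b) X hX, ipd_append]; rfl
    have sm : ∀ a b α, ContDiffOn ℝ (⊤ : ℕ∞) (pd a (pd b (KK N c1 c2 α β))) {0}ᶜ := fun a b α =>
      (((KK_ker h N c1 c2 α β).pd b).pd a).smooth
    -- PDE after applying l'
    have pde : ∀ α, ∀ X ∈ ({0}ᶜ : Set (EuclideanSpace ℝ (Fin n))),
        mu * ∑ s, ipd (s :: s :: l') (KK N c1 c2 α β) X +
        (lam + mu) * ∑ γ, ipd (α :: γ :: l') (KK N c1 c2 γ β) X = 0 := by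
      intro α X hX
      have e1 := ipd_sum hS (Finset.univ : Finset (Fin n ⊕ Fin n))
        (F := Sum.elim (fun s => pd s (pd s (KK N c1 c2 α β))) (fun γ => pd α (pd γ (KK N c1 c2 γ β))))
        (Sum.elim (fun _ => mu) (fun _ => lam + mu)) (by rintro (s | s) _ <;> exact sm _ _ _) l' X hX
      have e2 := ipd_eqOn hS (f := fun y => ∑ i, Sum.elim (fun _ => mu) (fun _ => lam + mu) i *
        (Sum.elim (fun s => pd s (pd s (KK N c1 c2 α β))) (fun γ => pd α (pd γ (KK N c1 c2 γ β))) i : _ → ℝ) y)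
        (g := fun _ => 0) (fun Y hY => by
          rw [Fintype.sum_sum_type]
          simp only [Sum.elim_inl, Sum.elim_inr, ← Finset.mul_sum]
          exact pde_KK' h N hc α β hY) l' X hX
      have e3 := ipd_sum hS (∅ : Finset Unit) (F := fun _ _ => 0) (fun _ => 0) (by simp) l' X hX
      simp only [Finset.sum_empty] at e3
      rw [e2, e3, Fintype.sum_sum_type] at e1
      simp only [Sum.elim_inl, Sum.elim_inr, ← Finset.mul_sum] at e1
      simp only [op _ _ _ X hX]
      exact e1.symm
    have T : ∀ (j : Fin (n - 1)) a α, Red p κ k (ipd (finUp j :: a :: l') (KK N c1 c2 α β)) :=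
      fun j a α => tang _ j (by simpa using hl2) α β
    have T' : ∀ (j : Fin (n - 1)) a α, Red p κ k (ipd (a :: finUp j :: l') (KK N c1 c2 α β)) :=
      fun j a α => tang' _ j (by simp) (by simpa using hl2) α β
    rcases idx_cases h α with e | ⟨j, e⟩
    · rw [e]
      refine (((Red.sum Finset.univ fun j _ => T j (finUp j) N).cmul hp0 (-mu / (2 * mu + lam))).add
        ((Red.sum Finset.univ fun j _ => T' j N (finUp j)).cmul hp0 (-(lam + mu) / (2 * mu + lam)))).congr
          fun X hX => ?_
      have := pde N X hX
      rw [sum_idx h, sum_idx h] at this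
      have hne : mu * 2 + lam ≠ 0 := by linarith
      field_simp
      linarith
    · rw [e]
      refine (((Red.sum Finset.univ fun j' _ => T j' (finUp j') (finUp j)).cmul hp0 (-1)).add
        ((Red.sum Finset.univ fun γ _ => T j γ γ).cmul hp0 (-(lam + mu) / mu))).congr
          fun X hX => ?_
      have := pde (finUp j) X hX
      rw [sum_idx h] at this
      field_simp
      linarith

end RED

section SOL
variable {n : ℕ}

/-- the solution -/
def usol (n : ℕ) (lam mu : ℝ) (f : EuclideanSpace ℝ (Fin (n - 1)) → EuclideanSpace ℝ (Fin n)) :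
    EuclideanSpace ℝ (Fin n) → EuclideanSpace ℝ (Fin n) := fun x =>
          (WithLp.equiv 2 (Fin n → ℝ)).symm (fun α =>
            (4 * mu / (3 * mu + lam)) * (1 / sphereArea n) *
              (∫ y' : EuclideanSpace ℝ (Fin (n - 1)),
                xlast x * ((‖xinit x - y'‖ ^ 2 + (xlast x) ^ 2) ^ (-(n : ℝ) / 2)) * f y' α)
            + ((mu + lam) / (3 * mu + lam)) * (2 * n / sphereArea n) *
                ∑ β : Fin n, ∫ y' : EuclideanSpace ℝ (Fin (n - 1)),
                  xlast x * toUp (xinit x - y') (xlast x) α *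
                    toUp (xinit x - y') (xlast x) β *
                    ((‖xinit x - y'‖ ^ 2 + (xlast x) ^ 2) ^ (-((n : ℝ) + 2) / 2)) * f y' β)

/-- first constant -/
def cc1 (n : ℕ) (lam mu : ℝ) : ℝ := (4 * mu / (3 * mu + lam)) * (1 / sphereArea n)
/-- second constant -/
def cc2 (n : ℕ) (lam mu : ℝ) : ℝ := ((mu + lam) / (3 * mu + lam)) * (2 * n / sphereArea n)

lemma cc_rel (n : ℕ) (lam mu : ℝ) : 2 * mu * cc2 n lam mu = n * (lam + mu) * cc1 n lam mu := by
  simp only [cc1, cc2]; ring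

lemma Uop_sum (h : 0 < n) {d : ℕ} (hd : n - 1 ≤ d) {ι : Type*} (s : Finset ι)
    {F : ι → EuclideanSpace ℝ (Fin n) → ℝ} (c : ι → ℝ) (hF : ∀ i, IsKer d (F i))
    {g : EuclideanSpace ℝ (Fin (n - 1)) → ℝ} (hg : Wt g) {x} (hx : x ∈ upperHalfSpace n) :
    Uop (fun X => ∑ i ∈ s, c i * F i X) g x = ∑ i ∈ s, c i * Uop (F i) g x := by
  simp only [Uop, Finset.sum_mul, mul_assoc]
  rw [integral_finset_sum _ (fun i _ => (U_intg h hd (hF i) hg hx).const_mul (c i))]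
  simp only [integral_const_mul]

lemma Uop_zero (g : EuclideanSpace ℝ (Fin (n - 1)) → ℝ) (x) :
    Uop (fun _ : EuclideanSpace ℝ (Fin n) => (0 : ℝ)) g x = 0 := by simp [Uop]

lemma usol_eq (h : 0 < n) (lam mu : ℝ) {f : EuclideanSpace ℝ (Fin (n - 1)) → EuclideanSpace ℝ (Fin n)}
    (hf : ∀ β, Wt (fun y => f y β)) {x} (hx : x ∈ upperHalfSpace n) (α : Fin n) :
    usol n lam mu f x α = ∑ β, Uop (KK (lastIdx n h) (cc1 n lam mu) (cc2 n lam mu) α β)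
      (fun y => f y β) x := by
  set N := lastIdx n h
  have hX : ∀ y : EuclideanSpace ℝ (Fin (n - 1)), toUp (xinit x - y) (xlast x) = x - toUp y 0 := by
    intro y
    conv_rhs => rw [← toUp_eta h x]
    rw [toUp_sub0]
  have hr : ∀ y : EuclideanSpace ℝ (Fin (n - 1)), ‖xinit x - y‖ ^ 2 + xlast x ^ 2 = ‖x - toUp y 0‖ ^ 2 := by
    intro y; rw [← hX, norm_toUp_sq h]
  have hl : ∀ y : EuclideanSpace ℝ (Fin (n - 1)), xlast x = (x - toUp y 0) N := by
    intro y; rw [← hX, toUp_last h]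
  have e1 : usol n lam mu f x α = cc1 n lam mu * Uop (fun X => X N * rho n X) (fun y => f y α) x
      + cc2 n lam mu * ∑ β, Uop (fun X => X N * (X α * X β * rho (n + 2) X)) (fun y => f y β) x := by
    show _ * _ + _ * _ = _
    simp only [Uop, cc1, cc2]
    congr 2
    · congr 1; ext y
      rw [hr, ← hl]; rfl
    · congr 1; ext β
      congr 1; ext y
      rw [hr, hX, ← hl, rho]; ring
  rw [e1]
  have k1 := fun α β => KK_ker h N 1 0 α β
  have k2 := fun α β => KK_ker h N 0 1 α β
  have e2 : ∀ β, Uop (KK N (cc1 n lam mu) (cc2 n lam mu) α β) (fun y => f y β) x =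
      cc1 n lam mu * dl α β * Uop (fun X => X N * rho n X) (fun y => f y β) x
      + cc2 n lam mu * Uop (fun X => X N * (X α * X β * rho (n + 2) X)) (fun y => f y β) x := by
    intro β
    have e3 : (fun X : EuclideanSpace ℝ (Fin n) => X N * rho n X) = KK N 1 0 α α := by
      ext X; simp [KK, HH, dl]
    have e4 : (fun X : EuclideanSpace ℝ (Fin n) => X N * (X α * X β * rho (n + 2) X)) = KK N 0 1 α β := by
      ext X; simp [KK, HH]
    rw [e3, e4]
    have := Uop_sum h le_rfl Finset.univ (F := fun b : Bool => if b then KK N 1 0 α α else KK N 0 1 α β)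
      (fun b : Bool => if b then cc1 n lam mu * dl α β else cc2 n lam mu)
      (by rintro (b | b) <;> simp [k1, k2]) (hf β) hx
    simp only [Fintype.sum_bool, if_true] at this
    simp only [Bool.false_eq_true, if_false] at this
    rw [← this]
    congr 1; ext X
    have hd : dl α α = 1 := by simp [dl]
    simp only [KK, HH, hd]; ring
  simp only [e2, Finset.sum_add_distrib, ← Finset.mul_sum]
  congr 1
  simp [dl]

lemma usol_ipd (h : 0 < n) (lam mu : ℝ) {f : EuclideanSpace ℝ (Fin (n - 1)) → EuclideanSpace ℝ (Fin n)}
    (hf : ∀ β, Wt (fun y => f y β)) (α : Fin n) (l : List (Fin n)) {x} (hx : x ∈ upperHalfSpace n) :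
    ipd l (fun y => usol n lam mu f y α) x =
      ∑ β, Uop (ipd l (KK (lastIdx n h) (cc1 n lam mu) (cc2 n lam mu) α β)) (fun y => f y β) x := by
  have h1 := ipd_eqOn (isOpen_up h) (fun x hx => usol_eq h lam mu hf hx α) l x hx
  have h2 := ipd_sum (isOpen_up h) Finset.univ
    (F := fun β => Uop (KK (lastIdx n h) (cc1 n lam mu) (cc2 n lam mu) α β) (fun y => f y β))
    (fun _ => 1) (fun β _ => U_smooth h le_rfl (KK_ker h _ _ _ α β) (hf β)) l x hx
  simp only [one_mul] at h2
  rw [h1, h2]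
  exact Finset.sum_congr rfl fun β _ => U_ipd h le_rfl (KK_ker h _ _ _ α β) (hf β) l x hx

lemma usol_smooth (h : 0 < n) (lam mu : ℝ) {f : EuclideanSpace ℝ (Fin (n - 1)) → EuclideanSpace ℝ (Fin n)}
    (hf : ∀ β, Wt (fun y => f y β)) (α : Fin n) :
    ContDiffOn ℝ (⊤ : ℕ∞) (fun y => usol n lam mu f y α) (upperHalfSpace n) := by
  refine ContDiffOn.congr (f := fun x => ∑ β, Uop (KK (lastIdx n h) (cc1 n lam mu) (cc2 n lam mu) α β)
      (fun y => f y β) x) (ContDiffOn.sum fun β _ => U_smooth h le_rfl (KK_ker h _ _ _ α β) (hf β))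
    fun x hx => usol_eq h lam mu hf hx α

lemma usol_pde (h : 0 < n) (lam mu : ℝ) {f : EuclideanSpace ℝ (Fin (n - 1)) → EuclideanSpace ℝ (Fin n)}
    (hf : ∀ β, Wt (fun y => f y β)) (α : Fin n) {x} (hx : x ∈ upperHalfSpace n) :
    mu * (∑ s : Fin n, pd s (pd s (fun y => usol n lam mu f y α)) x)
            + (lam + mu) *
                pd α (fun y => ∑ β : Fin n, pd β (fun z => usol n lam mu f z β) y) x = 0 := by
  set N := lastIdx n h
  set K := KK N (cc1 n lam mu) (cc2 n lam mu) with hK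
  have hS := isOpen_up h
  have e1 : ∀ s, pd s (pd s (fun y => usol n lam mu f y α)) x =
      ∑ β, Uop (pd s (pd s (K α β))) (fun y => f y β) x := fun s =>
    usol_ipd h lam mu hf α [s, s] hx
  have e2 : pd α (fun y => ∑ β : Fin n, pd β (fun z => usol n lam mu f z β) y) x =
      ∑ γ, ∑ β, Uop (pd α (pd γ (K γ β))) (fun y => f y β) x := by
    have := pd_sum Finset.univ (F := fun γ => pd γ (fun z => usol n lam mu f z γ)) (fun _ => 1) (x := x)
      (fun γ _ => ((pd_smooth hS (usol_smooth h lam mu hf γ) γ).contDiffAt (hS.mem_nhds hx)).differentiableAt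
        (by simp)) α
    simp only [one_mul] at this
    rw [this]
    exact Finset.sum_congr rfl fun γ _ => usol_ipd h lam mu hf γ [α, γ] hx
  simp only [e1, e2]
  have s1 : ∑ s, ∑ β, Uop (pd s (pd s (K α β))) (fun y => f y β) x =
    ∑ β, ∑ s, Uop (pd s (pd s (K α β))) (fun y => f y β) x := Finset.sum_comm
  have s2 : ∑ γ, ∑ β, Uop (pd α (pd γ (K γ β))) (fun y => f y β) x =
    ∑ β, ∑ γ, Uop (pd α (pd γ (K γ β))) (fun y => f y β) x := Finset.sum_comm
  rw [s1, s2, Finset.mul_sum, Finset.mul_sum, ← Finset.sum_add_distrib]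
  refine Finset.sum_eq_zero fun β _ => ?_
  have k : ∀ a b γ, IsKer ((n - 1 + 2 : ℕ) : ℤ) (pd a (pd b (K γ β))) := fun a b γ => by
    have := ((KK_ker h N (cc1 n lam mu) (cc2 n lam mu) γ β).pd b).pd a
    convert this using 1
    push_cast; ring
  have e3 := Uop_sum h (by omega : n - 1 ≤ n - 1 + 2) (Finset.univ : Finset (Fin n ⊕ Fin n))
    (F := Sum.elim (fun s => pd s (pd s (K α β))) (fun γ => pd α (pd γ (K γ β))))
    (Sum.elim (fun _ => mu) (fun _ => lam + mu)) (by rintro (s | s) <;> exact k _ _ _) (hf β) hx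
  rw [U_congr h (L := fun _ => 0) (fun X hX => ?_) _ hx, Uop_zero] at e3
  · rw [Fintype.sum_sum_type] at e3
    simp only [Sum.elim_inl, Sum.elim_inr, ← Finset.mul_sum] at e3
    exact e3.symm
  · rw [Fintype.sum_sum_type]
    simp only [Sum.elim_inl, Sum.elim_inr, ← Finset.mul_sum]
    exact pde_KK' h N (cc_rel n lam mu) α β hX

lemma Lp_sum_le {m : ℕ} {p : ℝ} (hp : 1 < p) {ι : Type*} (s : Finset ι)
    {F : ι → EuclideanSpace ℝ (Fin m) → ℝ≥0∞} (hF : ∀ i, Measurable (F i)) :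
    (∫⁻ x, (∑ i ∈ s, F i x) ^ p) ^ (1 / p) ≤ ∑ i ∈ s, (∫⁻ x, (F i x) ^ p) ^ (1 / p) := by
  classical
  induction s using Finset.induction_on with
  | empty =>
    have : 0 < p := by linarith
    simp [this]
  | insert a s ha ih =>
    simp only [Finset.sum_insert ha]
    refine (ENNReal.lintegral_Lp_add_le (hF a).aemeasurable
      (Finset.measurable_sum s fun i _ => hF i).aemeasurable hp.le).trans ?_
    gcongr

lemma enorm_le_sum (v : EuclideanSpace ℝ (Fin n)) : ‖v‖ₑ ≤ ∑ α, ‖v α‖ₑ := by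
  have : v = ∑ α, v α • EuclideanSpace.single α (1 : ℝ) := by
    ext i; simp [Pi.single_apply]
  conv_lhs => rw [this]
  refine (enorm_sum_le _ _).trans (Finset.sum_le_sum fun α _ => ?_)
  rw [enorm_smul]
  have : ‖EuclideanSpace.single α (1 : ℝ)‖ₑ = 1 := by
    rw [← ofReal_norm]; simp
  rw [this, mul_one]

lemma eLpNorm_rel {m : ℕ} {F : Type*} [NormedAddCommGroup F] {p : ℝ} (hp : 1 < p)
    (g : EuclideanSpace ℝ (Fin m) → F) :
    eLpNorm g (ENNReal.ofReal p) volume = (∫⁻ x, ‖g x‖ₑ ^ p) ^ (1 / p) := by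
  have hp0 : 0 < p := by linarith
  rw [eLpNorm_eq_lintegral_rpow_enorm_toReal (by simpa using hp0) (by simp), ENNReal.toReal_ofReal hp0.le]

lemma comp_memLp {m : ℕ} {p : ℝ} {g : EuclideanSpace ℝ (Fin m) → EuclideanSpace ℝ (Fin n)}
    (hg : MemLp g (ENNReal.ofReal p) volume) (β : Fin n) :
    MemLp (fun y => g y β) (ENNReal.ofReal p) volume :=
  (EuclideanSpace.proj β : EuclideanSpace ℝ (Fin n) →L[ℝ] ℝ).comp_memLp' hg

lemma usol_est (hn : 2 ≤ n) {lam mu : ℝ} (hmu : 0 < mu) (hlam : 0 < 2 * mu + lam)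
    {p : ℝ} (hp : 1 < p) (ℓ : ℕ) {κ : ℝ} (hκ : 0 < κ) (k : ℕ) (hk : k ≤ ℓ) (dd : Fin k → Fin n) :
    ∃ C : ℝ≥0, ∀ (f : EuclideanSpace ℝ (Fin (n - 1)) → EuclideanSpace ℝ (Fin n))
        (g : (k : ℕ) → (Fin k → Fin (n - 1)) →
          EuclideanSpace ℝ (Fin (n - 1)) → EuclideanSpace ℝ (Fin n)),
        MemLp f (ENNReal.ofReal p) volume →
        (∀ k : ℕ, k ≤ ℓ → ∀ d' : Fin k → Fin (n - 1),
          MemLp (g k d') (ENNReal.ofReal p) volume ∧ IsWeakDeriv k d' f (g k d')) →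
        (∫⁻ x' : EuclideanSpace ℝ (Fin (n - 1)), (ntMax κ (mpd k dd (usol n lam mu f)) x') ^ p)
              ^ (1 / p) ≤ C * ∑ d' : Fin k → Fin (n - 1), eLpNorm (g k d') (ENNReal.ofReal p) volume := by
  have h : 0 < n := by omega
  have hp0 : 0 < p := by linarith
  have hR := fun α β => red_KK hn hp hκ h hmu hlam (cc_rel n lam mu) k (List.ofFn dd) (by simp) α β
  choose ι hι d B hB hF using hR
  choose CB hCB using fun α β i => (hB α β i).2
  refine ⟨∑ α, ∑ β, ∑ i, (CB α β i) ^ (1 / p), fun f g hf hg => ?_⟩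
  have hfW : ∀ β, Wt (fun y => f y β) := fun β => Wt_of_memLp hn hp (comp_memLp hf β)
  -- representation
  have rep : ∀ α, ∀ x ∈ upperHalfSpace n, ipd (List.ofFn dd) (fun y => usol n lam mu f y α) x =
      ∑ β, ∑ i, Uop (B α β i) (fun y => g k (d α β i) y β) x := by
    intro α x hx
    rw [usol_ipd h lam mu hfW α _ hx]
    refine Finset.sum_congr rfl fun β _ => ?_
    rw [U_congr h (hF α β) _ hx]
    have := Uop_sum h (by omega : n - 1 ≤ n - 1 + k) Finset.univ
      (F := fun i => ipd (List.ofFn fun a => finUp (d α β i a)) (B α β i)) (fun _ => 1)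
      (fun i => by simpa using (hB α β i).1.ipd (List.ofFn fun a => finUp (d α β i a))) (hfW β) hx
    simp only [one_mul] at this
    rw [this]
    refine Finset.sum_congr rfl fun i _ => ?_
    exact ibp_k hn hp ℓ (fun y => f y β) (fun k d y => g k d y β) (comp_memLp hf β)
      (fun k hk d => ⟨comp_memLp (hg k hk d).1 β, swd_of hp hf (hg k hk d).1 (hg k hk d).2 β⟩) k hk
      (d α β i) le_rfl (hB α β i).1 hx
  have hcomp : ∀ x ∈ upperHalfSpace n, ∀ α, (mpd k dd (usol n lam mu f) x) α =
      ipd (List.ofFn dd) (fun y => usol n lam mu f y α) x := by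
    intro x hx α
    rw [← mpd_ipd (isOpen_up h) (usol_smooth h lam mu hfW α) k dd x hx]
    have hu : ContDiffAt ℝ (⊤ : ℕ∞) (usol n lam mu f) x :=
      (contDiffOn_euclidean.2 (usol_smooth h lam mu hfW)).contDiffAt ((isOpen_up h).mem_nhds hx)
    have := (EuclideanSpace.proj α : EuclideanSpace ℝ (Fin n) →L[ℝ] ℝ).iteratedFDeriv_comp_left hu
      (i := k) (by exact_mod_cast le_top)
    have e : (fun y => usol n lam mu f y α) =
      (EuclideanSpace.proj α : EuclideanSpace ℝ (Fin n) →L[ℝ] ℝ) ∘ usol n lam mu f := rfl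
    rw [mpd, mpd, e, this]; rfl
  have hle : ∀ x, ntMax κ (mpd k dd (usol n lam mu f)) x ≤
      ∑ q : (Σ α : Fin n, Σ β : Fin n, ι α β), ntMax κ (Uop (B q.1 q.2.1 q.2.2)
        (fun y => g k (d q.1 q.2.1 q.2.2) y q.2.1)) x := by
    intro x
    refine ntMax_le fun y t ht hd => ?_
    refine (enorm_le_sum _).trans ?_
    rw [Fintype.sum_sigma]
    refine Finset.sum_le_sum fun α _ => ?_
    rw [hcomp _ (toUp_mem h y ht), rep α _ (toUp_mem h y ht), Fintype.sum_sigma]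
    refine (enorm_sum_le _ _).trans (Finset.sum_le_sum fun β _ => ?_)
    refine (enorm_sum_le _ _).trans (Finset.sum_le_sum fun i _ => ?_)
    exact le_ntMax ht hd
  calc _ ≤ (∫⁻ x, (∑ q : (Σ α : Fin n, Σ β : Fin n, ι α β), ntMax κ (Uop (B q.1 q.2.1 q.2.2)
        (fun y => g k (d q.1 q.2.1 q.2.2) y q.2.1)) x) ^ p) ^ (1 / p) := by
          gcongr with x
          exact hle x
    _ ≤ _ := Lp_sum_le hp _ fun q => ntMax_meas κ _
    _ ≤ ∑ q : (Σ α : Fin n, Σ β : Fin n, ι α β), ((CB q.1 q.2.1 q.2.2) ^ (1 / p) : ℝ≥0) *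
        ∑ d' : Fin k → Fin (n - 1), eLpNorm (g k d') (ENNReal.ofReal p) volume := by
        refine Finset.sum_le_sum fun q _ => ?_
        have h1 := hCB q.1 q.2.1 q.2.2 _ (comp_memLp (hg k hk (d q.1 q.2.1 q.2.2)).1 q.2.1)
        have h2 : (∫⁻ x, ‖g k (d q.1 q.2.1 q.2.2) x q.2.1‖ₑ ^ p) ^ (1 / p) ≤
            ∑ d' : Fin k → Fin (n - 1), eLpNorm (g k d') (ENNReal.ofReal p) volume := by
          refine le_trans ?_ (Finset.single_le_sum (f := fun d' => eLpNorm (g k d') (ENNReal.ofReal p) volume)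
            (fun _ _ => zero_le) (Finset.mem_univ (d q.1 q.2.1 q.2.2)))
          rw [eLpNorm_rel hp]
          gcongr with x
          exact enorm_le_iff_norm_le.2 (PiLp.norm_apply_le _ _)
        refine (ENNReal.rpow_le_rpow h1 (by positivity)).trans ?_
        rw [ENNReal.mul_rpow_of_nonneg _ _ (by positivity), ENNReal.coe_rpow_of_nonneg _ (by positivity)]
        gcongr
    _ = _ := by
        rw [← Finset.sum_mul, Fintype.sum_sigma]
        simp only [Fintype.sum_sigma]
        push_cast
        rfl

end SOL

section NRM

lemma JJ_val {m : ℕ} {s : ℝ} (hs : (m : ℝ) / 2 < s) :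
    Gamma s * ∫ z : EuclideanSpace ℝ (Fin m), (1 + ‖z‖ ^ 2) ^ (-s) = Gamma (s - m / 2) * π ^ ((m : ℝ) / 2) := by
  have hm : (0 : ℝ) ≤ (m : ℝ) / 2 := by positivity
  have hs0 : 0 < s := by linarith
  have hs1 : 0 < s - m / 2 := by linarith
  have hi1 : Integrable (fun z : EuclideanSpace ℝ (Fin m) => (1 + ‖z‖ ^ 2) ^ (-s)) := by
    have := integrable_rpow_neg_one_add_norm_sq (E := EuclideanSpace ℝ (Fin m)) (μ := volume) (r := 2 * s)
      (by rw [finrank_euclideanSpace_fin]; linarith)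
    convert this using 3; ring
  have hg : ∀ a r : ℝ, 0 < a → 0 < r → IntegrableOn (fun t : ℝ => t ^ (a - 1) * rexp (-(r * t))) (Set.Ioi 0) := by
    intro a r ha hr
    refine Integrable.of_integral_ne_zero ?_
    rw [integral_rpow_mul_exp_neg_mul_Ioi ha hr]
    have := Gamma_pos_of_pos ha
    positivity
  have e1 : ENNReal.ofReal (Gamma s * ∫ z : EuclideanSpace ℝ (Fin m), (1 + ‖z‖ ^ 2) ^ (-s)) =
      ∫⁻ z : EuclideanSpace ℝ (Fin m), ∫⁻ t in Set.Ioi (0 : ℝ),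
        ENNReal.ofReal (t ^ (s - 1) * rexp (-((1 + ‖z‖ ^ 2) * t))) := by
    rw [← integral_const_mul, ofReal_integral_eq_lintegral_ofReal (hi1.const_mul _)
      (Eventually.of_forall fun z => by have := Gamma_pos_of_pos hs0; positivity)]
    congr 1; ext z
    have hr : (0 : ℝ) < 1 + ‖z‖ ^ 2 := by positivity
    rw [← ofReal_integral_eq_lintegral_ofReal (hg s _ hs0 hr)
      ((ae_restrict_iff' measurableSet_Ioi).2 (Eventually.of_forall fun t (ht : 0 < t) => by positivity)),
      integral_rpow_mul_exp_neg_mul_Ioi hs0 hr, one_div, inv_rpow hr.le, rpow_neg hr.le, mul_comm]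
  have e2 : ENNReal.ofReal (Gamma (s - m / 2) * π ^ ((m : ℝ) / 2)) =
      ∫⁻ t in Set.Ioi (0 : ℝ), ∫⁻ z : EuclideanSpace ℝ (Fin m),
        ENNReal.ofReal (t ^ (s - 1) * rexp (-((1 + ‖z‖ ^ 2) * t))) := by
    have h1 := integral_rpow_mul_exp_neg_mul_Ioi hs1 one_pos
    rw [div_one, one_rpow, one_mul] at h1
    rw [← h1, mul_comm, ← integral_const_mul, ofReal_integral_eq_lintegral_ofReal ((hg _ 1 hs1 one_pos).const_mul _)
      ((ae_restrict_iff' measurableSet_Ioi).2 (Eventually.of_forall fun t (ht : 0 < t) => by positivity))]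
    refine setLIntegral_congr_fun measurableSet_Ioi fun t (ht : 0 < t) => ?_
    have h2 := GaussianFourier.integral_rexp_neg_mul_sq_norm (V := EuclideanSpace ℝ (Fin m)) ht
    rw [finrank_euclideanSpace_fin] at h2
    have h3 : Integrable (fun v : EuclideanSpace ℝ (Fin m) => rexp (-t * ‖v‖ ^ 2)) := by
      refine Integrable.of_integral_ne_zero ?_
      rw [h2]; positivity
    have h4 : ∀ z : EuclideanSpace ℝ (Fin m), t ^ (s - 1) * rexp (-((1 + ‖z‖ ^ 2) * t)) =
        t ^ (s - 1) * rexp (-t) * rexp (-t * ‖z‖ ^ 2) := by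
      intro z; rw [mul_assoc, ← Real.exp_add]; congr 2; ring
    simp only [h4]
    rw [← ofReal_integral_eq_lintegral_ofReal (h3.const_mul _)
      (Eventually.of_forall fun z => by positivity), integral_const_mul, h2, div_rpow pi_pos.le ht.le,
      show s - m / 2 - 1 = (s - 1) - m / 2 by ring, rpow_sub ht]
    congr 1
    rw [one_mul]; ring
  have e3 : Gamma s * ∫ z : EuclideanSpace ℝ (Fin m), (1 + ‖z‖ ^ 2) ^ (-s) =
      (ENNReal.ofReal (Gamma s * ∫ z : EuclideanSpace ℝ (Fin m), (1 + ‖z‖ ^ 2) ^ (-s))).toReal := by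
    rw [ENNReal.toReal_ofReal]
    have := Gamma_pos_of_pos hs0
    exact mul_nonneg this.le (integral_nonneg fun z => by positivity)
  rw [e3, e1, lintegral_lintegral_swap, ← e2, ENNReal.toReal_ofReal]
  · have := Gamma_pos_of_pos hs1
    positivity
  · refine Measurable.aemeasurable ?_
    simp only [Function.uncurry_def]
    fun_prop

variable {n : ℕ}

lemma sphere_eq (hn : 2 ≤ n) : sphereArea n = 2 * π ^ ((n : ℝ) / 2) / Gamma (n / 2) := by
  have : Nonempty (Fin n) := ⟨⟨0, by omega⟩⟩
  have hn0 : (0 : ℝ) < n := by exact_mod_cast (by omega : 0 < n)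
  rw [sphereArea, EuclideanSpace.volume_ball]
  have hG := Gamma_pos_of_pos (show (0 : ℝ) < n / 2 by positivity)
  rw [Fintype.card_fin, ENNReal.ofReal_one, one_pow, one_mul, ENNReal.toReal_ofReal (by
    have := Gamma_pos_of_pos (show (0 : ℝ) < n / 2 + 1 by positivity)
    positivity), Gamma_add_one (by positivity), sqrt_eq_rpow, ← rpow_natCast, ← rpow_mul pi_pos.le]
  rw [show 1 / 2 * (n : ℝ) = n / 2 by ring]
  field_simp

lemma sphere_pos (hn : 2 ≤ n) : 0 < sphereArea n := by
  have hn0 : (0 : ℝ) < n := by exact_mod_cast (by omega : 0 < n)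
  rw [sphere_eq hn]
  have hG := Gamma_pos_of_pos (show (0 : ℝ) < n / 2 by positivity)
  positivity

lemma JA (hn : 2 ≤ n) : ∫ z : EuclideanSpace ℝ (Fin (n - 1)), (1 + ‖z‖ ^ 2) ^ (-(n : ℝ) / 2) = sphereArea n / 2 := by
  have hn0 : (0 : ℝ) < n := by exact_mod_cast (by omega : 0 < n)
  have hc : ((n - 1 : ℕ) : ℝ) = n - 1 := by push_cast [Nat.cast_sub (show 1 ≤ n by omega)]; ring
  have h := JJ_val (m := n - 1) (s := n / 2) (by rw [hc]; linarith)
  have hG := Gamma_pos_of_pos (show (0 : ℝ) < n / 2 by positivity)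
  rw [hc, show (n : ℝ) / 2 - (n - 1) / 2 = 1 / 2 by ring, Gamma_one_half_eq, sqrt_eq_rpow, ← rpow_add pi_pos,
    show (1 : ℝ) / 2 + (n - 1) / 2 = n / 2 by ring] at h
  rw [sphere_eq hn, neg_div]
  field_simp
  rw [← h]; ring

lemma JB (hn : 2 ≤ n) : ∫ z : EuclideanSpace ℝ (Fin (n - 1)), (1 + ‖z‖ ^ 2) ^ (-((n : ℝ) + 2) / 2)
    = sphereArea n / (2 * n) := by
  have hn0 : (0 : ℝ) < n := by exact_mod_cast (by omega : 0 < n)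
  have hc : ((n - 1 : ℕ) : ℝ) = n - 1 := by push_cast [Nat.cast_sub (show 1 ≤ n by omega)]; ring
  have h := JJ_val (m := n - 1) (s := n / 2 + 1) (by rw [hc]; linarith)
  have hG := Gamma_pos_of_pos (show (0 : ℝ) < n / 2 by positivity)
  rw [hc, show (n : ℝ) / 2 + 1 - (n - 1) / 2 = 1 / 2 + 1 by ring, Gamma_add_one (by norm_num : (1 / 2 : ℝ) ≠ 0),
    Gamma_add_one (by positivity : (n : ℝ) / 2 ≠ 0), Gamma_one_half_eq, sqrt_eq_rpow, mul_assoc (1 / 2 : ℝ), ← rpow_add pi_pos,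
    show (1 : ℝ) / 2 + (n - 1) / 2 = n / 2 by ring] at h
  rw [sphere_eq hn, show -((n : ℝ) + 2) / 2 = -(n / 2 + 1) by ring]
  field_simp at h ⊢
  linarith

/-- weight -/
def qq (n : ℕ) (z : EuclideanSpace ℝ (Fin (n - 1))) : ℝ := (1 + ‖z‖ ^ 2) ^ (-((n : ℝ) + 2) / 2)

/-- second moments -/
def MM (n : ℕ) (α β : Fin n) : ℝ :=
  ∫ z : EuclideanSpace ℝ (Fin (n - 1)), toUp z 1 α * toUp z 1 β * qq n z

lemma toUp_c1 (α : Fin n) : Continuous (fun z : EuclideanSpace ℝ (Fin (n - 1)) => toUp z 1 α) := by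
  have h := toUp_cont (n := n)
  have : Continuous (fun z : EuclideanSpace ℝ (Fin (n - 1)) => toUp z (1 : ℝ)) :=
    h.comp (by fun_prop : Continuous fun z : EuclideanSpace ℝ (Fin (n - 1)) => (z, (1 : ℝ)))
  exact (EuclideanSpace.proj (𝕜 := ℝ) α).continuous.comp this

lemma qq_sq (z : EuclideanSpace ℝ (Fin (n - 1))) : (1 + ‖z‖ ^ 2) * qq n z = (1 + ‖z‖ ^ 2) ^ (-(n : ℝ) / 2) := by
  have h : (0 : ℝ) < 1 + ‖z‖ ^ 2 := by positivity
  rw [qq, mul_comm, ← rpow_add_one h.ne']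
  congr 1; ring

lemma JA_int (hn : 2 ≤ n) : Integrable (fun z : EuclideanSpace ℝ (Fin (n - 1)) => (1 + ‖z‖ ^ 2) ^ (-(n : ℝ) / 2)) := by
  have hc : ((n - 1 : ℕ) : ℝ) = n - 1 := by push_cast [Nat.cast_sub (show 1 ≤ n by omega)]; ring
  exact integrable_rpow_neg_one_add_norm_sq (by rw [finrank_euclideanSpace_fin, hc]; linarith)

lemma MM_int (hn : 2 ≤ n) (α β : Fin n) :
    Integrable (fun z : EuclideanSpace ℝ (Fin (n - 1)) => toUp z 1 α * toUp z 1 β * qq n z) := by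
  refine (JA_int hn).mono' ?_ (Eventually.of_forall fun z => ?_)
  · refine Measurable.aestronglyMeasurable ?_
    have h1 := (toUp_c1 α).measurable
    have h2 := (toUp_c1 β).measurable
    unfold qq
    fun_prop
  · have h0 : 0 ≤ qq n z := by unfold qq; positivity
    rw [← qq_sq, norm_mul, norm_mul, Real.norm_of_nonneg h0]
    gcongr
    have h1 := PiLp.norm_apply_le (toUp z 1) α
    have h2 := PiLp.norm_apply_le (toUp z 1) β
    have h3 := norm_toUp_sq (by omega : 0 < n) z 1
    calc _ ≤ ‖toUp z 1‖ * ‖toUp z 1‖ := by gcongr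
      _ = _ := by rw [← sq, h3]; ring

lemma iso_int (L : EuclideanSpace ℝ (Fin (n - 1)) ≃ₗᵢ[ℝ] EuclideanSpace ℝ (Fin (n - 1)))
    (F : EuclideanSpace ℝ (Fin (n - 1)) → ℝ) : ∫ z, F (L z) = ∫ z, F z :=
  L.measurePreserving.integral_comp L.toHomeomorph.measurableEmbedding F

lemma MM_off (h : 0 < n) (j : Fin (n - 1)) (β : Fin n) (hb : finUp j ≠ β) : MM n (finUp j) β = 0 := by
  let L : EuclideanSpace ℝ (Fin (n - 1)) ≃ₗᵢ[ℝ] EuclideanSpace ℝ (Fin (n - 1)) :=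
    LinearIsometryEquiv.piLpCongrRight 2 (fun i => if i = j then LinearIsometryEquiv.neg ℝ
      else LinearIsometryEquiv.refl ℝ ℝ)
  have hL : ∀ z i, L z i = if i = j then - z i else z i := by
    intro z i
    simp only [L, LinearIsometryEquiv.piLpCongrRight_apply]
    split_ifs with h <;> simp [h]
  have h1 := iso_int L (fun z => toUp z 1 (finUp j) * toUp z 1 β * qq n z)
  have h2 : ∀ z, toUp (L z) 1 (finUp j) * toUp (L z) 1 β * qq n (L z) = -(toUp z 1 (finUp j) * toUp z 1 β * qq n z) := by
    intro z
    have e1 : qq n (L z) = qq n z := by simp only [qq, LinearIsometryEquiv.norm_map]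
    have e2 : toUp (L z) 1 β = toUp z 1 β := by
      rcases idx_cases h β with rfl | ⟨i, rfl⟩
      · rw [toUp_last h, toUp_last h]
      · rw [toUp_finUp, toUp_finUp, hL, if_neg]
        rintro rfl; exact hb rfl
    rw [e1, e2, toUp_finUp, toUp_finUp, hL, if_pos rfl]; ring
  simp only [h2, integral_neg] at h1
  rw [MM]; linarith

lemma MM_swap (i j : Fin (n - 1)) : MM n (finUp i) (finUp i) = MM n (finUp j) (finUp j) := by
  let L : EuclideanSpace ℝ (Fin (n - 1)) ≃ₗᵢ[ℝ] EuclideanSpace ℝ (Fin (n - 1)) :=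
    LinearIsometryEquiv.piLpCongrLeft 2 ℝ ℝ (Equiv.swap i j)
  have hL : ∀ z, L z j = z i := by
    intro z
    simp [L, LinearIsometryEquiv.piLpCongrLeft_apply, Equiv.piCongrLeft']
  have h1 := iso_int L (fun z => toUp z 1 (finUp j) * toUp z 1 (finUp j) * qq n z)
  have e1 : ∀ z, qq n (L z) = qq n z := fun z => by simp only [qq, LinearIsometryEquiv.norm_map]
  simp only [toUp_finUp, hL, e1] at h1
  simpa only [MM, toUp_finUp] using h1

lemma MM_tr (hn : 2 ≤ n) : ∑ α, MM n α α = sphereArea n / 2 := by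
  have h : 0 < n := by omega
  rw [← JA hn]
  simp only [MM]
  rw [← integral_finset_sum _ (fun α _ => MM_int hn α α)]
  congr 1; ext z
  rw [← Finset.sum_mul, ← qq_sq]
  congr 1
  have h3 := norm_toUp_sq h z 1
  rw [EuclideanSpace.norm_sq_eq] at h3
  simp only [norm_eq_abs, sq_abs] at h3
  simp only [← sq]
  rw [h3]; ring

lemma MM_val (hn : 2 ≤ n) (α β : Fin n) : MM n α β = dl α β * (sphereArea n / (2 * n)) := by
  have h : 0 < n := by omega
  have hN : MM n (lastIdx n h) (lastIdx n h) = sphereArea n / (2 * n) := by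
    rw [← JB hn, MM]
    simp only [toUp_last h]
    simp only [one_mul, qq]
  by_cases hab : α = β
  · subst hab
    rw [dl, if_pos rfl, one_mul]
    rcases idx_cases h α with rfl | ⟨i, rfl⟩
    · exact hN
    · have ht := MM_tr hn
      rw [sum_idx h, hN] at ht
      simp only [fun j => MM_swap j i] at ht
      rw [Finset.sum_const, Finset.card_univ, Fintype.card_fin, nsmul_eq_mul,
        Nat.cast_sub (show 1 ≤ n by omega)] at ht
      have h2 : (2 : ℝ) ≤ n := by exact_mod_cast hn
      have h3 : (n : ℝ) - 1 ≠ 0 := by linarith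
      have : ((n : ℝ) - 1) * MM n (finUp i) (finUp i) = (n - 1) * (sphereArea n / (2 * n)) := by
        push_cast at ht
        have : sphereArea n / 2 = n * (sphereArea n / (2 * n)) := by field_simp
        linarith
      exact mul_left_cancel₀ h3 this
  · rw [dl, if_neg hab, zero_mul]
    rcases idx_cases h α with rfl | ⟨i, rfl⟩
    · rcases idx_cases h β with rfl | ⟨i, rfl⟩
      · exact absurd rfl hab
      · rw [← MM_off h i _ (Ne.symm hab), MM, MM]
        congr 1; ext z; ring
    · exact MM_off h i _ hab

lemma KK_one (hn : 2 ≤ n) {lam mu : ℝ} (hmu : 0 < mu) (hlam : 0 < 2 * mu + lam) (α β : Fin n) :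
    ∫ z : EuclideanSpace ℝ (Fin (n - 1)), KK (lastIdx n (by omega)) (cc1 n lam mu) (cc2 n lam mu) α β (toUp z 1)
      = dl α β := by
  have h : 0 < n := by omega
  have e : ∀ z : EuclideanSpace ℝ (Fin (n - 1)),
      KK (lastIdx n h) (cc1 n lam mu) (cc2 n lam mu) α β (toUp z 1) =
      cc1 n lam mu * dl α β * (1 + ‖z‖ ^ 2) ^ (-(n : ℝ) / 2)
        + cc2 n lam mu * (toUp z 1 α * toUp z 1 β * qq n z) := by
    intro z
    rw [KK, HH, toUp_last h, one_mul, rho, rho, norm_toUp_sq h, one_pow, add_comm (‖z‖ ^ 2), qq]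
  simp only [e]
  rw [integral_add ((JA_int hn).const_mul _) ((MM_int hn α β).const_mul _), integral_const_mul,
    integral_const_mul, JA hn, ← MM, MM_val hn, cc1, cc2]
  have h1 := sphere_pos hn
  have h2 : 3 * mu + lam ≠ 0 := by linarith
  have h3 : (n : ℝ) ≠ 0 := by exact_mod_cast h.ne'
  have h4 : 4 * mu / (3 * mu + lam) * (1 / sphereArea n) * dl α β * (sphereArea n / 2) +
      (mu + lam) / (3 * mu + lam) * (2 * n / sphereArea n) * (dl α β * (sphereArea n / (2 * n))) =
      dl α β * ((3 * mu + lam) / (3 * mu + lam)) := by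
    field_simp; ring
  rw [h4, div_self h2, mul_one]

lemma KK_norm (hn : 2 ≤ n) {lam mu : ℝ} (hmu : 0 < mu) (hlam : 0 < 2 * mu + lam) (α β : Fin n)
    (y : EuclideanSpace ℝ (Fin (n - 1))) {t : ℝ} (ht : 0 < t) :
    ∫ z : EuclideanSpace ℝ (Fin (n - 1)), KK (lastIdx n (by omega)) (cc1 n lam mu) (cc2 n lam mu) α β (toUp (y - z) t)
      = dl α β := by
  have h : 0 < n := by omega
  set K := KK (lastIdx n h) (cc1 n lam mu) (cc2 n lam mu) α β with hK
  have hk : IsKer ((n - 1 : ℕ) : ℤ) K := KK_ker h _ _ _ _ _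
  rw [integral_sub_left_eq_self (fun z => K (toUp z t)) volume y]
  have e : ∀ z : EuclideanSpace ℝ (Fin (n - 1)), K (toUp z t) = (t ^ (n - 1))⁻¹ * K (toUp (t⁻¹ • z) 1) := by
    intro z
    have hne : toUp (t⁻¹ • z) 1 ≠ 0 := by
      have := le_norm_toUp' h (t⁻¹ • z) 1
      exact norm_pos_iff.1 (by linarith)
    have := hk.hom t (toUp (t⁻¹ • z) 1) ht hne
    rw [← toUp_smul, smul_smul, mul_inv_cancel₀ ht.ne', one_smul, mul_one, zpow_neg, zpow_natCast] at this
    exact this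
  simp only [e]
  rw [integral_const_mul, Measure.integral_comp_inv_smul volume (fun z => K (toUp z 1)) t, finrank_euclideanSpace_fin,
    hK, KK_one hn hmu hlam, abs_of_pos (by positivity), smul_eq_mul, ← mul_assoc,
    inv_mul_cancel₀ (by positivity), one_mul]

end NRM

section NTL
variable {n : ℕ}

lemma KK_int (hn : 2 ≤ n) (lam mu : ℝ) (α β : Fin n)
    (y : EuclideanSpace ℝ (Fin (n - 1))) {t : ℝ} (ht : 0 < t) :
    Integrable (fun z : EuclideanSpace ℝ (Fin (n - 1)) =>
      KK (lastIdx n (by omega)) (cc1 n lam mu) (cc2 n lam mu) α β (toUp (y - z) t)) := by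
  have h : 0 < n := by omega
  set K := KK (lastIdx n h) (cc1 n lam mu) (cc2 n lam mu) α β with hK
  have hk : IsKer ((n - 1 : ℕ) : ℤ) K := KK_ker h _ _ _ _ _
  have h1 : Integrable (fun z : EuclideanSpace ℝ (Fin (n - 1)) => K (toUp z 1)) := by
    have e : ∀ z : EuclideanSpace ℝ (Fin (n - 1)), K (toUp z 1) =
        cc1 n lam mu * dl α β * (1 + ‖z‖ ^ 2) ^ (-(n : ℝ) / 2)
        + cc2 n lam mu * (toUp z 1 α * toUp z 1 β * qq n z) := by
      intro z
      rw [hK, KK, HH, toUp_last h, one_mul, rho, rho, norm_toUp_sq h, one_pow, add_comm (‖z‖ ^ 2), qq]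
    simp only [e]
    exact ((JA_int hn).const_mul _).add ((MM_int hn α β).const_mul _)
  have e : ∀ z : EuclideanSpace ℝ (Fin (n - 1)), K (toUp z t) = (t ^ (n - 1))⁻¹ * K (toUp (t⁻¹ • z) 1) := by
    intro z
    have hne : toUp (t⁻¹ • z) 1 ≠ 0 := by
      have := le_norm_toUp' h (t⁻¹ • z) 1
      exact norm_pos_iff.1 (by linarith)
    have := hk.hom t (toUp (t⁻¹ • z) 1) ht hne
    rw [← toUp_smul, smul_smul, mul_inv_cancel₀ ht.ne', one_smul, mul_one, zpow_neg, zpow_natCast] at this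
    exact this
  have h2 : Integrable (fun z : EuclideanSpace ℝ (Fin (n - 1)) => K (toUp z t)) := by
    simp only [e]
    exact ((integrable_comp_smul_iff volume (fun z => K (toUp z 1)) (inv_ne_zero ht.ne')).2 h1).const_mul _
  exact h2.comp_sub_left y

lemma KK_pk (hn : 2 ≤ n) (lam mu : ℝ) (α β : Fin n) {κ : ℝ} (hκ : 0 < κ) :
    ∃ D : ℝ, 0 ≤ D ∧ ∀ (x y z : EuclideanSpace ℝ (Fin (n - 1))) t, 0 < t → dist x y < κ * t →
      |KK (lastIdx n (by omega)) (cc1 n lam mu) (cc2 n lam mu) α β (toUp (y - z) t)|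
        ≤ D * pk (n - 1) t ‖x - z‖ := by
  have h0 : 0 < n := by omega
  obtain ⟨A, hA0, hA⟩ := (HH_ker (cc1 n lam mu) (cc2 n lam mu) α β).bound
  refine ⟨A * (2 + κ) ^ n, by positivity, fun x y z t ht hxy => ?_⟩
  have h1 := cone_cmp h0 hκ (z := z) ht hxy
  have h2 : 0 < t + ‖x - z‖ := by positivity
  have h3 : 0 < ‖toUp (y - z) t‖ := lt_of_lt_of_le ht (le_norm_toUp' h0 _ _)
  have h4 := hA _ (norm_pos_iff.1 h3)
  rw [KK, toUp_last h0, abs_mul, abs_of_pos ht, pk, Nat.sub_add_cancel (by omega)]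
  have h5 : ‖toUp (y - z) t‖ ^ (-(n : ℤ)) ≤ (2 + κ) ^ n * ((t + ‖x - z‖) ^ n)⁻¹ := by
    rw [zpow_neg, zpow_natCast, ← div_eq_mul_inv, inv_eq_one_div,
      div_le_div_iff₀ (by positivity) (by positivity), one_mul, ← mul_pow]
    gcongr
  calc t * |HH (cc1 n lam mu) (cc2 n lam mu) α β (toUp (y - z) t)|
      ≤ t * (A * ((2 + κ) ^ n * ((t + ‖x - z‖) ^ n)⁻¹)) := by
        gcongr
        exact h4.trans (by gcongr)
    _ = _ := by ring

lemma near_mx {m : ℕ} (w : EuclideanSpace ℝ (Fin m) → ℝ≥0∞) (x : EuclideanSpace ℝ (Fin m)) {δ : ℝ} (hδ : 0 < δ) (e : ℝ≥0∞)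
    (h : ∀ r, 0 < r → r ≤ δ → (∫⁻ y in closedBall x r, w y) / volume (closedBall x r) ≤ e) :
    mx ((closedBall x δ).indicator w) x ≤ e := by
  refine iSup₂_le fun r hr => ?_
  rw [mul_comm, ← div_eq_mul_inv]
  rcases le_total r δ with hrd | hrd
  · refine le_trans ?_ (h r hr hrd)
    gcongr
    exact Set.indicator_le_self _ _ _
  · have h1 : ∫⁻ y in closedBall x r, (closedBall x δ).indicator w y ≤ ∫⁻ y in closedBall x δ, w y := by
      rw [← lintegral_indicator measurableSet_closedBall w]
      exact setLIntegral_le_lintegral _ _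
    refine le_trans ?_ (h δ hδ le_rfl)
    exact ENNReal.div_le_div h1 (measure_mono (closedBall_subset_closedBall hrd))

lemma far_fin (hn : 2 ≤ n) {G : EuclideanSpace ℝ (Fin (n - 1)) → ℝ}
    (hG : Integrable (fun z => ((1 + ‖z‖) ^ n)⁻¹ * G z)) (x : EuclideanSpace ℝ (Fin (n - 1))) {δ : ℝ} (hδ : 0 < δ) :
    ∃ M : ℝ≥0∞, M ≠ ∞ ∧ ∀ t, 0 < t → ∫⁻ z, ENNReal.ofReal (pk (n - 1) t ‖x - z‖) *
      (closedBall x δ)ᶜ.indicator (fun z => ‖G z‖ₑ) z ≤ ENNReal.ofReal t * M := by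
  set c := (1 + ‖x‖) / δ + 1
  have hc : 0 < c := by positivity
  refine ⟨ENNReal.ofReal (c ^ n) * ∫⁻ z, ‖((1 + ‖z‖) ^ n)⁻¹ * G z‖ₑ,
    ENNReal.mul_ne_top ENNReal.ofReal_ne_top hG.2.ne, fun t ht => ?_⟩
  rw [← mul_assoc, ← ENNReal.ofReal_mul ht.le, ← lintegral_const_mul' _ _ ENNReal.ofReal_ne_top]
  refine lintegral_mono fun z => ?_
  by_cases hz : z ∈ (closedBall x δ)ᶜ
  · rw [Set.indicator_of_mem hz, enorm_mul, ← mul_assoc]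
    gcongr
    rw [Real.enorm_eq_ofReal (by positivity), ← ENNReal.ofReal_mul (by positivity)]
    apply ENNReal.ofReal_le_ofReal
    have hz' : δ < ‖x - z‖ := by
      simpa [dist_eq_norm, norm_sub_rev] using hz
    have hx0 : 0 < ‖x - z‖ := hδ.trans hz'
    have h1 : 1 + ‖z‖ ≤ c * (t + ‖x - z‖) := by
      have h2 : ‖z‖ ≤ ‖x‖ + ‖x - z‖ := by
        have := norm_sub_norm_le z x
        rw [norm_sub_rev] at this; linarith
      have h3 : 1 + ‖x‖ ≤ (1 + ‖x‖) / δ * ‖x - z‖ := by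
        rw [div_mul_eq_mul_div, le_div_iff₀ hδ]
        have := norm_nonneg x
        gcongr
      have h4 : 0 ≤ c * t := by positivity
      calc 1 + ‖z‖ ≤ c * ‖x - z‖ := by simp only [c]; linarith
        _ ≤ _ := by nlinarith
    rw [pk, Nat.sub_add_cancel (by omega), div_eq_mul_inv, mul_assoc]
    gcongr
    rw [← div_eq_mul_inv, inv_eq_one_div, div_le_div_iff₀ (by positivity) (by positivity), one_mul, ← mul_pow]
    gcongr
  · rw [Set.indicator_of_notMem hz, mul_zero]; exact zero_le

lemma leb_pt (hn : 2 ≤ n) {g : EuclideanSpace ℝ (Fin (n - 1)) → ℝ} (hg : Wt g) (hl : LocallyIntegrable g) :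
    ∀ᵐ x, Tendsto (fun t => ∫⁻ z, ENNReal.ofReal (pk (n - 1) t ‖x - z‖) * ‖g z - g x‖ₑ) (𝓝[>] 0) (𝓝 0) := by
  obtain ⟨C, hC⟩ := pk_mx (E := EuclideanSpace ℝ (Fin (n - 1)))
  rw [finrank_euclideanSpace_fin] at hC
  filter_upwards [(IsUnifLocDoublingMeasure.vitaliFamily volume 1).ae_tendsto_lintegral_enorm_sub_div hl] with x hx
  have h1 := hx.comp (IsUnifLocDoublingMeasure.tendsto_closedBall_filterAt volume (K := 1) (fun _ : ℝ => x) id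
    (l := 𝓝[>] 0) tendsto_id (by
      filter_upwards [self_mem_nhdsWithin] with r (hr : 0 < r)
      exact mem_closedBall_self (by simpa using hr.le)))
  set g' := hg.aesm.mk g
  have hgm : Measurable g' := hg.aesm.stronglyMeasurable_mk.measurable
  have hgg : g =ᵐ[volume] g' := hg.aesm.ae_eq_mk
  have hG : Integrable (fun z => ((1 + ‖z‖) ^ n)⁻¹ * (g' z - g x)) := by
    have i1 : Integrable (fun z : EuclideanSpace ℝ (Fin (n - 1)) => ((1 + ‖z‖) ^ n)⁻¹) := by
      have hc : ((n - 1 : ℕ) : ℝ) = n - 1 := by push_cast [Nat.cast_sub (show 1 ≤ n by omega)]; ring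
      have := integrable_one_add_norm (E := EuclideanSpace ℝ (Fin (n - 1))) (μ := volume) (r := n)
        (by rw [finrank_euclideanSpace_fin, hc]; linarith)
      refine this.congr (Eventually.of_forall fun z => ?_)
      show (1 + ‖z‖) ^ (-(n : ℝ)) = _
      rw [rpow_neg (by positivity), rpow_natCast]
    have i2 : Integrable (fun z => ((1 + ‖z‖) ^ n)⁻¹ * g' z) := by
      refine Integrable.mono hg (Measurable.aestronglyMeasurable (by fun_prop)) ?_
      filter_upwards [hgg] with z hz
      rw [← hz, norm_mul, norm_mul, Real.norm_of_nonneg (show 0 ≤ ((1 + ‖z‖) ^ n)⁻¹ by positivity),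
        Real.norm_of_nonneg (show 0 ≤ ((1 + ‖z‖) ^ (n - 1))⁻¹ by positivity)]
      gcongr
      · linarith [norm_nonneg z]
      · omega
    simp only [mul_sub]
    exact i2.sub (i1.mul_const _)
  have heq : ∀ t, ∫⁻ z, ENNReal.ofReal (pk (n - 1) t ‖x - z‖) * ‖g z - g x‖ₑ =
      ∫⁻ z, ENNReal.ofReal (pk (n - 1) t ‖x - z‖) * ‖g' z - g x‖ₑ := by
    intro t
    refine lintegral_congr_ae ?_
    filter_upwards [hgg] with z hz
    rw [hz]
  simp only [heq]
  rw [ENNReal.tendsto_nhds_zero] at h1 ⊢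
  intro ε hε
  have hε2 : 0 < ε / 2 := ENNReal.half_pos hε.ne'
  have hε' : 0 < ε / 2 / (C + 1 : ℝ≥0) := ENNReal.div_pos hε2.ne' ENNReal.coe_ne_top
  obtain ⟨d, hd0, hd⟩ := mem_nhdsGT_iff_exists_Ioc_subset.1 (h1 _ hε')
  have hd0 : (0 : ℝ) < d := hd0
  have hn1 := near_mx (fun z => ‖g' z - g x‖ₑ) x hd0 _ (fun r hr hrd => by
    have h2 := hd (show r ∈ Set.Ioc 0 d from ⟨hr, hrd⟩)
    refine le_trans (le_of_eq ?_) h2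
    show _ = (∫⁻ y in closedBall x r, ‖g y - g x‖ₑ) / volume (closedBall x r)
    congr 1
    refine lintegral_congr_ae (ae_restrict_of_ae ?_)
    filter_upwards [hgg] with z hz
    rw [hz])
  obtain ⟨M, hM, hfar⟩ := far_fin hn hG x hd0
  have hwm : Measurable (fun z => ‖g' z - g x‖ₑ) := by fun_prop
  have h3 : Tendsto (fun t : ℝ => ENNReal.ofReal t * M) (𝓝[>] 0) (𝓝 0) := by
    have : Tendsto (fun t : ℝ => ENNReal.ofReal t) (𝓝[>] 0) (𝓝 0) := by
      have := (ENNReal.continuous_ofReal.tendsto 0).mono_left (nhdsWithin_le_nhds (s := Set.Ioi (0 : ℝ)))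
      simpa using this
    simpa using ENNReal.Tendsto.mul_const this (Or.inr hM)
  filter_upwards [self_mem_nhdsWithin, ENNReal.tendsto_nhds_zero.1 h3 _ hε2] with t (ht : 0 < t) ht2
  calc ∫⁻ z, ENNReal.ofReal (pk (n - 1) t ‖x - z‖) * ‖g' z - g x‖ₑ
      = ∫⁻ z, (ENNReal.ofReal (pk (n - 1) t ‖x - z‖) * (closedBall x d).indicator (fun z => ‖g' z - g x‖ₑ) z +
        ENNReal.ofReal (pk (n - 1) t ‖x - z‖) * (closedBall x d)ᶜ.indicator (fun z => ‖g' z - g x‖ₑ) z) := by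
        congr 1; ext z
        rw [← mul_add, Set.indicator_self_add_compl_apply]
    _ = (∫⁻ z, ENNReal.ofReal (pk (n - 1) t ‖x - z‖) * (closedBall x d).indicator (fun z => ‖g' z - g x‖ₑ) z) +
        ∫⁻ z, ENNReal.ofReal (pk (n - 1) t ‖x - z‖) * (closedBall x d)ᶜ.indicator (fun z => ‖g' z - g x‖ₑ) z := by
        refine lintegral_add_left ?_ _
        refine Measurable.mul ?_ (hwm.indicator measurableSet_closedBall)
        unfold pk; fun_prop
    _ ≤ C * (ε / 2 / (C + 1 : ℝ≥0)) + ε / 2 := by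
        refine add_le_add ((hC _ (hwm.indicator measurableSet_closedBall) x t ht).trans ?_) ((hfar t ht).trans ht2)
        gcongr
    _ ≤ ε / 2 + ε / 2 := by
        gcongr
        refine le_trans ?_ (ENNReal.mul_div_le (a := ((C + 1 : ℝ≥0) : ℝ≥0∞)))
        gcongr
        exact le_self_add
    _ = ε := ENNReal.add_halves ε

lemma usol_nt (hn : 2 ≤ n) {lam mu : ℝ} (hmu : 0 < mu) (hlam : 0 < 2 * mu + lam) {κ : ℝ} (hκ : 0 < κ)
    {f : EuclideanSpace ℝ (Fin (n - 1)) → EuclideanSpace ℝ (Fin n)}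
    (hf : ∀ β, Wt (fun y => f y β)) (hl : ∀ β, LocallyIntegrable (fun y => f y β)) :
    ∀ᵐ x', Tendsto (fun q : (EuclideanSpace ℝ (Fin (n - 1))) × ℝ => usol n lam mu f (toUp q.1 q.2))
            (ntFilter κ x') (nhds (f x')) := by
  have h : 0 < n := by omega
  choose D hD0 hD using fun α β => KK_pk hn lam mu α β hκ
  filter_upwards [ae_all_iff.2 fun β => leb_pt hn (hf β) (hl β)] with x hx
  have hco : ∀ α, Tendsto (fun q : (EuclideanSpace ℝ (Fin (n - 1))) × ℝ => usol n lam mu f (toUp q.1 q.2) α)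
      (ntFilter κ x) (nhds (f x α)) := by
    intro α
    rw [tendsto_iff_edist_tendsto_0]
    have hsnd : Tendsto (fun q : (EuclideanSpace ℝ (Fin (n - 1))) × ℝ => q.2) (ntFilter κ x) (𝓝[>] 0) := by
      refine tendsto_nhdsWithin_iff.2 ⟨(continuous_snd.tendsto (x, (0 : ℝ))).mono_left inf_le_left, ?_⟩
      exact (mem_inf_of_right (mem_principal_self _) :
        {q : (EuclideanSpace ℝ (Fin (n - 1))) × ℝ | 0 < q.2 ∧ dist x q.1 < κ * q.2} ∈ ntFilter κ x) |> fun h =>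
          mem_of_superset h fun q hq => hq.1
    have hlim : Tendsto (fun q : (EuclideanSpace ℝ (Fin (n - 1))) × ℝ => ∑ β, ENNReal.ofReal (D α β) *
        ∫⁻ z, ENNReal.ofReal (pk (n - 1) q.2 ‖x - z‖) * ‖f z β - f x β‖ₑ) (ntFilter κ x) (𝓝 0) := by
      rw [show (0 : ℝ≥0∞) = ∑ β : Fin n, 0 by simp]
      refine tendsto_finset_sum _ fun β _ => ?_
      have := ENNReal.Tendsto.const_mul (a := ENNReal.ofReal (D α β)) ((hx β).comp hsnd) (Or.inr ENNReal.ofReal_ne_top)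
      simpa using this
    refine tendsto_of_tendsto_of_tendsto_of_le_of_le' tendsto_const_nhds hlim (Eventually.of_forall fun _ => zero_le) ?_
    have hmem : {q : (EuclideanSpace ℝ (Fin (n - 1))) × ℝ | 0 < q.2 ∧ dist x q.1 < κ * q.2} ∈ ntFilter κ x :=
      mem_inf_of_right (mem_principal_self _)
    filter_upwards [hmem] with q hq
    obtain ⟨y, t⟩ := q
    obtain ⟨ht, hxy⟩ : 0 < t ∧ dist x y < κ * t := hq
    have hup := toUp_mem h y ht
    have e1 : usol n lam mu f (toUp y t) α - f x α = ∑ β,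
        ∫ z, KK (lastIdx n h) (cc1 n lam mu) (cc2 n lam mu) α β (toUp (y - z) t) * (f z β - f x β) := by
      have e2 : ∀ β, ∫ z, KK (lastIdx n h) (cc1 n lam mu) (cc2 n lam mu) α β (toUp (y - z) t) * (f z β - f x β)
          = Uop (KK (lastIdx n h) (cc1 n lam mu) (cc2 n lam mu) α β) (fun y => f y β) (toUp y t) - dl α β * f x β := by
        intro β
        have i1 := U_intg h le_rfl (KK_ker h (lastIdx n h) (cc1 n lam mu) (cc2 n lam mu) α β) (hf β) hup
        simp only [toUp_sub0] at i1
        simp only [mul_sub, Uop, toUp_sub0]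
        rw [integral_sub i1 ((KK_int hn lam mu α β y ht).mul_const _), integral_mul_const, KK_norm hn hmu hlam α β y ht]
      simp only [e2, Finset.sum_sub_distrib]
      rw [← usol_eq h lam mu hf hup]
      congr 1
      simp [dl]
    show edist (usol n lam mu f (toUp y t) α) (f x α) ≤ _
    rw [edist_eq_enorm_sub, e1]
    refine (enorm_sum_le _ _).trans (Finset.sum_le_sum fun β _ => ?_)
    refine (enorm_int_le _ _ _ fun z => hD α β x y z t ht hxy).trans (le_of_eq ?_)
    rw [← lintegral_const_mul' _ _ ENNReal.ofReal_ne_top]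
    congr 1; ext z
    rw [ENNReal.ofReal_mul (hD0 α β), mul_assoc]
  have h1 : Tendsto (fun q : (EuclideanSpace ℝ (Fin (n - 1))) × ℝ => WithLp.ofLp (usol n lam mu f (toUp q.1 q.2)))
      (ntFilter κ x) (nhds (WithLp.ofLp (f x))) := tendsto_pi_nhds.2 hco
  exact ((PiLp.continuous_toLp 2 (fun _ : Fin n => ℝ)).tendsto _).comp h1

end NTL

/-- Well-posedness of the `ℓ`-th order regularity Dirichlet problem for
the Lamé system `μΔu + (λ+μ)∇div u = 0` in the upper half space: for boundary data
`f ∈ L^p_ℓ(ℝ^{n-1}; ℝⁿ)` (encoded by `f` together with its weak derivatives `g k d ∈ L^p`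
of orders `k ≤ ℓ`), the explicit Poisson integral `u` solves the Lamé system, attains `f`
nontangentially a.e., and obeys nontangential maximal estimates of all orders up to `ℓ`. -/
theorem statement19
    (n : ℕ) (hn : 2 ≤ n)
    (lam mu : ℝ) (hmu : 0 < mu) (hlam : 0 < 2 * mu + lam)
    (p : ℝ) (hp : 1 < p) (ℓ : ℕ) (κ : ℝ) (hκ : 0 < κ) :
    ∃ C : ℝ, 0 < C ∧
      ∀ (f : EuclideanSpace ℝ (Fin (n - 1)) → EuclideanSpace ℝ (Fin n))
        (g : (k : ℕ) → (Fin k → Fin (n - 1)) →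
          EuclideanSpace ℝ (Fin (n - 1)) → EuclideanSpace ℝ (Fin n)),
        MemLp f (ENNReal.ofReal p) volume →
        (∀ k : ℕ, k ≤ ℓ → ∀ d' : Fin k → Fin (n - 1),
          MemLp (g k d') (ENNReal.ofReal p) volume ∧ IsWeakDeriv k d' f (g k d')) →
        (let u : EuclideanSpace ℝ (Fin n) → EuclideanSpace ℝ (Fin n) := fun x =>
          (WithLp.equiv 2 (Fin n → ℝ)).symm (fun α =>
            (4 * mu / (3 * mu + lam)) * (1 / sphereArea n) *
              (∫ y' : EuclideanSpace ℝ (Fin (n - 1)),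
                xlast x * ((‖xinit x - y'‖ ^ 2 + (xlast x) ^ 2) ^ (-(n : ℝ) / 2)) * f y' α)
            + ((mu + lam) / (3 * mu + lam)) * (2 * n / sphereArea n) *
                ∑ β : Fin n, ∫ y' : EuclideanSpace ℝ (Fin (n - 1)),
                  xlast x * toUp (xinit x - y') (xlast x) α *
                    toUp (xinit x - y') (xlast x) β *
                    ((‖xinit x - y'‖ ^ 2 + (xlast x) ^ 2) ^ (-((n : ℝ) + 2) / 2)) * f y' β)
        (∀ x ∈ upperHalfSpace n, ∀ α : Fin n,
          mu * (∑ s : Fin n, pd s (pd s (fun y => u y α)) x)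
            + (lam + mu) *
                pd α (fun y => ∑ β : Fin n, pd β (fun z => u z β) y) x = 0) ∧
        (∀ᵐ x' : EuclideanSpace ℝ (Fin (n - 1)),
          Filter.Tendsto (fun q : (EuclideanSpace ℝ (Fin (n - 1))) × ℝ => u (toUp q.1 q.2))
            (ntFilter κ x') (nhds (f x'))) ∧
        (∀ k : ℕ, k ≤ ℓ → ∀ dd : Fin k → Fin n,
          ∫⁻ x' : EuclideanSpace ℝ (Fin (n - 1)), (ntMax κ (mpd k dd u) x') ^ p < ∞) ∧
        (∑ k ∈ Finset.range (ℓ + 1), ∑ dd : Fin k → Fin n,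
            (∫⁻ x' : EuclideanSpace ℝ (Fin (n - 1)), (ntMax κ (mpd k dd u) x') ^ p)
              ^ (1 / p))
          ≤ ENNReal.ofReal C *
            (eLpNorm f (ENNReal.ofReal p) volume +
              ∑ k ∈ Finset.range (ℓ + 1), ∑ d' : Fin k → Fin (n - 1),
                eLpNorm (g k d') (ENNReal.ofReal p) volume)) := by
  have h0 : 0 < n := by omega
  choose! C hC using fun k hk dd => usol_est hn hmu hlam hp ℓ hκ k hk dd
  let C0 : ℝ≥0 := ∑ k ∈ Finset.range (ℓ + 1), ∑ dd : Fin k → Fin n, C k dd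
  refine ⟨C0 + 1, by positivity, fun f g hf hg => ?_⟩
  have hW : ∀ β, Wt (fun y => f y β) := fun β => Wt_of_memLp hn hp (comp_memLp hf β)
  have hL : ∀ β, LocallyIntegrable (fun y => f y β) := fun β =>
    (comp_memLp hf β).locallyIntegrable (by simpa using hp.le)
  intro u
  change (∀ x ∈ upperHalfSpace n, ∀ α : Fin n,
          mu * (∑ s : Fin n, pd s (pd s (fun y => usol n lam mu f y α)) x)
            + (lam + mu) *
                pd α (fun y => ∑ β : Fin n, pd β (fun z => usol n lam mu f z β) y) x = 0) ∧ _
  refine ⟨fun x hx α => usol_pde h0 lam mu hW α hx, usol_nt hn hmu hlam hκ hW hL, fun k hk dd => ?_, ?_⟩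
  · have h1 := hC k hk dd f g hf hg
    have h2 : (C k dd : ℝ≥0∞) * ∑ d', eLpNorm (g k d') (ENNReal.ofReal p) volume < ∞ :=
      ENNReal.mul_lt_top ENNReal.coe_lt_top (ENNReal.sum_lt_top.2 fun d' _ => (hg k hk d').1.2)
    have h3 := h1.trans_lt h2
    exact (ENNReal.rpow_lt_top_iff_of_pos (by positivity : 0 < 1 / p)).1 h3
  · have h4 : ∀ k ∈ Finset.range (ℓ + 1), ∑ d', eLpNorm (g k d') (ENNReal.ofReal p) volume ≤
        ∑ k ∈ Finset.range (ℓ + 1), ∑ d' : Fin k → Fin (n - 1), eLpNorm (g k d') (ENNReal.ofReal p) volume :=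
      fun k hk => Finset.single_le_sum
        (f := fun k => ∑ d' : Fin k → Fin (n - 1), eLpNorm (g k d') (ENNReal.ofReal p) volume)
        (fun _ _ => zero_le) hk
    set S := ∑ k ∈ Finset.range (ℓ + 1), ∑ d' : Fin k → Fin (n - 1), eLpNorm (g k d') (ENNReal.ofReal p) volume
    calc _ ≤ ∑ k ∈ Finset.range (ℓ + 1), ∑ dd : Fin k → Fin n, (C k dd : ℝ≥0∞) * S := by
          refine Finset.sum_le_sum fun k hk => Finset.sum_le_sum fun dd _ => ?_
          refine (hC k (by simpa [Nat.lt_succ_iff] using hk) dd f g hf hg).trans ?_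
          gcongr
          exact h4 k hk
      _ = (C0 : ℝ≥0∞) * S := by
          simp only [← Finset.sum_mul, C0]
          push_cast
          rfl
      _ ≤ _ := by
          gcongr
          · rw [← ENNReal.ofReal_coe_nnreal]
            exact ENNReal.ofReal_le_ofReal (by linarith)
          · exact le_add_self


end
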